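/- Let d ≥ 1, let Γ be a d×d symmetric positive definite real matrix, and let R be a d×d P-matrix. Suppose that for each r ∈ (0,1) there are Borel probability measures π^r, ν_1^r, …, ν_d^r on ℝ₊^d satisfying the basic adjoint relationship, and that the uniform moment bound condition holds. Then, as r → 0, the pushforward of π^r under the map z ↦ (r z_1, r² z_2, …, r^d z_d) converges weakly to the law of a vector (Z_1*, …, Z_d*) of independent random variables in which Z_k* is exponentially distributed with mean m_k = (u_kᵀ Γ u_k)/(2 u_kᵀ R_{:,k}); moreover m_k > 0 for every k ∈ {1,…,d}. -/

import Mathlib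

open MeasureTheory Filter

noncomputable section

namespace SRBMPaper

/-- The nonnegative orthant `ℝ₊^d`. -/
def posOrthant (d : ℕ) : Set (Fin d → ℝ) := {z | ∀ i, 0 ≤ z i}

/-- `R` is a P-matrix: every principal minor is positive. -/
def IsPMatrix {d : ℕ} (R : Matrix (Fin d) (Fin d) ℝ) : Prop :=
  ∀ s : Finset (Fin d),
    0 < (R.submatrix (fun i : s => (i : Fin d)) (fun i : s => (i : Fin d))).det

/-- `R` is a nonsingular M-matrix: nonpositive off-diagonal entries and
every principal minor positive. -/
def IsMMatrix {d : ℕ} (R : Matrix (Fin d) (Fin d) ℝ) : Prop :=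
  (∀ i j, i ≠ j → R i j ≤ 0) ∧ IsPMatrix R

/-- First-order partial derivative of `f` in coordinate `j`. -/
def pd1 {d : ℕ} (f : (Fin d → ℝ) → ℝ) (j : Fin d) (z : Fin d → ℝ) : ℝ :=
  fderiv ℝ f z (Pi.single j 1)

/-- Second-order partial derivative of `f` in coordinates `i`, `j`. -/
def pd2 {d : ℕ} (f : (Fin d → ℝ) → ℝ) (i j : Fin d) (z : Fin d → ℝ) : ℝ :=
  fderiv ℝ (fun w => pd1 f j w) z (Pi.single i 1)

/-- `f` is twice continuously differentiable and `f` together with all of its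
first- and second-order partial derivatives is bounded on the orthant. -/
def IsC2Bounded {d : ℕ} (f : (Fin d → ℝ) → ℝ) : Prop :=
  ContDiff ℝ 2 f ∧
    ∃ C : ℝ, ∀ z ∈ posOrthant d,
      |f z| ≤ C ∧ (∀ j, |pd1 f j z| ≤ C) ∧ (∀ i j, |pd2 f i j z| ≤ C)

/-- The basic adjoint relationship (BAR) at traffic-intensity parameter `r`. -/
def SatisfiesBAR {d : ℕ} (Γ R : Matrix (Fin d) (Fin d) ℝ) (r : ℝ)
    (π : Measure (Fin d → ℝ)) (ν : Fin d → Measure (Fin d → ℝ)) : Prop :=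
  ∀ f : (Fin d → ℝ) → ℝ, IsC2Bounded f →
    (1 / 2) * (∫ z, ∑ i, ∑ j, Γ i j * pd2 f i j z ∂π)
      - (∑ i : Fin d, r ^ ((i : ℕ) + 1) * ∫ z, ∑ j, R j i * pd1 f j z ∂π)
      + (∑ i : Fin d, r ^ ((i : ℕ) + 1) * ∫ z, ∑ j, R j i * pd1 f j z ∂(ν i)) = 0

/-- For every `r ∈ (0,1)`, `π r` is a Borel probability measure on the orthant,
each `ν i r` is a Borel probability measure on the face `{z i = 0}` of the orthant,
and together they satisfy the basic adjoint relationship. -/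
def BARFamily {d : ℕ} (Γ R : Matrix (Fin d) (Fin d) ℝ)
    (π : ℝ → Measure (Fin d → ℝ)) (ν : Fin d → ℝ → Measure (Fin d → ℝ)) : Prop :=
  ∀ r ∈ Set.Ioo (0 : ℝ) 1,
    IsProbabilityMeasure (π r) ∧ π r (posOrthant d) = 1 ∧
    (∀ i, IsProbabilityMeasure (ν i r) ∧
      ν i r {z | z ∈ posOrthant d ∧ z i = 0} = 1) ∧
    SatisfiesBAR Γ R r (π r) (fun i => ν i r)

/-- `u` is the vector `u_k` associated with the matrix `R`:
`u_k = (w_{1k}, …, w_{k-1,k}, 1, 0, …, 0)ᵀ` where the weights solve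
`∑_{j<k} w_{jk} R_{jℓ} + R_{kℓ} = 0` for all `ℓ < k`. -/
def IsUk {d : ℕ} (R : Matrix (Fin d) (Fin d) ℝ) (k : Fin d) (u : Fin d → ℝ) : Prop :=
  u k = 1 ∧ (∀ j, k < j → u j = 0) ∧
    ∀ ℓ, ℓ < k →
      (∑ j ∈ Finset.univ.filter (fun j => j < k), u j * R j ℓ) + R k ℓ = 0

/-- `uᵀ R_{:,i}`, the pairing of `u` with the `i`-th column of `R`. -/
def uR {d : ℕ} (R : Matrix (Fin d) (Fin d) ℝ) (u : Fin d → ℝ) (i : Fin d) : ℝ :=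
  ∑ j, u j * R j i

/-- The quadratic form `uᵀ Γ u`. -/
def quadForm {d : ℕ} (Γ : Matrix (Fin d) (Fin d) ℝ) (u : Fin d → ℝ) : ℝ :=
  ∑ i, ∑ j, u i * Γ i j * u j

/-- The limiting mean `m_k = (u_kᵀ Γ u_k) / (2 u_kᵀ R_{:,k})`. -/
def meanOf {d : ℕ} (Γ R : Matrix (Fin d) (Fin d) ℝ) (u : Fin d → ℝ) (k : Fin d) : ℝ :=
  quadForm Γ u / (2 * uR R u k)

/-- The exponential distribution on `ℝ` with mean `m`. -/
def expMean (m : ℝ) : Measure ℝ :=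
  (volume : Measure ℝ).withDensity fun x =>
    ENNReal.ofReal (if 0 ≤ x then m⁻¹ * Real.exp (-x / m) else 0)

/-- The law of a vector of independent exponential random variables with means `m k`. -/
def prodExp {d : ℕ} (m : Fin d → ℝ) : Measure (Fin d → ℝ) :=
  Measure.pi fun k => expMean (m k)

/-- The pushforwards of `π r` under `z ↦ (r z_1, r² z_2, …, r^d z_d)` converge weakly
to `μ` as `r → 0` (convergence tested against bounded continuous functions). -/
def ScaledWeakLimit {d : ℕ} (π : ℝ → Measure (Fin d → ℝ)) (μ : Measure (Fin d → ℝ)) : Prop :=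
  ∀ g : BoundedContinuousFunction (Fin d → ℝ) ℝ,
    Tendsto (fun r : ℝ => ∫ z, g (fun i => r ^ ((i : ℕ) + 1) * z i) ∂(π r))
      (nhdsWithin 0 (Set.Ioo 0 1)) (nhds (∫ z, g z ∂μ))

/-- The uniform moment bound condition: for all coordinates `i, k`, the `d`-th moment
of `r^k Z_k` under `π r` is bounded for small `r`, and `r` times its `d`-th moment
under `ν i r` tends to `0` as `r → 0`. -/
def UniformMomentBound {d : ℕ} (π : ℝ → Measure (Fin d → ℝ))
    (ν : Fin d → ℝ → Measure (Fin d → ℝ)) : Prop :=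
  ∀ i k : Fin d,
    (∃ r₁ > (0 : ℝ), ∃ C : ℝ, ∀ r ∈ Set.Ioo (0 : ℝ) (min r₁ 1),
      (∫ z, (r ^ ((k : ℕ) + 1) * z k) ^ d ∂(π r)) ≤ C) ∧
    Tendsto (fun r : ℝ => r * ∫ z, (r ^ ((k : ℕ) + 1) * z k) ^ d ∂(ν i r))
      (nhdsWithin 0 (Set.Ioo 0 1)) (nhds 0)

/-- The truncation function `κ`. -/
def kappa (x : ℝ) : ℝ :=
  if x ≤ 1 then x
  else if x ≤ 2 then 3*x^5 - 22*x^4 + 62*x^3 - 84*x^2 + 56*x - 14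
  else 2

/-- The vector `θ_k^{(r)} = ∑_{ℓ=k}^d r^ℓ η_ℓ u_ℓ`. -/
def thetaK {d : ℕ} (u : Fin d → Fin d → ℝ) (η : Fin d → ℝ) (k : Fin d) (r : ℝ) :
    Fin d → ℝ :=
  fun j => ∑ ℓ ∈ Finset.univ.filter (fun ℓ => k ≤ ℓ), r ^ ((ℓ : ℕ) + 1) * η ℓ * u ℓ j

/-- The vector `θ̃_k^{(r)} = r^{k+1/2} η_k u_k + ∑_{ℓ=k+1}^d r^ℓ η_ℓ u_ℓ`. -/
def thetaKt {d : ℕ} (u : Fin d → Fin d → ℝ) (η : Fin d → ℝ) (k : Fin d) (r : ℝ) :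
    Fin d → ℝ :=
  fun j => r ^ ((((k : ℕ) : ℝ) + 1) + 1/2) * η k * u k j
    + ∑ ℓ ∈ Finset.univ.filter (fun ℓ => k < ℓ), r ^ ((ℓ : ℕ) + 1) * η ℓ * u ℓ j

/-- The truncated exponential test function `f̃_θ(z) = exp(∑ κ(θ_i z_i))`. -/
def ftilde {d : ℕ} (θ z : Fin d → ℝ) : ℝ := Real.exp (∑ i, kappa (θ i * z i))

/-- Gradient extra term `ε_{g,θ,j}(z) = θ_j (κ'(θ_j z_j) − 1)`. -/
def epsG {d : ℕ} (θ : Fin d → ℝ) (j : Fin d) (z : Fin d → ℝ) : ℝ :=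
  θ j * (deriv kappa (θ j * z j) - 1)

/-- Hessian extra term `ε_{H,θ,ij}(z)`. -/
def epsH {d : ℕ} (θ : Fin d → ℝ) (i j : Fin d) (z : Fin d → ℝ) : ℝ :=
  θ i * θ j * (deriv kappa (θ i * z i) * deriv kappa (θ j * z j) - 1)
    + (if i = j then θ i ^ 2 * deriv (deriv kappa) (θ i * z i) else 0)

/-- The extra term `γ^r(θ)` in the truncated MGF-BAR. -/
def gammaTerm {d : ℕ} (Γ R : Matrix (Fin d) (Fin d) ℝ) (r : ℝ)
    (π : Measure (Fin d → ℝ)) (ν : Fin d → Measure (Fin d → ℝ))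
    (θ : Fin d → ℝ) : ℝ :=
  (1/2) * (∫ z, (∑ i, ∑ j, Γ i j * epsH θ i j z) * ftilde θ z ∂π)
    + ∑ i : Fin d, r ^ ((i : ℕ) + 1) *
        ((∫ z, (∑ j, epsG θ j z * R j i) * ftilde θ z ∂(ν i))
          - ∫ z, (∑ j, epsG θ j z * R j i) * ftilde θ z ∂π)

/-- A vector supported on `K` with prescribed pairings with the columns of `R` indexed by `K`. -/
theorem IsPMatrix.exists_vec {d : ℕ} {R : Matrix (Fin d) (Fin d) ℝ} (hR : IsPMatrix R)
    (K : Finset (Fin d)) (b : Fin d → ℝ) :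
    ∃ v : Fin d → ℝ, (∀ i, i ∉ K → v i = 0) ∧ ∀ i ∈ K, uR R v i = b i := by
  set M : Matrix K K ℝ := R.submatrix (fun i : K => (i : Fin d)) (fun i : K => (i : Fin d))
    with hM
  have hdet : IsUnit M.det := (hR K).ne'.isUnit
  set w : K → ℝ := Matrix.vecMul (fun i : K => b i) M⁻¹ with hw
  have hwM : Matrix.vecMul w M = fun i : K => b i := by
    rw [hw, Matrix.vecMul_vecMul, Matrix.nonsing_inv_mul _ hdet, Matrix.vecMul_one]
  refine ⟨fun i => if h : i ∈ K then w ⟨i, h⟩ else 0, fun i hi => by simp [hi], fun i hi => ?_⟩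
  have := congrFun hwM ⟨i, hi⟩
  simp only [Matrix.vecMul, dotProduct, hM, Matrix.submatrix_apply] at this
  rw [← this, uR, ← Finset.sum_subset (Finset.subset_univ K) (fun a _ ha => by simp [ha]),
    ← Finset.sum_coe_sort K]
  exact Finset.sum_congr rfl fun a _ => by simp

theorem IsPMatrix.eq_zero_of_uR_eq_zero {d : ℕ} {R : Matrix (Fin d) (Fin d) ℝ}
    (hR : IsPMatrix R) (K : Finset (Fin d)) (v : Fin d → ℝ) (hv : ∀ i, i ∉ K → v i = 0)
    (h : ∀ i ∈ K, uR R v i = 0) : v = 0 := by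
  set M : Matrix K K ℝ := R.submatrix (fun i : K => (i : Fin d)) (fun i : K => (i : Fin d))
    with hM
  have h0 : Matrix.vecMul (fun i : K => v i) M = 0 := by
    ext i
    have := h i i.2
    rw [uR, ← Finset.sum_subset (Finset.subset_univ K) (fun a _ ha => by simp [hv a ha]),
      ← Finset.sum_coe_sort K] at this
    simpa [Matrix.vecMul, dotProduct, hM] using this
  have h1 := Matrix.eq_zero_of_vecMul_eq_zero (hR K).ne' h0
  ext i
  by_cases hi : i ∈ K
  · exact congrFun h1 ⟨i, hi⟩
  · exact hv i hi

theorem IsPMatrix.uR_pos {d : ℕ} {R : Matrix (Fin d) (Fin d) ℝ} (hR : IsPMatrix R)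
    {K : Finset (Fin d)} {j : Fin d} (hj : j ∉ K) (v : Fin d → ℝ)
    (hv : ∀ i, i ∉ insert j K → v i = 0) (hvj : v j = 1) (h : ∀ i ∈ K, uR R v i = 0) :
    0 < uR R v j := by
  set K' := insert j K with hK'
  let j' : K' := ⟨j, Finset.mem_insert_self _ _⟩
  set M : Matrix K' K' ℝ := R.submatrix (fun i : K' => (i : Fin d)) (fun i : K' => (i : Fin d))
    with hM
  have hrow : (∑ k : K', v k • M k) = fun i : K' => uR R v i := by
    ext i
    rw [uR, ← Finset.sum_subset (Finset.subset_univ K') (fun a _ ha => by simp [hv a ha]),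
      ← Finset.sum_coe_sort K']
    simp [Finset.sum_apply, hM]
  have hd := Matrix.det_updateRow_sum M j' (fun k : K' => v k)
  rw [hrow] at hd
  have hvj' : v (j' : Fin d) = 1 := hvj
  rw [hvj', one_smul] at hd
  let e : K ⊕ Unit ≃ K' :=
    (Equiv.optionEquivSumPUnit _).symm.trans (Finset.subtypeInsertEquivOption hj).symm
  have he1 : ∀ a : K, ((e (Sum.inl a) : K') : Fin d) = a := fun a => rfl
  have he2 : ∀ a : Unit, e (Sum.inr a) = j' := fun a => rfl
  rw [← Matrix.det_submatrix_equiv_self e] at hd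
  have hblock : (M.updateRow j' (fun i : K' => uR R v i)).submatrix e e =
      Matrix.fromBlocks (R.submatrix (fun i : K => (i : Fin d)) (fun i : K => (i : Fin d)))
        (Matrix.of fun (a : K) (_ : Unit) => R a j) (0 : Matrix Unit K ℝ)
        (Matrix.of fun _ _ : Unit => uR R v j) := by
    ext a b
    have hne : ∀ a : K, e (Sum.inl a) ≠ j' := by
      intro a ha
      have h1 : (a : Fin d) = j := congrArg (fun x : K' => (x : Fin d)) ha
      exact hj (h1 ▸ a.2)
    rcases a with a | a <;> rcases b with b | b
    · simp [Matrix.updateRow_ne (hne a), hM, he1]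
    · simp [Matrix.updateRow_ne (hne a), hM, he1, he2, j']
    · simp [he2, he1, h b b.2]
    · simp [he2, j']
  rw [hblock, Matrix.det_fromBlocks_zero₂₁] at hd
  have hu : Matrix.det (Matrix.of fun _ _ : Unit => uR R v j) = uR R v j := by
    rw [Matrix.det_unique, Matrix.of_apply]
  rw [hu] at hd
  have h1 := hR K
  have h2 := hR K'
  rw [← hM, ← hd] at h2
  exact pos_of_mul_pos_right h2 h1.le

theorem IsUk.uR_eq_zero {d : ℕ} {R : Matrix (Fin d) (Fin d) ℝ} {k : Fin d} {u : Fin d → ℝ}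
    (hu : IsUk R k u) {l : Fin d} (hl : l < k) : uR R u l = 0 := by
  obtain ⟨h1, h2, h3⟩ := hu
  rw [← h3 l hl, uR, ← Finset.sum_filter_add_sum_filter_not Finset.univ (fun j => j < k)]
  congr 1
  rw [Finset.sum_eq_single k]
  · simp [h1]
  · intro b hb hbk
    have : k < b := lt_of_le_of_ne (by simpa using hb) (Ne.symm hbk)
    simp [h2 b this]
  · simp

theorem IsUk.uR_pos {d : ℕ} {R : Matrix (Fin d) (Fin d) ℝ} (hR : IsPMatrix R) {k : Fin d}
    {u : Fin d → ℝ} (hu : IsUk R k u) : 0 < uR R u k := by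
  refine hR.uR_pos (K := Finset.Iio k) (by simp) u (fun i hi => hu.2.1 i ?_) hu.1
    fun i hi => hu.uR_eq_zero (Finset.mem_Iio.1 hi)
  simp only [Finset.mem_insert, Finset.mem_Iio, not_or, not_lt] at hi
  exact lt_of_le_of_ne hi.2 (Ne.symm hi.1)

theorem quadForm_pos {d : ℕ} {Γ : Matrix (Fin d) (Fin d) ℝ} (hΓ : Γ.PosDef) {u : Fin d → ℝ}
    (hu : u ≠ 0) : 0 < quadForm Γ u := by
  have h := hΓ.dotProduct_mulVec_pos hu
  have e : star u ⬝ᵥ Γ.mulVec u = quadForm Γ u := by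
    simp [quadForm, dotProduct, Matrix.mulVec, Finset.mul_sum, mul_assoc]
  rwa [e] at h

theorem meanOf_pos {d : ℕ} {Γ R : Matrix (Fin d) (Fin d) ℝ} (hΓ : Γ.PosDef) (hR : IsPMatrix R)
    {k : Fin d} {u : Fin d → ℝ} (hu : IsUk R k u) : 0 < meanOf Γ R u k := by
  have h0 : u ≠ 0 := fun h => by simpa [h] using hu.1
  exact div_pos (quadForm_pos hΓ h0) (mul_pos two_pos (hu.uR_pos hR))

theorem uR_add {d : ℕ} (R : Matrix (Fin d) (Fin d) ℝ) (v w : Fin d → ℝ) (i : Fin d) :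
    uR R (v + w) i = uR R v i + uR R w i := by
  simp [uR, add_mul, Finset.sum_add_distrib]

theorem uR_smul {d : ℕ} (R : Matrix (Fin d) (Fin d) ℝ) (c : ℝ) (v : Fin d → ℝ) (i : Fin d) :
    uR R (c • v) i = c * uR R v i := by
  simp [uR, Finset.mul_sum, mul_assoc]

theorem uR_sum {d : ℕ} {ι : Type*} (R : Matrix (Fin d) (Fin d) ℝ) (s : Finset ι)
    (v : ι → Fin d → ℝ) (i : Fin d) : uR R (∑ a ∈ s, v a) i = ∑ a ∈ s, uR R (v a) i := by
  simp only [uR, Finset.sum_apply, Finset.sum_mul]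
  exact Finset.sum_comm

theorem uR_single {d : ℕ} (R : Matrix (Fin d) (Fin d) ℝ) (j i : Fin d) :
    uR R (Pi.single j 1) i = R j i := by
  simp [uR, Pi.single_apply]

/-- For a P-matrix, a vector supported on `insert j (Iio j ∪ K)` that is orthogonal to the columns
below `j`, positively paired with column `j` and negatively paired with the columns in `K`. -/
theorem IsPMatrix.exists_vec_signs {d : ℕ} {R : Matrix (Fin d) (Fin d) ℝ} (hR : IsPMatrix R)
    (j : Fin d) (K : Finset (Fin d)) (hK : K ⊆ Finset.Ioi j) :
    ∃ c > 0, ∃ v : Fin d → ℝ, v j = 1 ∧ (∀ i, j < i → i ∉ K → v i = 0) ∧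
      (∀ i, i < j → uR R v i = 0) ∧ c ≤ uR R v j ∧ ∀ i ∈ K, uR R v i ≤ -c := by
  have hjK : ∀ i ∈ K, j < i := fun i hi => Finset.mem_Ioi.1 (hK hi)
  set K0 := Finset.Iio j ∪ K with hK0
  have hj : j ∉ K0 := by
    intro h
    rcases Finset.mem_union.1 h with h | h
    · simp at h
    · exact lt_irrefl _ (hjK _ h)
  obtain ⟨v, hv, hv'⟩ := hR.exists_vec K0 (fun i => -R j i)
  obtain ⟨x, hx, hx'⟩ := hR.exists_vec K0 (fun i => if i < j then 0 else -1)
  set w := v + Pi.single j 1 with hw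
  have hwj : w j = 1 := by simp [hw, hv j hj]
  have hw0 : ∀ i ∈ K0, uR R w i = 0 := fun i hi => by
    rw [hw, uR_add, hv' i hi, uR_single]; ring
  have hpos : 0 < uR R w j := by
    refine hR.uR_pos hj w (fun i hi => ?_) hwj hw0
    simp only [Finset.mem_insert, not_or] at hi
    simp [hw, hv i hi.2, hi.1]
  set η := uR R w j / (2 * (|uR R x j| + 1)) with hη
  have hη0 : 0 < η := by positivity
  have hbd : η * |uR R x j| ≤ uR R w j / 2 := by
    rw [hη, div_mul_eq_mul_div, div_le_div_iff₀ (by positivity) two_pos]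
    nlinarith [abs_nonneg (uR R x j)]
  refine ⟨min η (uR R w j / 2), by positivity, w + η • x, ?_, ?_, ?_, ?_, ?_⟩
  · simp [hwj, hx j hj]
  · intro i hi hiK
    have : i ∉ K0 := by simp [hK0, hiK, hi.le]
    simp [hw, hv i this, hx i this, hi.ne']
  · intro i hi
    have : i ∈ K0 := by simp [hK0, hi]
    rw [uR_add, uR_smul, hw0 i this, hx' i this]; simp [hi]
  · rw [uR_add R w, uR_smul]
    refine (min_le_right _ _).trans ?_
    have := neg_abs_le (uR R x j)
    nlinarith
  · intro i hi
    have : i ∈ K0 := by simp [hK0, hi]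
    rw [uR_add, uR_smul, hw0 i this, hx' i this]
    simp only [(hjK i hi).not_gt, if_false]
    linarith [min_le_left η (uR R w j / 2)]

/-- Reduced coordinates at level `j`: the rows `p a`, `j ≤ a`, are orthogonal to the columns of `R`
below `j`, and for each `K ⊆ Ioi j` a combination of the rows in `insert j K` has the sign pattern
needed for a Lyapunov function. -/
theorem IsPMatrix.exists_reduction {d : ℕ} {R : Matrix (Fin d) (Fin d) ℝ} (hR : IsPMatrix R)
    (j : Fin d) :
    ∃ c > 0, ∃ p : Fin d → Fin d → ℝ, ∃ V : Finset (Fin d) → Fin d → ℝ,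
      (∀ a, j ≤ a → p a a = 1) ∧ (∀ a b, j ≤ b → b ≠ a → p a b = 0) ∧
      (∀ a m, m < j → uR R (p a) m = 0) ∧
      (∀ K, V K j = 1) ∧
      (∀ K, K ⊆ Finset.Ioi j → c ≤ ∑ a ∈ insert j K, V K a * uR R (p a) j) ∧
      (∀ K, K ⊆ Finset.Ioi j → ∀ m ∈ K, ∑ a ∈ insert j K, V K a * uR R (p a) m ≤ -c) := by
  have hp : ∀ a : Fin d, ∃ p : Fin d → ℝ, (j ≤ a → p a = 1) ∧ (∀ b, j ≤ b → b ≠ a → p b = 0) ∧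
      ∀ m, m < j → uR R p m = 0 := by
    intro a
    by_cases ha : j ≤ a
    · obtain ⟨v, hv, hv'⟩ := hR.exists_vec (Finset.Iio j) (fun i => -R a i)
      refine ⟨v + Pi.single a 1, fun _ => ?_, fun b hb hba => ?_, fun m hm => ?_⟩
      · simp [hv a (by simpa using ha)]
      · simp [hv b (by simpa using hb), hba]
      · rw [uR_add, uR_single, hv' m (by simpa using hm)]; ring
    · exact ⟨0, fun h => absurd h ha, fun b _ _ => rfl, fun m _ => by simp [uR]⟩
  choose p hp1 hp2 hp3 using hp
  have hV : ∀ K : Finset (Fin d), ∃ c > 0, ∃ v : Fin d → ℝ, v j = 1 ∧ (K ⊆ Finset.Ioi j →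
      (∀ i, j < i → i ∉ K → v i = 0) ∧
      (∀ i, i < j → uR R v i = 0) ∧ c ≤ uR R v j ∧ ∀ i ∈ K, uR R v i ≤ -c) := by
    intro K
    by_cases hK : K ⊆ Finset.Ioi j
    · obtain ⟨c, hc, v, h1, h2⟩ := hR.exists_vec_signs j K hK
      exact ⟨c, hc, v, h1, fun _ => h2⟩
    · exact ⟨1, one_pos, Pi.single j 1, by simp, fun h => absurd h hK⟩
  choose c hc V hV1 hV2 using hV
  obtain ⟨K0, hK0⟩ := Finite.exists_min c
  have key : ∀ K, K ⊆ Finset.Ioi j → ∀ m,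
      ∑ a ∈ insert j K, V K a * uR R (p a) m = uR R (V K) m := by
    intro K hK m
    obtain ⟨h2, h3, -, -⟩ := hV2 K hK
    have hz : V K + (-1 : ℝ) • (∑ a ∈ insert j K, V K a • p a) = 0 := by
      refine hR.eq_zero_of_uR_eq_zero (Finset.Iio j) _ (fun i hi => ?_) (fun i hi => ?_)
      · have hi' : j ≤ i := by simpa using hi
        simp only [Pi.add_apply, Pi.smul_apply, Finset.sum_apply, smul_eq_mul]
        by_cases hiK : i ∈ insert j K
        · rw [Finset.sum_eq_single_of_mem i hiK
            (fun b _ hb => by rw [hp2 b i hi' hb.symm, mul_zero]), hp1 i hi']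
          ring
        · have hiK' := hiK
          simp only [Finset.mem_insert, not_or] at hiK'
          rw [Finset.sum_eq_zero fun b hb => by
            rw [hp2 b i hi' (fun h => hiK (h ▸ hb)), mul_zero],
            h2 i (lt_of_le_of_ne hi' (Ne.symm hiK'.1)) hiK'.2]
          ring
      · have hi' : i < j := by simpa using hi
        rw [uR_add, uR_smul, uR_sum, h3 i hi']
        simp [uR_smul, hp3 _ i hi']
    have hz' : V K = ∑ a ∈ insert j K, V K a • p a := by
      rw [neg_one_smul, ← sub_eq_add_neg, sub_eq_zero] at hz
      exact hz
    conv_rhs => rw [hz', uR_sum]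
    simp [uR_smul]
  refine ⟨c K0, hc K0, p, V, hp1, hp2, hp3, hV1, fun K hK => ?_, fun K hK m hm => ?_⟩
  · rw [key K hK]; exact (hK0 K).trans (hV2 K hK).2.2.1
  · rw [key K hK]; linarith [hK0 K, (hV2 K hK).2.2.2 m hm]

theorem differentiable_pd1 {d : ℕ} {f : (Fin d → ℝ) → ℝ} (hf : ContDiff ℝ 2 f) (j : Fin d) :
    Differentiable ℝ fun z => pd1 f j z := by
  have h : ContDiff ℝ 1 (fderiv ℝ f) := hf.fderiv_right (by norm_num)
  exact (h.differentiable one_ne_zero).clm_apply (differentiable_const _)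

theorem continuous_pd1 {d : ℕ} {f : (Fin d → ℝ) → ℝ} (hf : ContDiff ℝ 2 f) (j : Fin d) :
    Continuous fun z => pd1 f j z := (differentiable_pd1 hf j).continuous

theorem contDiff_pd1 {d : ℕ} {f : (Fin d → ℝ) → ℝ} (hf : ContDiff ℝ 2 f) (j : Fin d) :
    ContDiff ℝ 1 fun z => pd1 f j z := by
  have h : ContDiff ℝ 1 (fderiv ℝ f) := hf.fderiv_right (by norm_num)
  exact h.clm_apply contDiff_const

theorem continuous_pd2 {d : ℕ} {f : (Fin d → ℝ) → ℝ} (hf : ContDiff ℝ 2 f) (i j : Fin d) :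
    Continuous fun z => pd2 f i j z :=
  ((contDiff_pd1 hf j).continuous_fderiv one_ne_zero).clm_apply continuous_const

theorem pd1_sin_mul {d : ℕ} {f : (Fin d → ℝ) → ℝ} (hf : ContDiff ℝ 2 f) {κ : ℝ} (hκ : κ ≠ 0)
    (j : Fin d) (z : Fin d → ℝ) :
    pd1 (fun z => Real.sin (κ * f z) / κ) j z = Real.cos (κ * f z) * pd1 f j z := by
  have hd : HasFDerivAt f (fderiv ℝ f z) z :=
    (hf.differentiable two_ne_zero z).hasFDerivAt
  have := ((hd.const_mul κ).sin).mul_const κ⁻¹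
  simp only [← div_eq_mul_inv] at this
  rw [pd1, this.fderiv]
  simp [pd1]
  field_simp

theorem pd2_sin_mul {d : ℕ} {f : (Fin d → ℝ) → ℝ} (hf : ContDiff ℝ 2 f) {κ : ℝ} (hκ : κ ≠ 0)
    (i j : Fin d) (z : Fin d → ℝ) :
    pd2 (fun z => Real.sin (κ * f z) / κ) i j z =
      Real.cos (κ * f z) * pd2 f i j z
        - κ * (Real.sin (κ * f z) * (pd1 f i z * pd1 f j z)) := by
  have hd : HasFDerivAt f (fderiv ℝ f z) z :=
    (hf.differentiable two_ne_zero z).hasFDerivAt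
  have hd1 := (differentiable_pd1 hf j z).hasFDerivAt
  have h2 := ((hd.const_mul κ).cos).mul hd1
  have : (fun w => pd1 (fun z => Real.sin (κ * f z) / κ) j w) =
      fun w => Real.cos (κ * f w) * pd1 f j w := funext fun w => pd1_sin_mul hf hκ j w
  have h3 : HasFDerivAt (fun w => Real.cos (κ * f w) * pd1 f j w) _ z := h2
  rw [pd2, this, h3.fderiv]
  simp [pd1, pd2]
  ring

theorem IsC2Bounded.sin_mul {d : ℕ} {f : (Fin d → ℝ) → ℝ} (hf : ContDiff ℝ 2 f) {C : ℝ}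
    (h1 : ∀ j z, |pd1 f j z| ≤ C) (h2 : ∀ i j z, |pd2 f i j z| ≤ C) {κ : ℝ} (hκ : 0 < κ) :
    IsC2Bounded fun z => Real.sin (κ * f z) / κ := by
  have hsin : ∀ x, |Real.sin x| ≤ 1 := Real.abs_sin_le_one
  have hcos : ∀ x, |Real.cos x| ≤ 1 := Real.abs_cos_le_one
  refine ⟨?_, max (max (1 / κ) C) (C + κ * (C * C)), fun z _ => ⟨?_, fun j => ?_, fun i j => ?_⟩⟩
  · exact ((contDiff_const.mul hf).sin).div_const κ
  · refine le_max_of_le_left (le_max_of_le_left ?_)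
    rw [abs_div, abs_of_pos hκ]
    gcongr
    exact hsin _
  · refine le_max_of_le_left (le_max_of_le_right ?_)
    rw [pd1_sin_mul hf hκ.ne', abs_mul]
    exact (mul_le_of_le_one_left (abs_nonneg _) (hcos _)).trans (h1 j z)
  · refine le_max_of_le_right ?_
    have hC : 0 ≤ C := (abs_nonneg _).trans (h1 j z)
    rw [pd2_sin_mul hf hκ.ne']
    refine (abs_sub _ _).trans (add_le_add ?_ ?_)
    · rw [abs_mul]
      exact (mul_le_of_le_one_left (abs_nonneg _) (hcos _)).trans (h2 i j z)
    · rw [abs_mul, abs_mul, abs_mul, abs_of_pos hκ]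
      refine mul_le_mul_of_nonneg_left ?_ hκ.le
      refine (mul_le_of_le_one_left (by positivity) (hsin _)).trans ?_
      exact mul_le_mul (h1 i z) (h1 j z) (abs_nonneg _) hC

theorem tendsto_integral_sum_sin_mul {d : ℕ} {f : (Fin d → ℝ) → ℝ} (hf : ContDiff ℝ 2 f) {C : ℝ}
    (h1 : ∀ j z, |pd1 f j z| ≤ C) (μ : Measure (Fin d → ℝ)) [IsFiniteMeasure μ]
    (a : Fin d → ℝ) :
    Tendsto (fun κ : ℝ => ∫ z, ∑ j, a j * pd1 (fun z => Real.sin (κ * f z) / κ) j z ∂μ)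
      (nhdsWithin 0 (Set.Ioi 0)) (nhds (∫ z, ∑ j, a j * pd1 f j z ∂μ)) := by
  have hev : ∀ᶠ κ : ℝ in nhdsWithin 0 (Set.Ioi 0), 0 < κ := self_mem_nhdsWithin
  have hid : Tendsto (fun κ : ℝ => κ) (nhdsWithin 0 (Set.Ioi 0)) (nhds 0) :=
    tendsto_nhdsWithin_of_tendsto_nhds tendsto_id
  have hcos : ∀ z, Tendsto (fun κ : ℝ => Real.cos (κ * f z)) (nhdsWithin 0 (Set.Ioi 0))
      (nhds (Real.cos (0 * f z))) :=
    fun z => (Real.continuous_cos.tendsto _).comp (hid.mul_const _)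
  refine tendsto_integral_filter_of_dominated_convergence (fun _ => ∑ j, |a j| * C) ?_ ?_
    (integrable_const _) ?_
  · filter_upwards [hev] with κ hκ
    simp only [pd1_sin_mul hf hκ.ne']
    have := continuous_pd1 hf
    have := hf.continuous
    exact Continuous.aestronglyMeasurable (by fun_prop)
  · filter_upwards [hev] with κ hκ
    refine ae_of_all _ fun z => ?_
    simp only [pd1_sin_mul hf hκ.ne', Real.norm_eq_abs]
    refine (Finset.abs_sum_le_sum_abs _ _).trans (Finset.sum_le_sum fun j _ => ?_)
    rw [abs_mul, abs_mul]
    gcongr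
    exact (mul_le_of_le_one_left (abs_nonneg _) (Real.abs_cos_le_one _)).trans (h1 j z)
  · refine ae_of_all _ fun z => ?_
    have : Tendsto (fun κ : ℝ => ∑ j, a j * (Real.cos (κ * f z) * pd1 f j z))
        (nhdsWithin 0 (Set.Ioi 0)) (nhds (∑ j, a j * (Real.cos (0 * f z) * pd1 f j z))) := by
      refine tendsto_finsetSum _ fun j _ => ?_
      exact ((hcos z).mul_const _).const_mul _
    simp only [zero_mul, Real.cos_zero, one_mul] at this
    refine this.congr' ?_
    filter_upwards [hev] with κ hκ
    simp only [pd1_sin_mul hf hκ.ne']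

theorem tendsto_integral_sum_sum_sin_mul {d : ℕ} {f : (Fin d → ℝ) → ℝ} (hf : ContDiff ℝ 2 f)
    {C : ℝ} (h1 : ∀ j z, |pd1 f j z| ≤ C) (h2 : ∀ i j z, |pd2 f i j z| ≤ C)
    (μ : Measure (Fin d → ℝ)) [IsFiniteMeasure μ] (Γ : Matrix (Fin d) (Fin d) ℝ) :
    Tendsto (fun κ : ℝ =>
        ∫ z, ∑ i, ∑ j, Γ i j * pd2 (fun z => Real.sin (κ * f z) / κ) i j z ∂μ)
      (nhdsWithin 0 (Set.Ioi 0)) (nhds (∫ z, ∑ i, ∑ j, Γ i j * pd2 f i j z ∂μ)) := by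
  have hev : ∀ᶠ κ : ℝ in nhdsWithin 0 (Set.Ioi 0), 0 < κ := self_mem_nhdsWithin
  have hev1 : ∀ᶠ κ : ℝ in nhdsWithin 0 (Set.Ioi 0), κ < 1 :=
    nhdsWithin_le_nhds (Iio_mem_nhds one_pos)
  have hid : Tendsto (fun κ : ℝ => κ) (nhdsWithin 0 (Set.Ioi 0)) (nhds 0) :=
    tendsto_nhdsWithin_of_tendsto_nhds tendsto_id
  have hcos : ∀ z, Tendsto (fun κ : ℝ => Real.cos (κ * f z)) (nhdsWithin 0 (Set.Ioi 0))
      (nhds (Real.cos (0 * f z))) :=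
    fun z => (Real.continuous_cos.tendsto _).comp (hid.mul_const _)
  have hsin : ∀ z, Tendsto (fun κ : ℝ => Real.sin (κ * f z)) (nhdsWithin 0 (Set.Ioi 0))
      (nhds (Real.sin (0 * f z))) :=
    fun z => (Real.continuous_sin.tendsto _).comp (hid.mul_const _)
  refine tendsto_integral_filter_of_dominated_convergence
    (fun _ => ∑ i, ∑ j, |Γ i j| * (C + C * C)) ?_ ?_ (integrable_const _) ?_
  · filter_upwards [hev] with κ hκ
    simp only [pd2_sin_mul hf hκ.ne']
    have := continuous_pd1 hf
    have := continuous_pd2 hf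
    have := hf.continuous
    exact Continuous.aestronglyMeasurable (by fun_prop)
  · filter_upwards [hev, hev1] with κ hκ hκ1
    refine ae_of_all _ fun z => ?_
    simp only [pd2_sin_mul hf hκ.ne', Real.norm_eq_abs]
    refine (Finset.abs_sum_le_sum_abs _ _).trans (Finset.sum_le_sum fun i _ => ?_)
    refine (Finset.abs_sum_le_sum_abs _ _).trans (Finset.sum_le_sum fun j _ => ?_)
    rw [abs_mul]
    have hC : 0 ≤ C := (abs_nonneg _).trans (h1 j z)
    gcongr
    refine (abs_sub _ _).trans (add_le_add ?_ ?_)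
    · rw [abs_mul]
      exact (mul_le_of_le_one_left (abs_nonneg _) (Real.abs_cos_le_one _)).trans (h2 i j z)
    · rw [abs_mul, abs_mul, abs_mul, abs_of_pos hκ]
      refine (mul_le_of_le_one_left (by positivity) hκ1.le).trans ?_
      refine (mul_le_of_le_one_left (by positivity) (Real.abs_sin_le_one _)).trans ?_
      exact mul_le_mul (h1 i z) (h1 j z) (abs_nonneg _) hC
  · refine ae_of_all _ fun z => ?_
    have : Tendsto (fun κ : ℝ => ∑ i, ∑ j, Γ i j * (Real.cos (κ * f z) * pd2 f i j z
          - κ * (Real.sin (κ * f z) * (pd1 f i z * pd1 f j z))))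
        (nhdsWithin 0 (Set.Ioi 0)) (nhds (∑ i, ∑ j, Γ i j * (Real.cos (0 * f z) * pd2 f i j z
          - 0 * (Real.sin (0 * f z) * (pd1 f i z * pd1 f j z))))) := by
      refine tendsto_finsetSum _ fun i _ => tendsto_finsetSum _ fun j _ => ?_
      exact (((hcos z).mul_const _).sub (hid.mul ((hsin z).mul_const _))).const_mul _
    simp only [zero_mul, Real.cos_zero, one_mul, sub_zero] at this
    refine this.congr' ?_
    filter_upwards [hev] with κ hκ
    simp only [pd2_sin_mul hf hκ.ne']

/-- The basic adjoint relationship extends to unbounded test functions with bounded first and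
second derivatives. -/
theorem SatisfiesBAR.of_bounded_derivs {d : ℕ} {Γ R : Matrix (Fin d) (Fin d) ℝ} {r : ℝ}
    {π : Measure (Fin d → ℝ)} {ν : Fin d → Measure (Fin d → ℝ)} [IsFiniteMeasure π]
    [∀ i, IsFiniteMeasure (ν i)] (h : SatisfiesBAR Γ R r π ν)
    {f : (Fin d → ℝ) → ℝ} (hf : ContDiff ℝ 2 f) {C : ℝ}
    (h1 : ∀ j z, |pd1 f j z| ≤ C) (h2 : ∀ i j z, |pd2 f i j z| ≤ C) :
    (1 / 2) * (∫ z, ∑ i, ∑ j, Γ i j * pd2 f i j z ∂π)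
      - (∑ i : Fin d, r ^ ((i : ℕ) + 1) * ∫ z, ∑ j, R j i * pd1 f j z ∂π)
      + (∑ i : Fin d, r ^ ((i : ℕ) + 1) * ∫ z, ∑ j, R j i * pd1 f j z ∂(ν i)) = 0 := by
  have ht := (((tendsto_integral_sum_sum_sin_mul hf h1 h2 π Γ).const_mul (1 / 2)).sub
    (tendsto_finsetSum Finset.univ fun i _ =>
      (tendsto_integral_sum_sin_mul hf h1 π (fun j => R j i)).const_mul
        (r ^ ((i : ℕ) + 1)))).add
    (tendsto_finsetSum Finset.univ fun i _ =>
      (tendsto_integral_sum_sin_mul hf h1 (ν i) (fun j => R j i)).const_mul (r ^ ((i : ℕ) + 1)))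
  refine tendsto_nhds_unique ht ?_
  refine tendsto_const_nhds.congr' ?_
  filter_upwards [self_mem_nhdsWithin] with κ hκ
  exact (h _ (IsC2Bounded.sin_mul hf h1 h2 hκ)).symm

/-- `F` is of class `C²` and its derivatives of orders between `k₀` and `2` are bounded by a
multiple of the weight `w`. -/
def WeightedC2 {E : Type*} [NormedAddCommGroup E] [NormedSpace ℝ E] (k₀ : ℕ) (w F : E → ℝ) :
    Prop :=
  ContDiff ℝ 2 F ∧ ∃ C, 0 ≤ C ∧ ∀ k, k₀ ≤ k → k ≤ 2 → ∀ y, ‖iteratedFDeriv ℝ k F y‖ ≤ C * w y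

section WeightedC2

variable {E E' : Type*} [NormedAddCommGroup E] [NormedSpace ℝ E]
  [NormedAddCommGroup E'] [NormedSpace ℝ E'] {k₀ : ℕ} {w F H : E → ℝ}

theorem WeightedC2.mono (hF : WeightedC2 0 w F) : WeightedC2 k₀ w F := by
  obtain ⟨h, C, hC, hb⟩ := hF
  exact ⟨h, C, hC, fun k _ hk => hb k (Nat.zero_le _) hk⟩

theorem WeightedC2.add (hF : WeightedC2 k₀ w F) (hH : WeightedC2 k₀ w H) :
    WeightedC2 k₀ w (fun y => F y + H y) := by
  obtain ⟨h, C, hC, hb⟩ := hF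
  obtain ⟨h', C', hC', hb'⟩ := hH
  refine ⟨h.add h', C + C', by positivity, fun k hk hk2 y => ?_⟩
  have hk' : (k : WithTop ℕ∞) ≤ 2 := by exact_mod_cast hk2
  have := iteratedFDeriv_add_apply (i := k) (x := y) ((h.of_le hk').contDiffAt)
    ((h'.of_le hk').contDiffAt)
  change ‖iteratedFDeriv ℝ k (F + H) y‖ ≤ _
  rw [this, add_mul]
  exact (norm_add_le _ _).trans (add_le_add (hb k hk hk2 y) (hb' k hk hk2 y))

theorem weightedC2_one_const (c : ℝ) : WeightedC2 0 (fun _ : E => (1 : ℝ)) (fun _ => c) := by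
  refine ⟨contDiff_const, |c|, abs_nonneg _, fun k _ _ y => ?_⟩
  rcases eq_or_ne k 0 with rfl | hk
  · rw [norm_iteratedFDeriv_zero]; simp
  · rw [iteratedFDeriv_const_of_ne hk]; simp

theorem WeightedC2.mul (hw : ∀ y, 0 ≤ w y) (hF : WeightedC2 0 w F)
    (hH : WeightedC2 0 (fun _ => 1) H) : WeightedC2 0 w (fun y => F y * H y) := by
  obtain ⟨h, C, hC, hb⟩ := hF
  obtain ⟨h', C', hC', hb'⟩ := hH
  refine ⟨h.mul h', 4 * (C * C'), by positivity, fun k _ hk2 y => ?_⟩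
  have hk' : (k : WithTop ℕ∞) ≤ 2 := by exact_mod_cast hk2
  refine (norm_iteratedFDeriv_mul_le h h' y hk').trans ?_
  have hkey : ∀ i ∈ Finset.range (k + 1),
      ((k.choose i : ℕ) : ℝ) * ‖iteratedFDeriv ℝ i F y‖ * ‖iteratedFDeriv ℝ (k - i) H y‖ ≤
        (k.choose i : ℕ) * (C * C' * w y) := by
    intro i hi
    have hi' : i ≤ k := by simpa [Nat.lt_succ_iff] using hi
    have h1 := hb i (Nat.zero_le _) (hi'.trans hk2) y
    have h2 := hb' (k - i) (Nat.zero_le _) ((Nat.sub_le _ _).trans hk2) y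
    rw [mul_one] at h2
    have := mul_le_mul h1 h2 (norm_nonneg _) (by have := hw y; positivity)
    rw [mul_assoc]
    refine mul_le_mul_of_nonneg_left (this.trans_eq (by ring)) (by positivity)
  refine (Finset.sum_le_sum hkey).trans ?_
  rw [← Finset.sum_mul, ← Nat.cast_sum, Nat.sum_range_choose]
  have : ((2 ^ k : ℕ) : ℝ) ≤ 4 := by
    have : 2 ^ k ≤ 2 ^ 2 := Nat.pow_le_pow_right two_pos hk2
    exact_mod_cast this
  have h0 : 0 ≤ C * C' * w y := by have := hw y; positivity
  nlinarith

theorem WeightedC2.const_mul (hw : ∀ y, 0 ≤ w y) (hF : WeightedC2 0 w F) (c : ℝ) :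
    WeightedC2 0 w (fun y => c * F y) := by
  simpa only [mul_comm] using hF.mul hw (weightedC2_one_const c)

theorem weightedC2_one_sum {ι : Type*} (s : Finset ι) (f : ι → E → ℝ)
    (hf : ∀ i ∈ s, WeightedC2 0 (fun _ => 1) (f i)) :
    WeightedC2 0 (fun _ => 1) (fun y => ∑ i ∈ s, f i y) := by
  classical
  induction s using Finset.induction_on with
  | empty => simpa using weightedC2_one_const (E := E) 0
  | insert a s ha ih =>
    simp only [Finset.sum_insert ha]
    exact (hf a (by simp)).add (ih fun i hi => hf i (by simp [hi]))

theorem weightedC2_one_prod {ι : Type*} (s : Finset ι) (f : ι → E → ℝ)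
    (hf : ∀ i ∈ s, WeightedC2 0 (fun _ => 1) (f i)) :
    WeightedC2 0 (fun _ => 1) (fun y => ∏ i ∈ s, f i y) := by
  classical
  induction s using Finset.induction_on with
  | empty => simpa using weightedC2_one_const (E := E) 1
  | insert a s ha ih =>
    simp only [Finset.prod_insert ha]
    exact (hf a (by simp)).mul (fun _ => zero_le_one) (ih fun i hi => hf i (by simp [hi]))

theorem WeightedC2.norm_iteratedFDeriv_comp_le {C : ℝ} (hF : ContDiff ℝ 2 F) {k : ℕ}
    (hk : k ≤ 2) (A : E' →L[ℝ] E) (b : E) (y : E')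
    (hb : ‖iteratedFDeriv ℝ k F (A y + b)‖ ≤ C) :
    ‖iteratedFDeriv ℝ k (fun y => F (A y + b)) y‖ ≤ C * ‖A‖ ^ k := by
  have hk' : (k : WithTop ℕ∞) ≤ 2 := by exact_mod_cast hk
  have hF' : ContDiff ℝ 2 (fun x => F (x + b)) := hF.comp (contDiff_id.add contDiff_const)
  have h1 := A.iteratedFDeriv_comp_right hF' y hk'
  change ‖iteratedFDeriv ℝ k ((fun x => F (x + b)) ∘ A) y‖ ≤ _
  rw [h1]
  refine (ContinuousMultilinearMap.norm_compContinuousLinearMap_le _ _).trans ?_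
  rw [iteratedFDeriv_comp_add_right, Finset.prod_const, Finset.card_univ, Fintype.card_fin]
  gcongr

theorem WeightedC2.comp_affine (hw : ∀ y, 0 ≤ w y) (hF : WeightedC2 k₀ w F) (A : E' →L[ℝ] E)
    (b : E) : WeightedC2 k₀ (fun y => w (A y + b)) (fun y => F (A y + b)) := by
  obtain ⟨h, C, hC, hb⟩ := hF
  refine ⟨h.comp (A.contDiff.add contDiff_const), C * (1 + ‖A‖) ^ 2, by positivity,
    fun k hk hk2 y => ?_⟩
  refine (WeightedC2.norm_iteratedFDeriv_comp_le h hk2 A b y (hb k hk hk2 _)).trans ?_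
  have : ‖A‖ ^ k ≤ (1 + ‖A‖) ^ 2 := by
    calc ‖A‖ ^ k ≤ (1 + ‖A‖) ^ k := by gcongr; linarith [norm_nonneg A]
      _ ≤ (1 + ‖A‖) ^ 2 := pow_le_pow_right₀ (by linarith [norm_nonneg A]) hk2
  calc C * w (A y + b) * ‖A‖ ^ k ≤ C * w (A y + b) * (1 + ‖A‖) ^ 2 := by
        have := hw (A y + b)
        gcongr
    _ = _ := by ring

theorem WeightedC2.comp_clm (hw : ∀ y, 0 ≤ w y) (hF : WeightedC2 k₀ w F) (A : E' →L[ℝ] E) :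
    WeightedC2 k₀ (fun y => w (A y)) (fun y => F (A y)) := by
  simpa using hF.comp_affine hw A 0

end WeightedC2

theorem weightedC2_real {k₀ : ℕ} {w g g₁ g₂ : ℝ → ℝ} {C : ℝ} (hC : 0 ≤ C)
    (hg : ContDiff ℝ 2 g) (h1 : ∀ x, HasDerivAt g (g₁ x) x) (h2 : ∀ x, HasDerivAt g₁ (g₂ x) x)
    (b0 : k₀ = 0 → ∀ x, |g x| ≤ C * w x) (b1 : ∀ x, |g₁ x| ≤ C * w x)
    (b2 : ∀ x, |g₂ x| ≤ C * w x) : WeightedC2 k₀ w g := by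
  have e1 : deriv g = g₁ := funext fun x => (h1 x).deriv
  have e2 : deriv g₁ = g₂ := funext fun x => (h2 x).deriv
  refine ⟨hg, C, hC, fun k hk hk2 y => ?_⟩
  rw [norm_iteratedFDeriv_eq_norm_iteratedDeriv, Real.norm_eq_abs]
  interval_cases k
  · rw [iteratedDeriv_zero]; exact b0 (by omega) y
  · rw [iteratedDeriv_one, e1]; exact b1 y
  · rw [iteratedDeriv_succ, iteratedDeriv_one, e1, e2]; exact b2 y

/-- The bump `x ↦ 1 / (1 + x²)`, the derivative of `arctan`. -/
def bump (x : ℝ) : ℝ := 1 / (1 + x ^ 2)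

theorem bump_pos (x : ℝ) : 0 < bump x := by unfold bump; positivity

theorem bump_le_one (x : ℝ) : bump x ≤ 1 := by
  unfold bump
  rw [div_le_one (by positivity)]
  nlinarith [sq_nonneg x]

theorem one_sub_bump_le (x : ℝ) : 1 - bump x ≤ x ^ 2 := by
  unfold bump
  have : (0 : ℝ) < 1 + x ^ 2 := by positivity
  rw [sub_le_iff_le_add, ← sub_le_iff_le_add', le_div_iff₀ this]
  nlinarith [sq_nonneg x, sq_nonneg (x ^ 2)]

theorem hasDerivAt_bump (x : ℝ) : HasDerivAt bump (-(2 * x) / (1 + x ^ 2) ^ 2) x := by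
  have h : HasDerivAt (fun x : ℝ => 1 + x ^ 2) (2 * x) x := by
    simpa using ((hasDerivAt_pow 2 x).const_add 1)
  have := h.inv (by positivity)
  have e : bump = (fun x : ℝ => 1 + x ^ 2)⁻¹ := by ext x; simp [bump]
  rw [e]
  exact this

theorem contDiff_bump : ContDiff ℝ 2 bump := by
  unfold bump
  exact contDiff_const.div (by fun_prop) fun x => by positivity

theorem weightedC2_bump : WeightedC2 0 (fun _ : ℝ => (1 : ℝ)) bump := by
  have key : ∀ x : ℝ, (0 : ℝ) < 1 + x ^ 2 := fun x => by positivity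
  refine weightedC2_real (C := 6) (by norm_num) contDiff_bump hasDerivAt_bump
    (g₂ := fun x => (6 * x ^ 2 - 2) / (1 + x ^ 2) ^ 3) ?_ ?_ ?_ ?_
  · intro x
    have h : HasDerivAt (fun x : ℝ => (1 + x ^ 2) ^ 2) (2 * (1 + x ^ 2) * (2 * x)) x := by
      have h0 : HasDerivAt (fun x : ℝ => 1 + x ^ 2) (2 * x) x := by
        simpa using ((hasDerivAt_pow 2 x).const_add 1)
      exact (h0.pow 2).congr_deriv (by push_cast; ring)
    have h' : HasDerivAt (fun x : ℝ => -(2 * x)) (-2) x := by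
      exact ((hasDerivAt_id x).const_mul 2).neg.congr_deriv (by norm_num)
    have hne : (1 + x ^ 2) ^ 2 ≠ 0 := by positivity
    refine (h'.div h hne).congr_deriv ?_
    have := (key x).ne'
    field_simp
    ring
  · intro _ x
    rw [abs_of_pos (bump_pos x)]
    linarith [bump_le_one x]
  · intro x
    rw [abs_div, abs_neg, abs_of_pos (pow_pos (key x) 2), div_le_iff₀ (pow_pos (key x) 2)]
    rw [abs_le]
    constructor <;> nlinarith [sq_nonneg x, sq_nonneg (x ^ 2), sq_nonneg (x - 1), sq_nonneg (x + 1)]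
  · intro x
    rw [abs_div, abs_of_pos (pow_pos (key x) 3), div_le_iff₀ (pow_pos (key x) 3), abs_le]
    have h2 : 0 ≤ x ^ 2 := sq_nonneg x
    have h4 : 0 ≤ (x ^ 2) ^ 2 := by positivity
    have h6 : 0 ≤ (x ^ 2) ^ 3 := by positivity
    constructor <;> nlinarith

theorem weightedC2_arctan : WeightedC2 0 (fun _ : ℝ => (1 : ℝ)) Real.arctan := by
  have key : ∀ x : ℝ, (0 : ℝ) < 1 + x ^ 2 := fun x => by positivity
  refine weightedC2_real (C := 2) (by norm_num) Real.contDiff_arctan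
    (g₁ := bump) (fun x => Real.hasDerivAt_arctan x) hasDerivAt_bump ?_ ?_ ?_
  · intro _ x
    rw [abs_le]
    constructor <;> linarith [Real.neg_pi_div_two_lt_arctan x, Real.arctan_lt_pi_div_two x,
      Real.pi_lt_four]
  · intro x
    rw [abs_of_pos (bump_pos x)]
    linarith [bump_le_one x]
  · intro x
    rw [abs_div, abs_neg, abs_of_pos (pow_pos (key x) 2), div_le_iff₀ (pow_pos (key x) 2)]
    rw [abs_le]
    constructor <;> nlinarith [sq_nonneg x, sq_nonneg (x ^ 2), sq_nonneg (x - 1), sq_nonneg (x + 1)]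

theorem hasDerivAt_sigmoid_deriv (x : ℝ) :
    HasDerivAt (fun x => Real.sigmoid x * (1 - Real.sigmoid x))
      (Real.sigmoid x * (1 - Real.sigmoid x) * (1 - 2 * Real.sigmoid x)) x := by
  have h := Real.hasDerivAt_sigmoid x
  exact (h.mul (h.const_sub 1)).congr_deriv (by ring)

theorem abs_sigmoid_deriv_le (x : ℝ) : |Real.sigmoid x * (1 - Real.sigmoid x)| ≤ Real.sigmoid x := by
  have h0 := Real.sigmoid_pos x
  have h1 := Real.sigmoid_lt_one x
  rw [abs_of_nonneg (by nlinarith)]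
  nlinarith

theorem weightedC2_sigmoid : WeightedC2 0 Real.sigmoid Real.sigmoid := by
  refine weightedC2_real (C := 1) zero_le_one (contDiff_sigmoid.of_le le_top)
    Real.hasDerivAt_sigmoid hasDerivAt_sigmoid_deriv ?_ ?_ ?_
  · intro _ x
    rw [abs_of_pos (Real.sigmoid_pos x), one_mul]
  · intro x
    rw [one_mul]; exact abs_sigmoid_deriv_le x
  · intro x
    have h0 := Real.sigmoid_pos x
    have h1 := Real.sigmoid_lt_one x
    rw [abs_mul, one_mul]
    refine (mul_le_of_le_one_right (abs_nonneg _) ?_).trans (abs_sigmoid_deriv_le x)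
    rw [abs_le]; constructor <;> linarith

/-- The softplus function, a primitive of the sigmoid. -/
def softplus (x : ℝ) : ℝ := Real.log (1 + Real.exp x)

theorem hasDerivAt_softplus (x : ℝ) : HasDerivAt softplus (Real.sigmoid x) x := by
  have h : HasDerivAt (fun x => 1 + Real.exp x) (Real.exp x) x :=
    (Real.hasDerivAt_exp x).const_add 1
  refine (h.log (by positivity)).congr_deriv ?_
  rw [Real.sigmoid_def, Real.exp_neg]
  have := Real.exp_pos x
  field_simp
  ring

theorem contDiff_softplus : ContDiff ℝ 2 softplus :=
  (contDiff_const.add Real.contDiff_exp).log fun x => by positivity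

theorem weightedC2_softplus : WeightedC2 1 Real.sigmoid softplus := by
  refine weightedC2_real (C := 1) zero_le_one contDiff_softplus hasDerivAt_softplus
    Real.hasDerivAt_sigmoid (by simp) ?_ ?_
  · intro x
    rw [abs_of_pos (Real.sigmoid_pos x), one_mul]
  · intro x
    rw [one_mul]; exact abs_sigmoid_deriv_le x

/-- The partial products in the partition of unity built from `bump`. -/
def lyapFactor {d : ℕ} (N K : Finset (Fin d)) (i : Fin d) (x : Fin d → ℝ) : ℝ :=
  (∏ m ∈ K.erase i, bump (x m)) * ∏ m ∈ N \ K, (1 - bump (x m))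

/-- The partition of unity `∏_{m ∈ K} bump x_m ∏_{m ∈ N \ K} (1 - bump x_m)`, `K ⊆ N`. -/
def bumpPartition {d : ℕ} (N K : Finset (Fin d)) (x : Fin d → ℝ) : ℝ :=
  (∏ m ∈ K, bump (x m)) * ∏ m ∈ N \ K, (1 - bump (x m))

/-- The corrector of the Lyapunov function, varying on the scale `t²` and localized on the
scale `t`. -/
def lyapCorr {d : ℕ} (N : Finset (Fin d)) (V : Finset (Fin d) → Fin d → ℝ) (t : ℝ)
    (y : Fin d → ℝ) : ℝ :=
  ∑ K ∈ N.powerset, ∑ i ∈ K,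
    V K i * (t ^ 2 * Real.arctan ((t ^ 2)⁻¹ * y i) * lyapFactor N K i (t⁻¹ • y))

/-- The Lyapunov function. -/
def lyap {d : ℕ} (N : Finset (Fin d)) (V : Finset (Fin d) → Fin d → ℝ) (j : Fin d) (t : ℝ)
    (y : Fin d → ℝ) : ℝ :=
  softplus (y j) + Real.sigmoid (y j) * lyapCorr N V t y

/-- The error made when replacing the scale `t` by the scale `t²`. -/
def scaleGap {d : ℕ} (N : Finset (Fin d)) (t : ℝ) (y : Fin d → ℝ) : ℝ :=
  ∑ i ∈ N, (bump (t⁻¹ * y i) - bump ((t ^ 2)⁻¹ * y i))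

theorem bump_gap_nonneg {t : ℝ} (ht : 0 < t) (ht1 : t ≤ 1) (x : ℝ) :
    0 ≤ bump (t⁻¹ * x) - bump ((t ^ 2)⁻¹ * x) := by
  unfold bump
  rw [sub_nonneg]
  apply one_div_le_one_div_of_le (by positivity)
  rw [mul_pow, mul_pow]
  have h1 : 1 ≤ t⁻¹ := (one_le_inv₀ ht).2 ht1
  have h2 : t⁻¹ ^ 2 ≤ (t ^ 2)⁻¹ ^ 2 := by
    rw [← inv_pow, ← pow_mul]
    exact pow_le_pow_right₀ h1 (by norm_num)
  nlinarith [sq_nonneg x]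

theorem scaleGap_nonneg {d : ℕ} (N : Finset (Fin d)) {t : ℝ} (ht : 0 < t) (ht1 : t ≤ 1)
    (y : Fin d → ℝ) : 0 ≤ scaleGap N t y :=
  Finset.sum_nonneg fun _ _ => bump_gap_nonneg ht ht1 _

theorem abs_prod_bump_le_one {d : ℕ} (A B : Finset (Fin d)) (x : Fin d → ℝ) :
    0 ≤ (∏ m ∈ A, bump (x m)) * ∏ m ∈ B, (1 - bump (x m)) ∧
      (∏ m ∈ A, bump (x m)) * ∏ m ∈ B, (1 - bump (x m)) ≤ 1 := by
  have h1 : 0 ≤ ∏ m ∈ A, bump (x m) := Finset.prod_nonneg fun m _ => (bump_pos _).le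
  have h2 : 0 ≤ ∏ m ∈ B, (1 - bump (x m)) :=
    Finset.prod_nonneg fun m _ => sub_nonneg.2 (bump_le_one _)
  have h3 : ∏ m ∈ A, bump (x m) ≤ 1 :=
    Finset.prod_le_one (fun m _ => (bump_pos _).le) fun m _ => bump_le_one _
  have h4 : ∏ m ∈ B, (1 - bump (x m)) ≤ 1 :=
    Finset.prod_le_one (fun m _ => sub_nonneg.2 (bump_le_one _))
      fun m _ => by linarith [bump_pos (x m)]
  exact ⟨mul_nonneg h1 h2, mul_le_one₀ h3 h2 h4⟩

theorem abs_lyapFactor_le_one {d : ℕ} (N K : Finset (Fin d)) (i : Fin d) (x : Fin d → ℝ) :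
    |lyapFactor N K i x| ≤ 1 := by
  have := abs_prod_bump_le_one (K.erase i) (N \ K) x
  rw [lyapFactor, abs_of_nonneg this.1]
  exact this.2

theorem bumpPartition_eq {d : ℕ} (N : Finset (Fin d)) {K : Finset (Fin d)} {i : Fin d}
    (hi : i ∈ K) (x : Fin d → ℝ) : bumpPartition N K x = bump (x i) * lyapFactor N K i x := by
  rw [bumpPartition, lyapFactor, ← mul_assoc, Finset.mul_prod_erase K (fun m => bump (x m)) hi]

theorem sum_bumpPartition {d : ℕ} (N : Finset (Fin d)) (x : Fin d → ℝ) :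
    ∑ K ∈ N.powerset, bumpPartition N K x = 1 := by
  have := Finset.prod_add (fun m => bump (x m)) (fun m => 1 - bump (x m)) N
  simp only [add_sub_cancel, Finset.prod_const_one] at this
  exact this.symm

theorem sum_bumpPartition_mem {d : ℕ} (N : Finset (Fin d)) {m : Fin d} (hm : m ∈ N)
    (x : Fin d → ℝ) :
    ∑ K ∈ N.powerset with m ∉ K, bumpPartition N K x = 1 - bump (x m) := by
  have h := Finset.prod_add (fun a => bump (x a)) (fun a => 1 - bump (x a)) (N.erase m)
  simp only [add_sub_cancel, Finset.prod_const_one] at h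
  have e : N.powerset.filter (fun K => m ∉ K) = (N.erase m).powerset := by
    ext K
    simp only [Finset.mem_filter, Finset.mem_powerset]
    constructor
    · rintro ⟨h1, h2⟩
      exact Finset.subset_erase.2 ⟨h1, h2⟩
    · intro h1
      exact Finset.subset_erase.1 h1
  refine Eq.trans ?_ ((congrArg (fun y => (1 - bump (x m)) * y) h.symm).trans (mul_one _))
  simp only [e, Finset.mul_sum]
  refine Finset.sum_congr rfl fun K hK => ?_
  have hmK : m ∉ K := (Finset.subset_erase.1 (Finset.mem_powerset.1 hK)).2
  have hm' : m ∈ N \ K := Finset.mem_sdiff.2 ⟨hm, hmK⟩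
  rw [bumpPartition, ← Finset.mul_prod_erase (N \ K) (fun a => 1 - bump (x a)) hm',
    Finset.erase_sdiff_comm]
  ring

theorem bumpPartition_nonneg {d : ℕ} (N K : Finset (Fin d)) (x : Fin d → ℝ) :
    0 ≤ bumpPartition N K x := (abs_prod_bump_le_one K (N \ K) x).1

theorem WeightedC2.comp_coord {d : ℕ} {k₀ : ℕ} {w g : ℝ → ℝ} (hw : ∀ x, 0 ≤ w x)
    (hg : WeightedC2 k₀ w g) (i : Fin d) :
    WeightedC2 k₀ (fun y : Fin d → ℝ => w (y i)) (fun y => g (y i)) :=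
  hg.comp_clm hw (ContinuousLinearMap.proj (R := ℝ) (φ := fun _ : Fin d => ℝ) i)

theorem weightedC2_lyapFactor {d : ℕ} (N K : Finset (Fin d)) (i : Fin d) :
    WeightedC2 0 (fun _ => (1 : ℝ)) (lyapFactor N K i) := by
  have h1 : ∀ m : Fin d, WeightedC2 0 (fun _ => (1 : ℝ)) fun x : Fin d → ℝ => bump (x m) :=
    fun m => weightedC2_bump.comp_coord (fun _ => zero_le_one) m
  have h0 : ∀ _ : Fin d → ℝ, (0 : ℝ) ≤ 1 := fun _ => zero_le_one
  refine (weightedC2_one_prod _ _ fun m _ => h1 m).mul h0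
    (weightedC2_one_prod _ _ fun m _ => ?_)
  have := (weightedC2_one_const (E := Fin d → ℝ) 1).add ((h1 m).const_mul h0 (-1))
  simpa [sub_eq_add_neg] using this

theorem weightedC2_lyapCorr {d : ℕ} (N : Finset (Fin d)) (V : Finset (Fin d) → Fin d → ℝ)
    (t : ℝ) : WeightedC2 0 (fun _ => (1 : ℝ)) (lyapCorr N V t) := by
  have h0 : ∀ _ : Fin d → ℝ, (0 : ℝ) ≤ 1 := fun _ => zero_le_one
  refine weightedC2_one_sum _ _ fun K _ => weightedC2_one_sum _ _ fun i _ => ?_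
  refine WeightedC2.const_mul h0 ?_ _
  refine WeightedC2.mul h0 ?_ ?_
  · refine WeightedC2.const_mul h0 ?_ _
    have := weightedC2_arctan.comp_clm (fun _ => zero_le_one)
      ((t ^ 2)⁻¹ • ContinuousLinearMap.proj (R := ℝ) (φ := fun _ : Fin d => ℝ) i)
    simpa using this
  · have := (weightedC2_lyapFactor N K i).comp_clm h0
      (t⁻¹ • ContinuousLinearMap.id ℝ (Fin d → ℝ))
    simpa using this

theorem weightedC2_lyap {d : ℕ} (N : Finset (Fin d)) (V : Finset (Fin d) → Fin d → ℝ)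
    (j : Fin d) (t : ℝ) :
    WeightedC2 1 (fun y => Real.sigmoid (y j)) (lyap N V j t) := by
  refine WeightedC2.add (weightedC2_softplus.comp_coord Real.sigmoid_nonneg j) ?_
  exact ((weightedC2_sigmoid.comp_coord Real.sigmoid_nonneg j).mul
    (fun _ => Real.sigmoid_nonneg _) (weightedC2_lyapCorr N V t)).mono

theorem fderiv_lyap_apply {d : ℕ} (N : Finset (Fin d)) (V : Finset (Fin d) → Fin d → ℝ)
    (j : Fin d) {t : ℝ} (ht : 0 < t) (y v : Fin d → ℝ) :
    fderiv ℝ (lyap N V j t) y v =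
      Real.sigmoid (y j) * v j +
        (Real.sigmoid (y j) * (1 - Real.sigmoid (y j)) * v j * lyapCorr N V t y +
        Real.sigmoid (y j) * ∑ K ∈ N.powerset, ∑ i ∈ K,
          V K i * (bump ((t ^ 2)⁻¹ * y i) * v i * lyapFactor N K i (t⁻¹ • y) +
            t ^ 2 * Real.arctan ((t ^ 2)⁻¹ * y i) *
              (fderiv ℝ (lyapFactor N K i) (t⁻¹ • y) (t⁻¹ • v)))) := by
  have hdiff : HasFDerivAt (lyap N V j t) (fderiv ℝ (lyap N V j t) y) y :=
    ((weightedC2_lyap N V j t).1.differentiable two_ne_zero y).hasFDerivAt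
  have hline := hdiff.hasLineDerivAt v
  have hc : ∀ i, HasDerivAt (fun s : ℝ => (y + s • v) i) (v i) 0 := fun i => by
    simpa using ((hasDerivAt_id (0 : ℝ)).mul_const (v i)).const_add (y i)
  have e0 : ∀ i, (y + (0 : ℝ) • v) i = y i := fun i => by simp
  have hsp : HasDerivAt (fun s : ℝ => softplus ((y + s • v) j)) (Real.sigmoid (y j) * v j) 0 := by
    refine HasDerivAt.comp (0 : ℝ) (h₂ := softplus) ?_ (hc j)
    rw [e0]; exact hasDerivAt_softplus _
  have hsg : HasDerivAt (fun s : ℝ => Real.sigmoid ((y + s • v) j))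
      (Real.sigmoid (y j) * (1 - Real.sigmoid (y j)) * v j) 0 := by
    refine HasDerivAt.comp (0 : ℝ) (h₂ := Real.sigmoid) ?_ (hc j)
    rw [e0]; exact Real.hasDerivAt_sigmoid _
  have hat : ∀ i, HasDerivAt (fun s : ℝ => Real.arctan ((t ^ 2)⁻¹ * (y + s • v) i))
      (bump ((t ^ 2)⁻¹ * y i) * ((t ^ 2)⁻¹ * v i)) 0 := fun i => by
    refine HasDerivAt.comp (0 : ℝ) (h₂ := Real.arctan) ?_ ((hc i).const_mul _)
    rw [e0]; exact Real.hasDerivAt_arctan _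
  have hlf : ∀ K i, HasDerivAt (fun s : ℝ => lyapFactor N K i (t⁻¹ • (y + s • v)))
      (fderiv ℝ (lyapFactor N K i) (t⁻¹ • y) (t⁻¹ • v)) 0 := fun K i => by
    have h1 : HasDerivAt (fun s : ℝ => t⁻¹ • (y + s • v)) (t⁻¹ • v) 0 := by
      have := (((hasDerivAt_id (0 : ℝ)).smul_const v).const_add y).const_smul t⁻¹
      exact this.congr_deriv (by simp)
    have h2 : HasFDerivAt (lyapFactor N K i) (fderiv ℝ (lyapFactor N K i) (t⁻¹ • y))
        (t⁻¹ • (y + (0 : ℝ) • v)) := by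
      have := ((weightedC2_lyapFactor N K i).1.differentiable two_ne_zero (t⁻¹ • y)).hasFDerivAt
      simpa using this
    exact h2.comp_hasDerivAt (0 : ℝ) h1
  have hcorr : HasDerivAt (fun s : ℝ => lyapCorr N V t (y + s • v))
      (∑ K ∈ N.powerset, ∑ i ∈ K,
          V K i * (bump ((t ^ 2)⁻¹ * y i) * v i * lyapFactor N K i (t⁻¹ • y) +
            t ^ 2 * Real.arctan ((t ^ 2)⁻¹ * y i) *
              (fderiv ℝ (lyapFactor N K i) (t⁻¹ • y) (t⁻¹ • v)))) 0 := by
    unfold lyapCorr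
    refine HasDerivAt.fun_sum fun K _ => HasDerivAt.fun_sum fun i _ => ?_
    refine HasDerivAt.const_mul _ ?_
    refine (((hat i).const_mul (t ^ 2)).mul (hlf K i)).congr_deriv ?_
    simp only [zero_smul, add_zero]
    field_simp
  have htot := hsp.add (hsg.mul hcorr)
  simp only [zero_smul, add_zero] at htot
  exact HasDerivAt.unique hline htot

theorem abs_arctan_le_two (x : ℝ) : |Real.arctan x| ≤ 2 := by
  rw [abs_le]
  constructor <;> linarith [Real.neg_pi_div_two_lt_arctan x, Real.arctan_lt_pi_div_two x,
    Real.pi_lt_four]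

theorem abs_lyapCorr_le {d : ℕ} (N : Finset (Fin d)) (V : Finset (Fin d) → Fin d → ℝ)
    {t : ℝ} (ht : 0 < t) (ht1 : t ≤ 1) (y : Fin d → ℝ) :
    |lyapCorr N V t y| ≤ (∑ K ∈ N.powerset, ∑ i ∈ K, |V K i|) * (2 * t) := by
  unfold lyapCorr
  rw [Finset.sum_mul]
  refine (Finset.abs_sum_le_sum_abs _ _).trans (Finset.sum_le_sum fun K _ => ?_)
  rw [Finset.sum_mul]
  refine (Finset.abs_sum_le_sum_abs _ _).trans (Finset.sum_le_sum fun i _ => ?_)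
  rw [abs_mul, abs_mul, abs_mul, abs_of_pos (pow_pos ht 2)]
  have h1 := abs_arctan_le_two ((t ^ 2)⁻¹ * y i)
  have h2 := abs_lyapFactor_le_one N K i (t⁻¹ • y)
  have h3 : t ^ 2 ≤ t := by nlinarith
  refine mul_le_mul_of_nonneg_left ?_ (abs_nonneg _)
  calc t ^ 2 * |Real.arctan ((t ^ 2)⁻¹ * y i)| * |lyapFactor N K i (t⁻¹ • y)|
      ≤ t * 2 * 1 := by gcongr
    _ = 2 * t := by ring

theorem exists_norm_fderiv_lyapFactor_le {d : ℕ} (N : Finset (Fin d)) :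
    ∃ M, 0 ≤ M ∧ ∀ K i x, ‖fderiv ℝ (lyapFactor N K i) x‖ ≤ M := by
  have h : ∀ p : Finset (Fin d) × Fin d, ∃ C, 0 ≤ C ∧
      ∀ x, ‖fderiv ℝ (lyapFactor N p.1 p.2) x‖ ≤ C := fun p => by
    obtain ⟨-, C, hC, hb⟩ := weightedC2_lyapFactor N p.1 p.2
    refine ⟨C, hC, fun x => ?_⟩
    have := hb 1 zero_le_one one_le_two x
    rwa [norm_iteratedFDeriv_one, mul_one] at this
  choose C hC hb using h
  refine ⟨∑ p, C p, Finset.sum_nonneg fun p _ => hC p, fun K i x => (hb (K, i) x).trans ?_⟩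
  exact Finset.single_le_sum (fun p _ => hC p) (Finset.mem_univ (K, i))

theorem exists_fderiv_lyap_approx {d : ℕ} (N : Finset (Fin d)) (V : Finset (Fin d) → Fin d → ℝ)
    {j : Fin d} (hj : j ∉ N) (hV : ∀ K, V K j = 1) :
    ∃ C, 0 ≤ C ∧ ∀ t, 0 < t → t ≤ 1 → ∀ y v : Fin d → ℝ,
      |fderiv ℝ (lyap N V j t) y v - Real.sigmoid (y j) * ∑ K ∈ N.powerset,
          bumpPartition N K (t⁻¹ • y) * ∑ a ∈ insert j K, V K a * v a| ≤
        Real.sigmoid (y j) * (C * ‖v‖ * (t + scaleGap N t y)) := by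
  obtain ⟨M, hM, hMb⟩ := exists_norm_fderiv_lyapFactor_le N
  set W := ∑ K ∈ N.powerset, ∑ i ∈ K, |V K i| with hW
  have hW0 : 0 ≤ W := Finset.sum_nonneg fun K _ => Finset.sum_nonneg fun i _ => abs_nonneg _
  refine ⟨W * (3 + 2 * M), by positivity, fun t ht ht1 y v => ?_⟩
  set σ := Real.sigmoid (y j) with hσ
  have hσ0 : 0 < σ := Real.sigmoid_pos _
  have hσ1 : σ ≤ 1 := Real.sigmoid_le_one _
  set Δ := scaleGap N t y with hΔ
  have hΔ0 : 0 ≤ Δ := scaleGap_nonneg N ht ht1 y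
  have hmain : ∑ K ∈ N.powerset, bumpPartition N K (t⁻¹ • y) * ∑ a ∈ insert j K, V K a * v a =
      v j + ∑ K ∈ N.powerset, ∑ i ∈ K,
        V K i * (bump (t⁻¹ * y i) * v i * lyapFactor N K i (t⁻¹ • y)) := by
    have h1 : v j = ∑ K ∈ N.powerset, bumpPartition N K (t⁻¹ • y) * v j := by
      rw [← Finset.sum_mul, sum_bumpPartition, one_mul]
    conv_rhs => rw [h1]
    rw [← Finset.sum_add_distrib]
    refine Finset.sum_congr rfl fun K hK => ?_
    have hjK : j ∉ K := fun h => hj (Finset.mem_powerset.1 hK h)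
    rw [Finset.sum_insert hjK, hV, mul_add, one_mul, Finset.mul_sum]
    congr 1
    refine Finset.sum_congr rfl fun i hi => ?_
    rw [bumpPartition_eq N hi]
    simp only [Pi.smul_apply, smul_eq_mul]
    ring
  have hdiff : fderiv ℝ (lyap N V j t) y v - σ * ∑ K ∈ N.powerset,
          bumpPartition N K (t⁻¹ • y) * ∑ a ∈ insert j K, V K a * v a =
      σ * ((1 - σ) * v j * lyapCorr N V t y + ∑ K ∈ N.powerset, ∑ i ∈ K,
        V K i * (-(bump (t⁻¹ * y i) - bump ((t ^ 2)⁻¹ * y i)) * v i * lyapFactor N K i (t⁻¹ • y) +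
            t ^ 2 * Real.arctan ((t ^ 2)⁻¹ * y i) *
              (fderiv ℝ (lyapFactor N K i) (t⁻¹ • y) (t⁻¹ • v)))) := by
    rw [fderiv_lyap_apply N V j ht, hmain]
    have : ∀ A B X Y Z : ℝ, A - B = Z → (σ * X + (σ * (1 - σ) * X * Y + σ * A)) - σ * (X + B)
        = σ * ((1 - σ) * X * Y + Z) := fun A B X Y Z h => by rw [← h]; ring
    refine this _ _ _ _ _ ?_
    rw [← Finset.sum_sub_distrib]
    refine Finset.sum_congr rfl fun K _ => ?_
    rw [← Finset.sum_sub_distrib]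
    exact Finset.sum_congr rfl fun i _ => by ring
  rw [hdiff, abs_mul, abs_of_pos hσ0]
  refine mul_le_mul_of_nonneg_left ?_ hσ0.le
  have hv : ∀ i, |v i| ≤ ‖v‖ := fun i => norm_le_pi_norm v i
  have hv0 := norm_nonneg v
  have hA : |(1 - σ) * v j * lyapCorr N V t y| ≤ ‖v‖ * (W * (2 * t)) := by
    rw [abs_mul, abs_mul, abs_of_nonneg (by linarith : (0 : ℝ) ≤ 1 - σ)]
    have h1 := abs_lyapCorr_le N V ht ht1 y
    have h2 : (1 - σ) * |v j| ≤ ‖v‖ :=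
      (mul_le_of_le_one_left (abs_nonneg _) (by linarith)).trans (hv j)
    exact mul_le_mul h2 h1 (abs_nonneg _) hv0
  have hB : |∑ K ∈ N.powerset, ∑ i ∈ K,
        V K i * (-(bump (t⁻¹ * y i) - bump ((t ^ 2)⁻¹ * y i)) * v i * lyapFactor N K i (t⁻¹ • y) +
            t ^ 2 * Real.arctan ((t ^ 2)⁻¹ * y i) *
              (fderiv ℝ (lyapFactor N K i) (t⁻¹ • y) (t⁻¹ • v)))| ≤
      W * (‖v‖ * (Δ + 2 * M * t)) := by
    rw [hW, Finset.sum_mul]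
    refine (Finset.abs_sum_le_sum_abs _ _).trans (Finset.sum_le_sum fun K hK => ?_)
    rw [Finset.sum_mul]
    refine (Finset.abs_sum_le_sum_abs _ _).trans (Finset.sum_le_sum fun i hi => ?_)
    rw [abs_mul]
    refine mul_le_mul_of_nonneg_left ?_ (abs_nonneg _)
    have hg0 := bump_gap_nonneg ht ht1 (y i)
    have hgΔ : bump (t⁻¹ * y i) - bump ((t ^ 2)⁻¹ * y i) ≤ Δ := by
      have hiN : i ∈ N := Finset.mem_powerset.1 hK hi
      exact Finset.single_le_sum (f := fun i => bump (t⁻¹ * y i) - bump ((t ^ 2)⁻¹ * y i))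
        (fun i _ => bump_gap_nonneg ht ht1 (y i)) hiN
    have hlf : |fderiv ℝ (lyapFactor N K i) (t⁻¹ • y) (t⁻¹ • v)| ≤ M * (t⁻¹ * ‖v‖) := by
      have h1 := (fderiv ℝ (lyapFactor N K i) (t⁻¹ • y)).le_opNorm (t⁻¹ • v)
      rw [norm_smul, Real.norm_eq_abs, Real.norm_eq_abs, abs_of_pos (inv_pos.2 ht)] at h1
      exact h1.trans (mul_le_mul_of_nonneg_right (hMb K i _) (by positivity))
    refine (abs_add_le _ _).trans ?_
    have e1 : |-(bump (t⁻¹ * y i) - bump ((t ^ 2)⁻¹ * y i)) * v i * lyapFactor N K i (t⁻¹ • y)| ≤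
        Δ * ‖v‖ := by
      rw [abs_mul, abs_mul, abs_neg, abs_of_nonneg hg0]
      calc _ ≤ Δ * ‖v‖ * 1 := by
            gcongr
            · exact hv i
            · exact abs_lyapFactor_le_one N K i _
        _ = Δ * ‖v‖ := mul_one _
    have e2 : |t ^ 2 * Real.arctan ((t ^ 2)⁻¹ * y i) *
              (fderiv ℝ (lyapFactor N K i) (t⁻¹ • y) (t⁻¹ • v))| ≤ 2 * M * t * ‖v‖ := by
      rw [abs_mul, abs_mul, abs_of_pos (pow_pos ht 2)]
      calc _ ≤ t ^ 2 * 2 * (M * (t⁻¹ * ‖v‖)) := by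
            gcongr
            exact abs_arctan_le_two _
        _ = 2 * M * t * ‖v‖ := by field_simp
    linarith
  refine (abs_add_le _ _).trans ((add_le_add hA hB).trans ?_)
  have : 0 ≤ W * ‖v‖ := by positivity
  nlinarith [mul_nonneg this hΔ0, mul_nonneg this ht.le, mul_nonneg (mul_nonneg this hM) hΔ0]

/-- Pointwise drift estimates for the Lyapunov function along the columns `S m`. -/
theorem exists_lyap_drift {d : ℕ} {j : Fin d} {N : Finset (Fin d)} (hj : j ∉ N)
    (V : Finset (Fin d) → Fin d → ℝ) (hV : ∀ K, V K j = 1) (S : Fin d → Fin d → ℝ) {c : ℝ}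
    (hc : 0 < c) (h1 : ∀ K, K ⊆ N → c ≤ ∑ a ∈ insert j K, V K a * S j a)
    (h2 : ∀ K, K ⊆ N → ∀ m ∈ K, ∑ a ∈ insert j K, V K a * S m a ≤ -c) :
    ∃ C, 0 ≤ C ∧ ∀ t, 0 < t → t ≤ 1 → ∀ y : Fin d → ℝ,
      Real.sigmoid (y j) * (c - C * (t + scaleGap N t y)) ≤ fderiv ℝ (lyap N V j t) y (S j) ∧
      ∀ m ∈ N, fderiv ℝ (lyap N V j t) y (S m) ≤
        Real.sigmoid (y j) * (-c + C * (1 - bump (t⁻¹ * y m)) + C * (t + scaleGap N t y)) := by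
  obtain ⟨C0, hC0, hb⟩ := exists_fderiv_lyap_approx N V hj hV
  set B := ∑ m, ‖S m‖ with hB
  have hSB : ∀ m, ‖S m‖ ≤ B := fun m =>
    Finset.single_le_sum (f := fun m => ‖S m‖) (fun _ _ => norm_nonneg _) (Finset.mem_univ m)
  have hB0 : 0 ≤ B := Finset.sum_nonneg fun _ _ => norm_nonneg _
  set U := ∑ m, ∑ K ∈ N.powerset, |∑ a ∈ insert j K, V K a * S m a| with hU
  have hU0 : 0 ≤ U := Finset.sum_nonneg fun _ _ => Finset.sum_nonneg fun _ _ => abs_nonneg _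
  have hUb : ∀ m, ∀ K ∈ N.powerset, ∑ a ∈ insert j K, V K a * S m a ≤ U := fun m K hK =>
    (le_abs_self _).trans ((Finset.single_le_sum
      (f := fun K => |∑ a ∈ insert j K, V K a * S m a|) (fun _ _ => abs_nonneg _) hK).trans
      (Finset.single_le_sum (f := fun m => ∑ K ∈ N.powerset, |∑ a ∈ insert j K, V K a * S m a|)
        (fun _ _ => Finset.sum_nonneg fun _ _ => abs_nonneg _) (Finset.mem_univ m)))
  refine ⟨C0 * B + (U + c), by positivity, fun t ht ht1 y => ?_⟩
  have hσ0 : 0 < Real.sigmoid (y j) := Real.sigmoid_pos _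
  have hΔ0 : 0 ≤ t + scaleGap N t y := by
    have := scaleGap_nonneg N ht ht1 y
    positivity
  have herr : ∀ m, C0 * ‖S m‖ * (t + scaleGap N t y) ≤
      (C0 * B + (U + c)) * (t + scaleGap N t y) := fun m => by
    refine mul_le_mul_of_nonneg_right ?_ hΔ0
    have := mul_le_mul_of_nonneg_left (hSB m) hC0
    linarith
  refine ⟨?_, fun m hm => ?_⟩
  · have h := (abs_le.1 (hb t ht ht1 y (S j))).1
    have hm : c ≤ ∑ K ∈ N.powerset,
        bumpPartition N K (t⁻¹ • y) * ∑ a ∈ insert j K, V K a * S j a := by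
      calc c = ∑ K ∈ N.powerset, bumpPartition N K (t⁻¹ • y) * c := by
            rw [← Finset.sum_mul, sum_bumpPartition, one_mul]
        _ ≤ _ := Finset.sum_le_sum fun K hK => mul_le_mul_of_nonneg_left
            (h1 K (Finset.mem_powerset.1 hK)) (bumpPartition_nonneg N K _)
    have e1 := mul_le_mul_of_nonneg_left hm hσ0.le
    have e2 := mul_le_mul_of_nonneg_left (herr j) hσ0.le
    linarith
  · have h := (abs_le.1 (hb t ht ht1 y (S m))).2
    have hs : ∑ K ∈ N.powerset,
        bumpPartition N K (t⁻¹ • y) * ∑ a ∈ insert j K, V K a * S m a ≤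
        -c + (C0 * B + (U + c)) * (1 - bump (t⁻¹ * y m)) := by
      have hb0 : 0 ≤ 1 - bump (t⁻¹ * y m) := sub_nonneg.2 (bump_le_one _)
      calc _ ≤ ∑ K ∈ N.powerset, (bumpPartition N K (t⁻¹ • y) * (-c) +
              if m ∉ K then bumpPartition N K (t⁻¹ • y) * (U + c) else 0) := by
            refine Finset.sum_le_sum fun K hK => ?_
            have hp := bumpPartition_nonneg N K (t⁻¹ • y)
            by_cases hmK : m ∈ K
            · simp only [hmK, not_true_eq_false, if_false, add_zero]
              exact mul_le_mul_of_nonneg_left (h2 K (Finset.mem_powerset.1 hK) m hmK) hp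
            · simp only [hmK, not_false_eq_true, if_true]
              have := mul_le_mul_of_nonneg_left (hUb m K hK) hp
              linarith
        _ = -c + (1 - bump (t⁻¹ * y m)) * (U + c) := by
            rw [Finset.sum_add_distrib, ← Finset.sum_mul, sum_bumpPartition, ← Finset.sum_filter,
              ← Finset.sum_mul, sum_bumpPartition_mem N hm]
            simp
        _ ≤ _ := by nlinarith [mul_nonneg (mul_nonneg hC0 hB0) hb0]
    have e1 := mul_le_mul_of_nonneg_left hs hσ0.le
    have e2 := mul_le_mul_of_nonneg_left (herr m) hσ0.le
    linarith

theorem pd2_eq {d : ℕ} {f : (Fin d → ℝ) → ℝ} (hf : ContDiff ℝ 2 f) (i j : Fin d)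
    (z : Fin d → ℝ) :
    pd2 f i j z = iteratedFDeriv ℝ 2 f z ![Pi.single i 1, Pi.single j 1] := by
  have h : ContDiff ℝ 1 (fderiv ℝ f) := hf.fderiv_right (by norm_num)
  rw [iteratedFDeriv_two_apply, pd2]
  have hd := (h.differentiable one_ne_zero z).hasFDerivAt
  have := hd.clm_apply (hasFDerivAt_const (Pi.single j (1 : ℝ) : Fin d → ℝ) z)
  have e : (fun w => pd1 f j w) = fun w => fderiv ℝ f w (Pi.single j 1) := rfl
  rw [e, this.fderiv]
  simp

theorem norm_single_one {d : ℕ} (j : Fin d) : ‖(Pi.single j (1 : ℝ) : Fin d → ℝ)‖ = 1 := by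
  refine le_antisymm ((pi_norm_le_iff_of_nonneg zero_le_one).2 fun i => ?_) ?_
  · rcases eq_or_ne i j with rfl | h
    · simp
    · simp [h]
  · simpa using norm_le_pi_norm (Pi.single j (1 : ℝ) : Fin d → ℝ) j

theorem abs_pd1_le {d : ℕ} (f : (Fin d → ℝ) → ℝ) (j : Fin d) (z : Fin d → ℝ) :
    |pd1 f j z| ≤ ‖iteratedFDeriv ℝ 1 f z‖ := by
  rw [norm_iteratedFDeriv_one]
  have := (fderiv ℝ f z).le_opNorm (Pi.single j 1)
  rwa [norm_single_one, mul_one] at this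

theorem abs_pd2_le {d : ℕ} {f : (Fin d → ℝ) → ℝ} (hf : ContDiff ℝ 2 f) (i j : Fin d)
    (z : Fin d → ℝ) : |pd2 f i j z| ≤ ‖iteratedFDeriv ℝ 2 f z‖ := by
  rw [pd2_eq hf]
  refine ((iteratedFDeriv ℝ 2 f z).le_opNorm _).trans ?_
  simp [norm_single_one]

theorem integrable_of_continuous_bounded {E : Type*} [TopologicalSpace E] [MeasurableSpace E]
    [OpensMeasurableSpace E] {f : E → ℝ} (hf : Continuous f) (μ : Measure E) [IsFiniteMeasure μ]
    (C : ℝ) (h : ∀ x, |f x| ≤ C) : Integrable f μ :=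
  Integrable.of_bound hf.measurable.aestronglyMeasurable C (ae_of_all _ h)

/-- The basic adjoint relationship for a test function of the form `F (ρ P z + b)`. -/
theorem SatisfiesBAR.comp_affine {d : ℕ} {Γ R : Matrix (Fin d) (Fin d) ℝ} {r : ℝ}
    {π : Measure (Fin d → ℝ)} {ν : Fin d → Measure (Fin d → ℝ)} [IsFiniteMeasure π]
    [∀ i, IsFiniteMeasure (ν i)] (h : SatisfiesBAR Γ R r π ν)
    {F w : (Fin d → ℝ) → ℝ} (hF : ContDiff ℝ 2 F) {C : ℝ} (hC : 0 ≤ C)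
    (hb : ∀ k, 1 ≤ k → k ≤ 2 → ∀ y, ‖iteratedFDeriv ℝ k F y‖ ≤ C * w y)
    (hwc : Continuous w) (hw0 : ∀ y, 0 ≤ w y) (hw1 : ∀ y, w y ≤ 1)
    (P : (Fin d → ℝ) →L[ℝ] (Fin d → ℝ)) (b : Fin d → ℝ) {ρ : ℝ} (hρ : 0 < ρ) :
    |∑ m : Fin d, r ^ ((m : ℕ) + 1) *
        (∫ z, fderiv ℝ F (ρ • P z + b) (P fun l => R l m) ∂π
          - ∫ z, fderiv ℝ F (ρ • P z + b) (P fun l => R l m) ∂(ν m))| ≤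
      (∑ i, ∑ j, |Γ i j|) * C * ‖P‖ ^ 2 * ρ * ∫ z, w (ρ • P z + b) ∂π := by
  set A : (Fin d → ℝ) →L[ℝ] (Fin d → ℝ) := ρ • P with hA
  have hAz : ∀ z, ρ • P z + b = A z + b := fun z => rfl
  set f : (Fin d → ℝ) → ℝ := fun z => F (A z + b) with hf
  have hfC : ContDiff ℝ 2 f := hF.comp (A.contDiff.add contDiff_const)
  have hfb : ∀ k, 1 ≤ k → k ≤ 2 → ∀ z, ‖iteratedFDeriv ℝ k f z‖ ≤ C * w (A z + b) * ‖A‖ ^ k :=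
    fun k hk hk2 z => WeightedC2.norm_iteratedFDeriv_comp_le hF hk2 A b z (hb k hk hk2 _)
  have hp1 : ∀ l z, |pd1 f l z| ≤ C * w (A z + b) * ‖A‖ ^ 1 := fun l z =>
    (abs_pd1_le f l z).trans (hfb 1 le_rfl one_le_two z)
  have hp2 : ∀ i l z, |pd2 f i l z| ≤ C * w (A z + b) * ‖A‖ ^ 2 := fun i l z =>
    (abs_pd2_le hfC i l z).trans (hfb 2 one_le_two le_rfl z)
  have hwle : ∀ z k, C * w (A z + b) * ‖A‖ ^ k ≤ C * ‖A‖ ^ k := fun z k => by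
    have := hw1 (A z + b)
    have := hw0 (A z + b)
    calc C * w (A z + b) * ‖A‖ ^ k ≤ C * 1 * ‖A‖ ^ k := by gcongr
      _ = _ := by ring
  have hbar := h.of_bounded_derivs hfC (C := C * ‖A‖ ^ 1 + C * ‖A‖ ^ 2)
    (fun l z => ((hp1 l z).trans (hwle z 1)).trans (le_add_of_nonneg_right (by positivity)))
    (fun i l z => ((hp2 i l z).trans (hwle z 2)).trans (le_add_of_nonneg_left (by positivity)))
  have hpd1 : ∀ l z, pd1 f l z = fderiv ℝ F (A z + b) (A (Pi.single l 1)) := fun l z => by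
    have h1 : HasFDerivAt F (fderiv ℝ F (A z + b)) (A z + b) :=
      (hF.differentiable two_ne_zero _).hasFDerivAt
    have h2 : HasFDerivAt (fun z => A z + b) A z := A.hasFDerivAt.add_const b
    have h3 : HasFDerivAt f _ z := h1.comp z h2
    rw [pd1, h3.fderiv]
    rfl
  have hsum : ∀ m z, ∑ l, R l m * pd1 f l z =
      ρ * fderiv ℝ F (A z + b) (P fun l => R l m) := fun m z => by
    have e : (fun l => R l m) = ∑ l, R l m • (Pi.single l (1 : ℝ) : Fin d → ℝ) := by
      ext a; simp [Finset.sum_apply, Pi.single_apply]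
    rw [e, map_sum, map_sum, Finset.mul_sum]
    refine Finset.sum_congr rfl fun l _ => ?_
    rw [hpd1, hA]
    simp only [map_smul, smul_eq_mul, smul_apply]
    ring
  simp only [hsum, integral_const_mul] at hbar
  simp only [hAz]
  set X := ∑ m : Fin d, r ^ ((m : ℕ) + 1) *
        (∫ z, fderiv ℝ F (A z + b) (P fun l => R l m) ∂π
          - ∫ z, fderiv ℝ F (A z + b) (P fun l => R l m) ∂(ν m)) with hX
  have hXe : ρ * X = 1 / 2 * ∫ z, ∑ i, ∑ l, Γ i l * pd2 f i l z ∂π := by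
    have : ρ * X = (∑ i : Fin d, r ^ ((i : ℕ) + 1) *
        (ρ * ∫ z, fderiv ℝ F (A z + b) (P fun l => R l i) ∂π)) -
        ∑ i : Fin d, r ^ ((i : ℕ) + 1) *
        (ρ * ∫ z, fderiv ℝ F (A z + b) (P fun l => R l i) ∂(ν i)) := by
      rw [hX, Finset.mul_sum, ← Finset.sum_sub_distrib]
      exact Finset.sum_congr rfl fun m _ => by ring
    rw [this]; linarith
  have hcw : Continuous fun z => w (A z + b) := hwc.comp (A.continuous.add continuous_const)
  have hint : Integrable (fun z => w (A z + b)) π :=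
    integrable_of_continuous_bounded hcw π 1 fun z => by
      rw [abs_of_nonneg (hw0 _)]; exact hw1 _
  have hI : |∫ z, ∑ i, ∑ l, Γ i l * pd2 f i l z ∂π| ≤
      (∑ i, ∑ l, |Γ i l|) * C * ‖A‖ ^ 2 * ∫ z, w (A z + b) ∂π := by
    rw [← integral_const_mul, ← Real.norm_eq_abs]
    refine norm_integral_le_of_norm_le (hint.const_mul _) (ae_of_all _ fun z => ?_)
    rw [Real.norm_eq_abs, mul_assoc, mul_assoc, Finset.sum_mul]
    refine (Finset.abs_sum_le_sum_abs _ _).trans (Finset.sum_le_sum fun i _ => ?_)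
    rw [Finset.sum_mul]
    refine (Finset.abs_sum_le_sum_abs _ _).trans (Finset.sum_le_sum fun l _ => ?_)
    rw [abs_mul]
    refine mul_le_mul_of_nonneg_left ((hp2 i l z).trans_eq (by ring)) (abs_nonneg _)
  have hAn : ‖A‖ ^ 2 = ρ ^ 2 * ‖P‖ ^ 2 := by
    rw [hA, norm_smul, Real.norm_eq_abs, abs_of_pos hρ, mul_pow]
  rw [hAn] at hI
  have hw' : 0 ≤ ∫ z, w (A z + b) ∂π := integral_nonneg fun z => hw0 _
  have hG : 0 ≤ ∑ i, ∑ l, |Γ i l| :=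
    Finset.sum_nonneg fun _ _ => Finset.sum_nonneg fun _ _ => abs_nonneg _
  have h3 : ρ * |X| ≤ ρ * ((∑ i, ∑ l, |Γ i l|) * C * ‖P‖ ^ 2 * ρ * ∫ z, w (A z + b) ∂π) := by
    rw [← abs_of_pos hρ, ← abs_mul, abs_of_pos hρ, hXe, abs_mul]
    have h4 : |(1 / 2 : ℝ)| ≤ 1 := by norm_num
    calc _ ≤ 1 * ((∑ i, ∑ l, |Γ i l|) * C * (ρ ^ 2 * ‖P‖ ^ 2) * ∫ z, w (A z + b) ∂π) :=
          mul_le_mul h4 hI (abs_nonneg _) zero_le_one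
      _ = _ := by ring
  exact le_of_mul_le_mul_left h3 hρ

/-- The measure `π + ∑_{m > j} r^(m-j) ν_m`. -/
def levelMeasure {d : ℕ} (r : ℝ) (π : Measure (Fin d → ℝ)) (ν : Fin d → Measure (Fin d → ℝ))
    (j : Fin d) : Measure (Fin d → ℝ) :=
  π + ∑ m ∈ Finset.Ioi j, ENNReal.ofReal (r ^ ((m : ℕ) - (j : ℕ))) • ν m

instance {d : ℕ} (r : ℝ) (π : Measure (Fin d → ℝ)) (ν : Fin d → Measure (Fin d → ℝ))
    (j : Fin d) [IsFiniteMeasure π] [∀ i, IsFiniteMeasure (ν i)] :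
    IsFiniteMeasure (levelMeasure r π ν j) := by
  have (m : Fin d) : IsFiniteMeasure (ENNReal.ofReal (r ^ ((m : ℕ) - (j : ℕ))) • ν m) :=
    (ν m).smul_finite ENNReal.ofReal_ne_top
  unfold levelMeasure
  infer_instance

theorem integral_levelMeasure {d : ℕ} {r : ℝ} (hr : 0 < r) (π : Measure (Fin d → ℝ))
    (ν : Fin d → Measure (Fin d → ℝ)) (j : Fin d) [IsFiniteMeasure π] [∀ i, IsFiniteMeasure (ν i)]
    {f : (Fin d → ℝ) → ℝ} (hf : Continuous f) (C : ℝ) (h : ∀ x, |f x| ≤ C) :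
    ∫ z, f z ∂(levelMeasure r π ν j) =
      ∫ z, f z ∂π + ∑ m ∈ Finset.Ioi j, r ^ ((m : ℕ) - (j : ℕ)) * ∫ z, f z ∂(ν m) := by
  have (m : Fin d) : IsFiniteMeasure (ENNReal.ofReal (r ^ ((m : ℕ) - (j : ℕ))) • ν m) :=
    (ν m).smul_finite ENNReal.ofReal_ne_top
  rw [levelMeasure, integral_add_measure, integral_finsetSum_measure]
  · congr 1
    refine Finset.sum_congr rfl fun m _ => ?_
    rw [integral_smul_measure, ENNReal.toReal_ofReal (by positivity), smul_eq_mul]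
  · exact fun m _ => integrable_of_continuous_bounded hf _ C h
  · exact integrable_of_continuous_bounded hf _ C h
  · exact integrable_of_continuous_bounded hf _ C h

theorem bump_abs_le_one (x : ℝ) : |bump x| ≤ 1 := by
  rw [abs_of_pos (bump_pos x)]; exact bump_le_one x

theorem continuous_bump : Continuous bump := contDiff_bump.continuous

theorem continuous_scaleGap {d : ℕ} (N : Finset (Fin d)) (t : ℝ) : Continuous (scaleGap N t) := by
  unfold scaleGap
  have := continuous_bump
  fun_prop

theorem abs_scaleGap_le {d : ℕ} (N : Finset (Fin d)) (t : ℝ) (y : Fin d → ℝ) :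
    |scaleGap N t y| ≤ 2 * d := by
  unfold scaleGap
  refine (Finset.abs_sum_le_sum_abs _ _).trans ?_
  calc _ ≤ ∑ _i ∈ N, (2 : ℝ) := Finset.sum_le_sum fun i _ => by
        refine (abs_sub _ _).trans ?_
        linarith [bump_abs_le_one (t⁻¹ * y i), bump_abs_le_one ((t ^ 2)⁻¹ * y i)]
    _ ≤ 2 * d := by
        rw [Finset.sum_const, nsmul_eq_mul, mul_comm]
        have : N.card ≤ d := by simpa using Finset.card_le_univ N
        have : (N.card : ℝ) ≤ d := by exact_mod_cast this
        linarith

theorem abs_sigmoid_le_one (x : ℝ) : |Real.sigmoid x| ≤ 1 := by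
  rw [abs_of_nonneg (Real.sigmoid_nonneg x)]; exact Real.sigmoid_le_one x

/-- Integrated drift inequality at level `j`. -/
theorem exists_integrated_drift {d : ℕ} {Γ R : Matrix (Fin d) (Fin d) ℝ} {j : Fin d}
    (V : Finset (Fin d) → Fin d → ℝ) (hV : ∀ K, V K j = 1)
    (P : (Fin d → ℝ) →L[ℝ] (Fin d → ℝ)) {c : ℝ}
    (hP0 : ∀ m < j, P (fun l => R l m) = 0)
    (hc : 0 < c) (h1 : ∀ K ⊆ Finset.Ioi j, c ≤ ∑ a ∈ insert j K, V K a * P (fun l => R l j) a)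
    (h2 : ∀ K ⊆ Finset.Ioi j, ∀ m ∈ K, ∑ a ∈ insert j K, V K a * P (fun l => R l m) a ≤ -c) :
    ∃ C, 0 ≤ C ∧ ∀ t, 0 < t → t ≤ 1 → ∃ Ct, 0 ≤ Ct ∧ ∀ q r, 0 < r → r ≤ q → r ≤ 1 →
      ∀ (π : Measure (Fin d → ℝ)) (ν : Fin d → Measure (Fin d → ℝ)) [IsFiniteMeasure π]
        [∀ i, IsFiniteMeasure (ν i)], SatisfiesBAR Γ R r π ν → ∀ b Y,
        (Y = fun z => (q * r ^ ((j : ℕ) + 1)) • P z + b) →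
        c * ∫ z, Real.sigmoid (Y z j) ∂(levelMeasure r π ν j) ≤
          C * (∫ z, Real.sigmoid (Y z j) * (t + scaleGap (Finset.Ioi j) t (Y z))
            ∂(levelMeasure r π ν j)) +
          C * (∑ m ∈ Finset.Ioi j, r ^ ((m : ℕ) - (j : ℕ)) *
            ∫ z, Real.sigmoid (Y z j) * (1 - bump (t⁻¹ * Y z m)) ∂(ν m)) +
          Ct * (q * ∫ z, Real.sigmoid (Y z j) ∂π + ∫ z, Real.sigmoid (Y z j) ∂(ν j)) := by
  set S : Fin d → Fin d → ℝ := fun m => P (fun l => R l m) with hS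
  set N := Finset.Ioi j with hN
  obtain ⟨C, hC, hdr⟩ := exists_lyap_drift (j := j) (N := N) (by simp [hN]) V hV S hc h1 h2
  refine ⟨C, hC, fun t ht ht1 => ?_⟩
  obtain ⟨hF, CF, hCF, hFb⟩ := weightedC2_lyap N V j t
  set F := lyap N V j t with hFdef
  set B := ∑ m, ‖S m‖ with hB
  have hSB : ∀ m, ‖S m‖ ≤ B := fun m =>
    Finset.single_le_sum (f := fun m => ‖S m‖) (fun _ _ => norm_nonneg _) (Finset.mem_univ m)
  have hB0 : 0 ≤ B := Finset.sum_nonneg fun _ _ => norm_nonneg _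
  set G := ∑ i, ∑ l, |Γ i l| with hG
  have hG0 : 0 ≤ G := Finset.sum_nonneg fun _ _ => Finset.sum_nonneg fun _ _ => abs_nonneg _
  refine ⟨CF * B + d * (CF * B) + G * CF * ‖P‖ ^ 2, by positivity, ?_⟩
  intro q r hr hrq hr1 π ν _ _ hbar b Y hY
  have hq : 0 < q := hr.trans_le hrq
  have hYc : Continuous Y := by rw [hY]; fun_prop
  have hYj : ∀ m, Continuous fun z => Y z m := fun m => (continuous_apply m).comp hYc
  set w : (Fin d → ℝ) → ℝ := fun z => Real.sigmoid (Y z j) with hw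
  have hsc : Continuous Real.sigmoid := continuous_sigmoid
  have hwc : Continuous w := hsc.comp (hYj j)
  have hw0 : ∀ z, 0 ≤ w z := fun z => Real.sigmoid_nonneg _
  have hw1 : ∀ z, w z ≤ 1 := fun z => Real.sigmoid_le_one _
  have hwa : ∀ z, |w z| ≤ 1 := fun z => abs_sigmoid_le_one _
  have hDb : ∀ m z, |fderiv ℝ F (Y z) (S m)| ≤ CF * B * w z := fun m z => by
    have := (fderiv ℝ F (Y z)).le_opNorm (S m)
    rw [Real.norm_eq_abs] at this
    have h2 := hFb 1 le_rfl one_le_two (Y z)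
    rw [norm_iteratedFDeriv_one] at h2
    calc _ ≤ _ := this
      _ ≤ CF * w z * B := mul_le_mul h2 (hSB m) (norm_nonneg _)
          (mul_nonneg hCF (hw0 z))
      _ = _ := by ring
  have hDc : ∀ m, Continuous fun z => fderiv ℝ F (Y z) (S m) := fun m =>
    ((hF.continuous_fderiv two_ne_zero).comp hYc).clm_apply continuous_const
  have hDb1 : ∀ m z, |fderiv ℝ F (Y z) (S m)| ≤ CF * B := fun m z =>
    (hDb m z).trans (mul_le_of_le_one_right (by positivity) (hw1 z))
  have hDi : ∀ m (μ : Measure (Fin d → ℝ)) [IsFiniteMeasure μ],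
      Integrable (fun z => fderiv ℝ F (Y z) (S m)) μ := fun m μ _ =>
    integrable_of_continuous_bounded (hDc m) μ _ (hDb1 m)
  have hwi : ∀ (μ : Measure (Fin d → ℝ)) [IsFiniteMeasure μ], Integrable w μ := fun μ _ =>
    integrable_of_continuous_bounded hwc μ 1 hwa
  have hDI : ∀ m (μ : Measure (Fin d → ℝ)) [IsFiniteMeasure μ],
      |∫ z, fderiv ℝ F (Y z) (S m) ∂μ| ≤ CF * B * ∫ z, w z ∂μ := fun m μ _ => by
    rw [← integral_const_mul, ← Real.norm_eq_abs]
    exact norm_integral_le_of_norm_le ((hwi μ).const_mul _) (ae_of_all _ (hDb m))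
  set D : (Fin d → ℝ) → ℝ := fun z => w z * (t + scaleGap N t (Y z)) with hD
  have hDcont : Continuous D :=
    hwc.mul (continuous_const.add ((continuous_scaleGap N t).comp hYc))
  have hDbd : ∀ z, |D z| ≤ 1 + 2 * d := fun z => by
    rw [hD, abs_mul]
    have h3 : |t + scaleGap N t (Y z)| ≤ 1 + 2 * d := by
      refine (abs_add_le _ _).trans (add_le_add ?_ (abs_scaleGap_le _ _ _))
      rwa [abs_of_pos ht]
    calc _ ≤ 1 * (1 + 2 * (d : ℝ)) := mul_le_mul (hwa z) h3 (abs_nonneg _) zero_le_one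
      _ = _ := one_mul _
  have hDint : ∀ (μ : Measure (Fin d → ℝ)) [IsFiniteMeasure μ], Integrable D μ := fun μ _ =>
    integrable_of_continuous_bounded hDcont μ _ hDbd
  set E : Fin d → (Fin d → ℝ) → ℝ := fun m z => w z * (1 - bump (t⁻¹ * Y z m)) with hE
  have hEint : ∀ m (μ : Measure (Fin d → ℝ)) [IsFiniteMeasure μ], Integrable (E m) μ :=
    fun m μ _ => by
    refine integrable_of_continuous_bounded ?_ μ 1 fun z => ?_
    · exact hwc.mul (continuous_const.sub (continuous_bump.comp (continuous_const.mul (hYj m))))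
    · have h3 := bump_pos (t⁻¹ * Y z m)
      have h4 := bump_le_one (t⁻¹ * Y z m)
      rw [hE, abs_mul]
      refine mul_le_one₀ (hwa z) (abs_nonneg _) ?_
      rw [abs_le]; constructor <;> linarith
  have hmain := hbar.comp_affine hF hCF (w := fun y => Real.sigmoid (y j)) hFb
    (hsc.comp (continuous_apply j)) (fun _ => Real.sigmoid_nonneg _)
    (fun _ => Real.sigmoid_le_one _) P b (ρ := q * r ^ ((j : ℕ) + 1)) (by positivity)
  have hYz : ∀ z, (q * r ^ ((j : ℕ) + 1)) • P z + b = Y z := fun z => by rw [hY]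
  simp only [hYz] at hmain
  set T : Fin d → ℝ := fun m => ∫ z, fderiv ℝ F (Y z) (S m) ∂π
          - ∫ z, fderiv ℝ F (Y z) (S m) ∂(ν m) with hT
  have hsplit : ∑ m : Fin d, r ^ ((m : ℕ) + 1) * T m =
      r ^ ((j : ℕ) + 1) * (T j + ∑ m ∈ N, r ^ ((m : ℕ) - (j : ℕ)) * T m) := by
    have hz : ∀ m, m < j → T m = 0 := fun m hm => by
      have : S m = 0 := hP0 m hm
      simp [hT, this]
    have e1 : ∑ m : Fin d, r ^ ((m : ℕ) + 1) * T m =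
        ∑ m ∈ insert j N, r ^ ((m : ℕ) + 1) * T m := by
      symm
      refine Finset.sum_subset (Finset.subset_univ _) fun m _ hm => ?_
      have : m < j := by
        simp only [hN, Finset.mem_insert, Finset.mem_Ioi, not_or, not_lt] at hm
        exact lt_of_le_of_ne hm.2 hm.1
      rw [hz m this, mul_zero]
    rw [e1, Finset.sum_insert (by simp [hN]), mul_add, Finset.mul_sum]
    congr 1
    refine Finset.sum_congr rfl fun m hm => ?_
    have hjm : j < m := by simpa [hN] using hm
    have : (m : ℕ) + 1 = ((j : ℕ) + 1) + ((m : ℕ) - (j : ℕ)) := by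
      have : (j : ℕ) < m := hjm
      omega
    rw [this, pow_add]
    ring_nf
  have hle : T j + ∑ m ∈ N, r ^ ((m : ℕ) - (j : ℕ)) * T m ≤
      G * CF * ‖P‖ ^ 2 * q * ∫ z, w z ∂π := by
    have h3 := (le_abs_self _).trans hmain
    change ∑ m : Fin d, r ^ ((m : ℕ) + 1) * T m ≤ _ at h3
    rw [hsplit] at h3
    refine le_of_mul_le_mul_left (h3.trans_eq ?_) (show 0 < r ^ ((j : ℕ) + 1) by positivity)
    ring
  have hTj : c * ∫ z, w z ∂π - C * ∫ z, D z ∂π - CF * B * ∫ z, w z ∂(ν j) ≤ T j := by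
    have h3 : c * ∫ z, w z ∂π - C * ∫ z, D z ∂π ≤ ∫ z, fderiv ℝ F (Y z) (S j) ∂π := by
      rw [← integral_const_mul, ← integral_const_mul,
        ← integral_sub ((hwi π).const_mul _) ((hDint π).const_mul _)]
      refine integral_mono (((hwi π).const_mul _).sub ((hDint π).const_mul _)) (hDi j π)
        fun z => ?_
      refine le_trans (le_of_eq ?_) (hdr t ht ht1 (Y z)).1
      simp only [hD, hw]; ring
    have h4 := (le_abs_self _).trans (hDI j (ν j))
    simp only [hT]; linarith
  have hTm : ∀ m ∈ N, r ^ ((m : ℕ) - (j : ℕ)) * (c * ∫ z, w z ∂(ν m) - C * ∫ z, D z ∂(ν m)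
      - C * ∫ z, E m z ∂(ν m)) - q * (CF * B * ∫ z, w z ∂π) ≤
      r ^ ((m : ℕ) - (j : ℕ)) * T m := fun m hm => by
    have hjm : (j : ℕ) < m := by simpa [hN] using hm
    have h3 : ∫ z, fderiv ℝ F (Y z) (S m) ∂(ν m) ≤ C * ∫ z, E m z ∂(ν m) + C * ∫ z, D z ∂(ν m)
        - c * ∫ z, w z ∂(ν m) := by
      rw [← integral_const_mul, ← integral_const_mul, ← integral_const_mul,
        ← integral_add ((hEint m _).const_mul _) ((hDint _).const_mul _),
        ← integral_sub _ ((hwi _).const_mul _)]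
      · refine integral_mono (hDi m _) ((((hEint m _).const_mul _).add
          ((hDint _).const_mul _)).sub ((hwi _).const_mul _)) fun z => ?_
        refine le_trans ((hdr t ht ht1 (Y z)).2 m hm) (le_of_eq ?_)
        simp only [hD, hw, hE]; ring
      · exact ((hEint m _).const_mul _).add ((hDint _).const_mul _)
    have h4 := (neg_abs_le _).trans' (neg_le_neg (hDI m π))
    have hwπ : 0 ≤ CF * B * ∫ z, w z ∂π :=
      mul_nonneg (by positivity) (integral_nonneg hw0)
    have h5 : r ^ ((m : ℕ) - (j : ℕ)) ≤ q :=
      (pow_le_of_le_one hr.le hr1 (by omega)).trans hrq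
    have h6 := mul_le_mul_of_nonneg_right h5 hwπ
    have h7 : 0 < r ^ ((m : ℕ) - (j : ℕ)) := by positivity
    have h8 : c * ∫ z, w z ∂(ν m) - C * ∫ z, D z ∂(ν m) - C * ∫ z, E m z ∂(ν m)
        - CF * B * ∫ z, w z ∂π ≤ T m := by
      simp only [hT]; linarith
    have := mul_le_mul_of_nonneg_left h8 h7.le
    linarith
  have hsum := Finset.sum_le_sum hTm
  rw [Finset.sum_sub_distrib, Finset.sum_const, nsmul_eq_mul] at hsum
  have hcard : (N.card : ℝ) ≤ d := by
    have : N.card ≤ d := by simpa using Finset.card_le_univ N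
    exact_mod_cast this
  have hwπ : 0 ≤ q * (CF * B * ∫ z, w z ∂π) :=
    mul_nonneg hq.le (mul_nonneg (by positivity) (integral_nonneg hw0))
  have hcard2 := mul_le_mul_of_nonneg_right hcard hwπ
  have hwν : 0 ≤ ∫ z, w z ∂(ν j) := integral_nonneg hw0
  have hwπ' : 0 ≤ ∫ z, w z ∂π := integral_nonneg hw0
  rw [integral_levelMeasure hr π ν j hwc 1 hwa, integral_levelMeasure hr π ν j hDcont _ hDbd]
  have e3 : ∑ m ∈ N, r ^ ((m : ℕ) - (j : ℕ)) * (c * ∫ z, w z ∂(ν m) - C * ∫ z, D z ∂(ν m)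
      - C * ∫ z, E m z ∂(ν m)) = c * (∑ m ∈ N, r ^ ((m : ℕ) - (j : ℕ)) * ∫ z, w z ∂(ν m))
      - C * (∑ m ∈ N, r ^ ((m : ℕ) - (j : ℕ)) * ∫ z, D z ∂(ν m))
      - C * (∑ m ∈ N, r ^ ((m : ℕ) - (j : ℕ)) * ∫ z, E m z ∂(ν m)) := by
    simp only [Finset.mul_sum, ← Finset.sum_sub_distrib]
    exact Finset.sum_congr rfl fun m _ => by ring
  rw [e3] at hsum
  have h9 : 0 ≤ (d * (CF * B) + G * CF * ‖P‖ ^ 2) * ∫ z, w z ∂(ν j) := by positivity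
  have h10 : 0 ≤ (CF * B) * (q * ∫ z, w z ∂π) := by positivity
  linarith

theorem bump_anti {a b x : ℝ} (ha : 0 ≤ a) (hab : a ≤ b) : bump (b * x) ≤ bump (a * x) := by
  unfold bump
  have : a ^ 2 ≤ b ^ 2 := by gcongr
  rw [mul_pow, mul_pow]
  gcongr

theorem sum_scaleGap_le {d : ℕ} (N : Finset (Fin d)) (t : ℝ) (n : ℕ) (y : Fin d → ℝ) :
    ∑ p ∈ Finset.range n, scaleGap N (t ^ 2 ^ p) y ≤ d := by
  have h : ∀ p, scaleGap N (t ^ 2 ^ p) y =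
      ∑ i ∈ N, bump ((t ^ 2 ^ p)⁻¹ * y i) - ∑ i ∈ N, bump ((t ^ 2 ^ (p + 1))⁻¹ * y i) := fun p => by
    rw [scaleGap, Finset.sum_sub_distrib, pow_succ 2 p, pow_mul]
  simp only [h]
  rw [Finset.sum_range_sub' (fun p => ∑ i ∈ N, bump ((t ^ 2 ^ p)⁻¹ * y i))]
  have h1 : 0 ≤ ∑ i ∈ N, bump ((t ^ 2 ^ n)⁻¹ * y i) :=
    Finset.sum_nonneg fun _ _ => (bump_pos _).le
  have h2 : ∑ i ∈ N, bump ((t ^ 2 ^ 0)⁻¹ * y i) ≤ N.card := by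
    refine (Finset.sum_le_sum fun i _ => bump_le_one _).trans ?_
    simp
  have : N.card ≤ d := by simpa using Finset.card_le_univ N
  have : (N.card : ℝ) ≤ d := by exact_mod_cast this
  linarith

/-- Averaging the integrated drift inequality over a ladder of scales. -/
theorem exists_ladder_bound {d : ℕ} {Γ R : Matrix (Fin d) (Fin d) ℝ} {j : Fin d}
    (V : Finset (Fin d) → Fin d → ℝ) (hV : ∀ K, V K j = 1)
    (P : (Fin d → ℝ) →L[ℝ] (Fin d → ℝ)) {c : ℝ}
    (hP0 : ∀ m < j, P (fun l => R l m) = 0)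
    (hc : 0 < c) (h1 : ∀ K ⊆ Finset.Ioi j, c ≤ ∑ a ∈ insert j K, V K a * P (fun l => R l j) a)
    (h2 : ∀ K ⊆ Finset.Ioi j, ∀ m ∈ K, ∑ a ∈ insert j K, V K a * P (fun l => R l m) a ≤ -c) :
    ∃ τ, 0 < τ ∧ ∃ K, 0 ≤ K ∧ ∀ q r, 0 < r → r ≤ q → r ≤ 1 →
      ∀ (π : Measure (Fin d → ℝ)) (ν : Fin d → Measure (Fin d → ℝ)) [IsFiniteMeasure π]
        [∀ i, IsFiniteMeasure (ν i)], SatisfiesBAR Γ R r π ν → ∀ b Y,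
        (Y = fun z => (q * r ^ ((j : ℕ) + 1)) • P z + b) →
        ∫ z, Real.sigmoid (Y z j) ∂(levelMeasure r π ν j) ≤
          K * ((∑ m ∈ Finset.Ioi j, r ^ ((m : ℕ) - (j : ℕ)) *
            ∫ z, Real.sigmoid (Y z j) * (1 - bump (τ⁻¹ * Y z m)) ∂(ν m)) +
          (q * ∫ z, Real.sigmoid (Y z j) ∂π + ∫ z, Real.sigmoid (Y z j) ∂(ν j))) := by
  obtain ⟨C, hC, hdr⟩ := exists_integrated_drift (Γ := Γ) V hV P hP0 hc h1 h2
  choose! Ct hCt hdr using hdr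
  set t0 := min 1 (c / (4 * (C + 1))) with ht0
  have ht0p : 0 < t0 := by positivity
  have ht01 : t0 ≤ 1 := min_le_left _ _
  have hCt0 : C * t0 ≤ c / 4 := by
    calc C * t0 ≤ (C + 1) * (c / (4 * (C + 1))) := by
          gcongr
          · linarith
          · exact min_le_right _ _
      _ = c / 4 := by field_simp
  obtain ⟨n, hn⟩ := exists_nat_gt (4 * C * d / c)
  have hn0 : (0 : ℝ) < n := lt_of_le_of_lt (by positivity) hn
  have hCn : C * (d / n) ≤ c / 4 := by
    rw [div_lt_iff₀ hc] at hn
    rw [← mul_div_assoc, div_le_iff₀ hn0]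
    linarith
  have hnn : n ≠ 0 := by rintro rfl; simp at hn0
  set t : ℕ → ℝ := fun p => t0 ^ 2 ^ p with ht
  have htp : ∀ p, 0 < t p := fun p => pow_pos ht0p _
  have ht1 : ∀ p, t p ≤ t0 := fun p => pow_le_of_le_one ht0p.le ht01 (by positivity)
  have htn : ∀ p, p ≤ n → t n ≤ t p := fun p hp =>
    pow_le_pow_of_le_one ht0p.le ht01 (Nat.pow_le_pow_right two_pos hp)
  set Cm := ∑ p ∈ Finset.range n, Ct (t p) with hCm
  have hCt' : ∀ p, 0 ≤ Ct (t p) := fun p => hCt _ (htp p) ((ht1 p).trans ht01)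
  have hCm0 : 0 ≤ Cm := Finset.sum_nonneg fun p _ => hCt' p
  refine ⟨t n, htp n, 2 * (C + Cm) / c, by positivity, ?_⟩
  intro q r hr hrq hr1 π ν _ _ hbar b Y hY
  have hq : 0 < q := hr.trans_le hrq
  have hYc : Continuous Y := by rw [hY]; fun_prop
  have hYj : ∀ m, Continuous fun z => Y z m := fun m => (continuous_apply m).comp hYc
  set N := Finset.Ioi j with hN
  set w : (Fin d → ℝ) → ℝ := fun z => Real.sigmoid (Y z j) with hw
  have hwc : Continuous w := continuous_sigmoid.comp (hYj j)
  have hw0 : ∀ z, 0 ≤ w z := fun z => Real.sigmoid_nonneg _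
  have hwa : ∀ z, |w z| ≤ 1 := fun z => abs_sigmoid_le_one _
  set μ := levelMeasure r π ν j with hμ
  have hwi : Integrable w μ := integrable_of_continuous_bounded hwc μ 1 hwa
  have hgi : ∀ s, Integrable (fun z => w z * scaleGap N s (Y z)) μ := fun s => by
    refine integrable_of_continuous_bounded
      (hwc.mul ((continuous_scaleGap N s).comp hYc)) μ (1 * (2 * d)) fun z => ?_
    rw [Pi.mul_apply, abs_mul]
    exact mul_le_mul (hwa z) (abs_scaleGap_le _ _ _) (abs_nonneg _) zero_le_one
  set A := ∫ z, w z ∂μ with hA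
  have hA0 : 0 ≤ A := integral_nonneg hw0
  have hsum : ∑ p ∈ Finset.range n, ∫ z, w z * scaleGap N (t p) (Y z) ∂μ ≤
      ∑ _p ∈ Finset.range n, d / n * A := by
    rw [← integral_finsetSum _ fun p _ => hgi (t p), Finset.sum_const, Finset.card_range,
      nsmul_eq_mul, ← mul_assoc, mul_div_cancel₀ _ hn0.ne', hA, ← integral_const_mul]
    refine integral_mono (integrable_finsetSum _ fun p _ => hgi (t p)) (hwi.const_mul _)
      fun z => ?_
    simp only
    rw [← Finset.mul_sum, mul_comm (d : ℝ)]
    exact mul_le_mul_of_nonneg_left (sum_scaleGap_le N t0 n (Y z)) (hw0 z)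
  obtain ⟨p, hp, hpl⟩ := Finset.exists_le_of_sum_le (by simpa using hnn) hsum
  have hpn : p ≤ n := (Finset.mem_range.1 hp).le
  have key := hdr (t p) (htp p) ((ht1 p).trans ht01) q r hr hrq hr1 π ν hbar b Y hY
  set X := q * ∫ z, w z ∂π + ∫ z, w z ∂(ν j) with hX
  have hX0 : 0 ≤ X := add_nonneg (mul_nonneg hq.le (integral_nonneg hw0)) (integral_nonneg hw0)
  have hXle : Ct (t p) * X ≤ Cm * X := by
    gcongr
    exact Finset.single_le_sum (f := fun p => Ct (t p)) (fun p _ => hCt' p) hp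
  have hEi : ∀ s m (μ : Measure (Fin d → ℝ)) [IsFiniteMeasure μ],
      Integrable (fun z => w z * (1 - bump (s * Y z m))) μ := fun s m μ _ => by
    refine integrable_of_continuous_bounded ?_ μ 1 fun z => ?_
    · exact hwc.mul (continuous_const.sub (continuous_bump.comp (continuous_const.mul (hYj m))))
    · have h3 := bump_pos (s * Y z m)
      have h4 := bump_le_one (s * Y z m)
      rw [abs_mul]
      refine mul_le_one₀ (hwa z) (abs_nonneg _) ?_
      rw [abs_le]; constructor <;> linarith
  set E : ℝ := ∑ m ∈ N, r ^ ((m : ℕ) - (j : ℕ)) *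
            ∫ z, w z * (1 - bump ((t n)⁻¹ * Y z m)) ∂(ν m) with hE
  have hE0 : 0 ≤ E := Finset.sum_nonneg fun m _ => mul_nonneg (by positivity)
    (integral_nonneg fun z => mul_nonneg (hw0 z) (sub_nonneg.2 (bump_le_one _)))
  have hEle : ∑ m ∈ N, r ^ ((m : ℕ) - (j : ℕ)) *
            ∫ z, w z * (1 - bump ((t p)⁻¹ * Y z m)) ∂(ν m) ≤ E := by
    refine Finset.sum_le_sum fun m _ => mul_le_mul_of_nonneg_left ?_ (by positivity)
    refine integral_mono (hEi _ m _) (hEi _ m _) fun z => mul_le_mul_of_nonneg_left ?_ (hw0 z)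
    have : bump ((t n)⁻¹ * Y z m) ≤ bump ((t p)⁻¹ * Y z m) :=
      bump_anti (inv_nonneg.2 (htp p).le) (inv_anti₀ (htp n) (htn p hpn))
    linarith
  have hint : ∫ z, w z * (t p + scaleGap N (t p) (Y z)) ∂μ =
      t p * A + ∫ z, w z * scaleGap N (t p) (Y z) ∂μ := by
    rw [hA, ← integral_const_mul, ← integral_add (hwi.const_mul _) (hgi _)]
    congr 1; ext z; ring
  change c * A ≤ C * (∫ z, w z * (t p + scaleGap N (t p) (Y z)) ∂μ) + C * (∑ m ∈ N,
    r ^ ((m : ℕ) - (j : ℕ)) * ∫ z, w z * (1 - bump ((t p)⁻¹ * Y z m)) ∂(ν m)) +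
    Ct (t p) * X at key
  rw [hint] at key
  change A ≤ 2 * (C + Cm) / c * (E + X)
  have k1 := mul_le_mul_of_nonneg_left hpl hC
  have k2 := mul_le_mul_of_nonneg_left hEle hC
  have k3 : C * (t p * A) ≤ c / 4 * A := by
    rw [← mul_assoc]
    exact mul_le_mul_of_nonneg_right ((mul_le_mul_of_nonneg_left (ht1 p) hC).trans hCt0) hA0
  have k4 : C * (d / n * A) ≤ c / 4 * A := by
    rw [← mul_assoc]
    exact mul_le_mul_of_nonneg_right hCn hA0
  have k5 : c / 2 * A ≤ C * E + Cm * X := by linarith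
  have k6 : C * E + Cm * X ≤ (C + Cm) * (E + X) := by
    nlinarith [mul_nonneg hC hX0, mul_nonneg hCm0 hE0]
  rw [div_mul_eq_mul_div, le_div_iff₀ hc]
  linarith

/-- The set where the `l`-th coordinate exceeds the level-`l` threshold. -/
def overSet {d : ℕ} (q : ℝ) (l : Fin d) : Set (Fin d → ℝ) :=
  {z | 2 < (q ^ 4) ^ ((l : ℕ) + 1) * q ^ 2 * z l}

/-- The set where some coordinate below `j` exceeds its threshold. -/
def overBelow {d : ℕ} (q : ℝ) (j : Fin d) : Set (Fin d → ℝ) := ⋃ l ∈ Finset.Iio j, overSet q l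

theorem measurableSet_overSet {d : ℕ} (q : ℝ) (l : Fin d) : MeasurableSet (overSet q l) :=
  measurableSet_lt measurable_const (measurable_const.mul (measurable_pi_apply l))

theorem measurableSet_overBelow {d : ℕ} (q : ℝ) (j : Fin d) : MeasurableSet (overBelow q j) :=
  Finset.measurableSet_biUnion _ fun l _ => measurableSet_overSet q l

theorem integral_le_add_measureReal {E : Type*} [MeasurableSpace E] {μ : Measure E}
    [IsFiniteMeasure μ] {f g : E → ℝ} {B : Set E} (hf : Integrable f μ) (hg : Integrable g μ)
    (hB : MeasurableSet B) (h1 : ∀ᵐ z ∂μ, z ∉ B → f z ≤ g z) (h2 : ∀ z, f z ≤ g z + 1) :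
    ∫ z, f z ∂μ ≤ ∫ z, g z ∂μ + μ.real B := by
  have hi : Integrable (B.indicator (1 : E → ℝ)) μ := (integrable_const (1 : ℝ)).indicator hB
  rw [← integral_indicator_one hB, ← integral_add hg hi]
  refine integral_mono_ae hf (hg.add hi) ?_
  filter_upwards [h1] with z hz
  by_cases h : z ∈ B
  · simpa [h] using h2 z
  · simpa [h] using hz h

theorem exp_bound_sigmoid (x : ℝ) : Real.sigmoid x ≤ Real.exp x := by
  have h := Real.exp_pos x
  rw [Real.sigmoid_def, inv_le_comm₀ (by positivity) h, ← Real.exp_neg]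
  linarith [Real.exp_pos (-x)]

theorem half_le_sigmoid {x : ℝ} (hx : 0 ≤ x) : 1 / 2 ≤ Real.sigmoid x := by
  have : Real.exp (-x) ≤ 1 := Real.exp_le_one_iff.2 (by linarith)
  rw [Real.sigmoid_def, ← one_div]
  exact one_div_le_one_div_of_le (by positivity) (by linarith)

/-- Off the set `overBelow q j`, applying a matrix that is the identity on the coordinates
from `j` on changes those coordinates by little at scale `j`. -/
theorem abs_sub_le_of_notMem_overBelow {d : ℕ} {j : Fin d} (p : Fin d → Fin d → ℝ)
    (hp1 : ∀ a, j ≤ a → p a a = 1) (hp2 : ∀ a b, j ≤ b → b ≠ a → p a b = 0) {q : ℝ} (hq : 0 < q)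
    (hq1 : q ≤ 1) {z : Fin d → ℝ} (hz : z ∈ posOrthant d) (hB : z ∉ overBelow q j) {a : Fin d}
    (ha : j ≤ a) :
    (q ^ 4) ^ ((j : ℕ) + 1) * |∑ b, p a b * z b - z a| ≤ 2 * (∑ a, ∑ b, |p a b|) * q ^ 2 := by
  have hzb : ∀ b, b < j → (q ^ 4) ^ ((j : ℕ) + 1) * z b ≤ 2 * q ^ 2 := fun b hb => by
    have h1 : z ∉ overSet q b := fun h => hB (by
      simp only [overBelow, Set.mem_iUnion]
      exact ⟨b, Finset.mem_Iio.2 hb, h⟩)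
    have h2 : (q ^ 4) ^ ((b : ℕ) + 1) * q ^ 2 * z b ≤ 2 := not_lt.1 h1
    have h3 : (q ^ 4) ^ ((j : ℕ) + 1) ≤ (q ^ 4) ^ ((b : ℕ) + 1) * q ^ 2 * q ^ 2 := by
      rw [mul_assoc, ← pow_add, show 2 + 2 = 4 from rfl, ← pow_succ]
      exact pow_le_pow_of_le_one (by positivity) (pow_le_one₀ hq.le hq1)
        (by have : (b : ℕ) < j := hb
            omega)
    calc _ ≤ (q ^ 4) ^ ((b : ℕ) + 1) * q ^ 2 * q ^ 2 * z b :=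
          mul_le_mul_of_nonneg_right h3 (hz b)
      _ = (q ^ 4) ^ ((b : ℕ) + 1) * q ^ 2 * z b * q ^ 2 := by ring
      _ ≤ _ := mul_le_mul_of_nonneg_right h2 (by positivity)
  have h4 : ∑ b, p a b * z b - z a = ∑ b ∈ Finset.Iio j, p a b * z b := by
    have e : ∑ b, p a b * z b = ∑ b ∈ insert a (Finset.Iio j), p a b * z b := by
      symm
      refine Finset.sum_subset (Finset.subset_univ _) fun b _ hb => ?_
      simp only [Finset.mem_insert, Finset.mem_Iio, not_or, not_lt] at hb
      rw [hp2 a b hb.2 hb.1, zero_mul]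
    rw [e, Finset.sum_insert (by simpa using ha), hp1 a ha]
    ring
  rw [h4]
  have h5 : (q ^ 4) ^ ((j : ℕ) + 1) * |∑ b ∈ Finset.Iio j, p a b * z b| ≤
      ∑ b ∈ Finset.Iio j, |p a b| * (2 * q ^ 2) := by
    refine (mul_le_mul_of_nonneg_left (Finset.abs_sum_le_sum_abs _ _) (by positivity)).trans ?_
    rw [Finset.mul_sum]
    refine Finset.sum_le_sum fun b hb => ?_
    rw [abs_mul, abs_of_nonneg (hz b)]
    calc _ = |p a b| * ((q ^ 4) ^ ((j : ℕ) + 1) * z b) := by ring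
      _ ≤ _ := mul_le_mul_of_nonneg_left (hzb b (Finset.mem_Iio.1 hb)) (abs_nonneg _)
  refine h5.trans ?_
  rw [← Finset.sum_mul]
  have h6 : ∑ b ∈ Finset.Iio j, |p a b| ≤ ∑ a, ∑ b, |p a b| :=
    (Finset.sum_le_sum_of_subset_of_nonneg (Finset.subset_univ _)
      fun _ _ _ => abs_nonneg _).trans
      (Finset.single_le_sum (f := fun a => ∑ b, |p a b|)
        (fun _ _ => Finset.sum_nonneg fun _ _ => abs_nonneg _) (Finset.mem_univ a))
  calc _ ≤ (∑ a, ∑ b, |p a b|) * (2 * q ^ 2) := mul_le_mul_of_nonneg_right h6 (by positivity)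
    _ = _ := by ring

/-- Tail bounds at level `j` in terms of tail bounds at lower levels. -/
theorem exists_level_bound {d : ℕ} (Γ : Matrix (Fin d) (Fin d) ℝ) {R : Matrix (Fin d) (Fin d) ℝ}
    (hR : IsPMatrix R) (j : Fin d) :
    ∃ K, 0 ≤ K ∧ ∃ q₀, 0 < q₀ ∧ ∀ q, 0 < q → q < q₀ →
      ∀ (π : Measure (Fin d → ℝ)) (ν : Fin d → Measure (Fin d → ℝ)) [IsProbabilityMeasure π]
        [∀ i, IsProbabilityMeasure (ν i)], (∀ᵐ z ∂π, z ∈ posOrthant d) →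
        (∀ i, ∀ᵐ z ∂(ν i), z ∈ posOrthant d ∧ z i = 0) → SatisfiesBAR Γ R (q ^ 4) π ν →
        π.real (overSet q j) ≤ K * (Real.exp (-q⁻¹) +
          ∑ m ∈ Finset.Ici j, (ν m).real (overBelow q j)) + π.real (overBelow q j) ∧
        ∀ m, j < m → (q ^ 4) ^ ((m : ℕ) - (j : ℕ)) * (ν m).real (overSet q j) ≤
          K * (Real.exp (-q⁻¹) + ∑ m ∈ Finset.Ici j, (ν m).real (overBelow q j)) +
            (ν m).real (overBelow q j) := by
  obtain ⟨c, hc, p, V, hp1, hp2, hp3, hV, hV1, hV2⟩ := hR.exists_reduction j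
  set P : (Fin d → ℝ) →L[ℝ] (Fin d → ℝ) :=
    LinearMap.toContinuousLinearMap (Matrix.mulVecLin (Matrix.of p)) with hPdef
  have hP : ∀ z a, P z a = ∑ b, p a b * z b := fun z a => by
    simp [hPdef, Matrix.mulVec, dotProduct]
  have hPR : ∀ m a, P (fun l => R l m) a = uR R (p a) m := fun m a => by rw [hP, uR]
  obtain ⟨τ, hτ, K, hK, hlad⟩ := exists_ladder_bound (Γ := Γ) (R := R) (j := j) V hV P
    (fun m hm => by ext a; rw [hPR, hp3 a m hm]; rfl) hc
    (fun K hK => by simp only [hPR]; exact hV1 K hK)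
    (fun K hK m hm => by simp only [hPR]; exact hV2 K hK m hm)
  set M := ∑ a, ∑ b, |p a b| with hM
  have hM0 : 0 ≤ M := Finset.sum_nonneg fun _ _ => Finset.sum_nonneg fun _ _ => abs_nonneg _
  set K1 := (τ⁻¹ * (2 * M)) ^ 2 with hK1
  set K2 := 2 * K * (Real.exp (2 * M) + 1) with hK2
  have hK10 : 0 ≤ K1 := sq_nonneg _
  have hK20 : 0 ≤ K2 := by positivity
  refine ⟨2 * K2, by positivity, min 1 (min (1 / (2 * (K * (K1 + 1) + 1))) (1 / (2 * M + 1))),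
    by positivity, ?_⟩
  intro q hq hqlt π ν _ _ hπ hν hbar
  obtain ⟨hq1, hq2, hq3⟩ : q < 1 ∧ q < 1 / (2 * (K * (K1 + 1) + 1)) ∧ q < 1 / (2 * M + 1) := by
    simpa using hqlt
  have hqK : K * (K1 + 1) * q ≤ 1 / 2 := by
    have : 0 ≤ K * (K1 + 1) := by positivity
    rw [lt_div_iff₀ (by positivity)] at hq2
    linarith
  have hqM : 2 * M * q ≤ 1 := by
    rw [lt_div_iff₀ (by positivity)] at hq3
    linarith
  have hqn : ∀ n, q ^ (n + 1) ≤ q := fun n => pow_le_of_le_one hq.le hq1.le (by simp)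
  set r := q ^ 4 with hr
  have hr0 : 0 < r := by positivity
  set b : Fin d → ℝ := Pi.single j (-q⁻¹) with hb
  set Y : (Fin d → ℝ) → (Fin d → ℝ) := fun z => (q * r ^ ((j : ℕ) + 1)) • P z + b with hY
  have hA := hlad q r hr0 (hqn 3) (pow_le_one₀ hq.le hq1.le) π ν hbar b Y rfl
  have hYc : Continuous Y := by rw [hY]; fun_prop
  have hYj : ∀ m, Continuous fun z => Y z m := fun m => (continuous_apply m).comp hYc
  set N := Finset.Ioi j with hN
  set w : (Fin d → ℝ) → ℝ := fun z => Real.sigmoid (Y z j) with hw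
  have hwc : Continuous w := continuous_sigmoid.comp (hYj j)
  have hw0 : ∀ z, 0 ≤ w z := fun z => Real.sigmoid_nonneg _
  have hw1 : ∀ z, w z ≤ 1 := fun z => Real.sigmoid_le_one _
  have hwa : ∀ z, |w z| ≤ 1 := fun z => abs_sigmoid_le_one _
  have hwi : ∀ (μ : Measure (Fin d → ℝ)) [IsFiniteMeasure μ], Integrable w μ := fun μ _ =>
    integrable_of_continuous_bounded hwc μ 1 hwa
  set B := overBelow q j with hBdef
  have hBm : MeasurableSet B := measurableSet_overBelow q j
  set A := ∫ z, w z ∂(levelMeasure r π ν j) with hAdef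
  have hAeq : A = ∫ z, w z ∂π + ∑ m ∈ N, r ^ ((m : ℕ) - (j : ℕ)) * ∫ z, w z ∂(ν m) :=
    integral_levelMeasure hr0 π ν j hwc 1 hwa
  set X := Real.exp (-q⁻¹) + ∑ m ∈ Finset.Ici j, (ν m).real B with hX
  have hYsub : ∀ z a, z ∈ posOrthant d → z ∉ B → j ≤ a →
      r ^ ((j : ℕ) + 1) * |P z a - z a| ≤ 2 * M * q ^ 2 := fun z a hz hzB ha => by
    rw [hP]
    exact abs_sub_le_of_notMem_overBelow p hp1 hp2 hq hq1.le hz hzB ha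
  have hEm : ∀ m ∈ N, ∫ z, w z * (1 - bump (τ⁻¹ * Y z m)) ∂(ν m) ≤
      K1 * q * ∫ z, w z ∂(ν m) + (ν m).real B := fun m hm => by
    have hjm : j < m := by simpa [hN] using hm
    rw [← integral_const_mul]
    refine integral_le_add_measureReal ?_ ((hwi _).const_mul _) hBm ?_ fun z => ?_
    · refine integrable_of_continuous_bounded ?_ _ 1 fun z => ?_
      · exact hwc.mul (continuous_const.sub (continuous_bump.comp (continuous_const.mul (hYj m))))
      · have h3 := bump_pos (τ⁻¹ * Y z m)
        have h4 := bump_le_one (τ⁻¹ * Y z m)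
        rw [abs_mul]
        refine mul_le_one₀ (hwa z) (abs_nonneg _) ?_
        rw [abs_le]; constructor <;> linarith
    · filter_upwards [hν m] with z hz hzB
      have h3 := hYsub z m hz.1 hzB hjm.le
      rw [hz.2, sub_zero] at h3
      have h4 : Y z m = q * (r ^ ((j : ℕ) + 1) * P z m) := by
        simp [hY, hb, hjm.ne', mul_assoc]
      have h5 : |Y z m| ≤ 2 * M * q := by
        have h6 : |Y z m| = q * (r ^ ((j : ℕ) + 1) * |P z m|) := by
          rw [h4, abs_mul, abs_mul, abs_of_pos hq, abs_of_pos (pow_pos hr0 _)]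
        rw [h6]
        calc q * (r ^ ((j : ℕ) + 1) * |P z m|) ≤ 1 * (2 * M * q ^ 2) :=
              mul_le_mul hq1.le h3 (by positivity) zero_le_one
          _ = 2 * M * q ^ 2 := one_mul _
          _ ≤ _ := mul_le_mul_of_nonneg_left (hqn 1) (by positivity)
      have h7 : 1 - bump (τ⁻¹ * Y z m) ≤ K1 * q := by
        refine (one_sub_bump_le _).trans ?_
        rw [mul_pow, ← sq_abs (Y z m), ← mul_pow]
        calc (τ⁻¹ * |Y z m|) ^ 2 ≤ (τ⁻¹ * (2 * M * q)) ^ 2 := by gcongr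
          _ = K1 * q ^ 2 := by rw [hK1]; ring
          _ ≤ K1 * q := mul_le_mul_of_nonneg_left (hqn 1) hK10
      calc _ ≤ w z * (K1 * q) := mul_le_mul_of_nonneg_left h7 (hw0 z)
        _ = _ := by ring
    · have h3 : w z * (1 - bump (τ⁻¹ * Y z m)) ≤ 1 := by
        refine mul_le_one₀ (hw1 z) (sub_nonneg.2 (bump_le_one _)) ?_
        linarith [bump_pos (τ⁻¹ * Y z m)]
      have : 0 ≤ K1 * q * w z := mul_nonneg (by positivity) (hw0 z)
      linarith
  have hEj : ∫ z, w z ∂(ν j) ≤ Real.exp (2 * M) * Real.exp (-q⁻¹) + (ν j).real B := by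
    have h2 : ∫ _z, Real.exp (2 * M) * Real.exp (-q⁻¹) ∂(ν j) =
      Real.exp (2 * M) * Real.exp (-q⁻¹) := by simp
    rw [← h2]
    refine integral_le_add_measureReal (hwi _) (integrable_const _) hBm ?_ fun z => ?_
    · filter_upwards [hν j] with z hz hzB
      have h3 := hYsub z j hz.1 hzB le_rfl
      rw [hz.2, sub_zero] at h3
      have h4 : Y z j = q * (r ^ ((j : ℕ) + 1) * P z j) - q⁻¹ := by
        simp [hY, hb, mul_assoc, sub_eq_add_neg]
      have h5 : q * (r ^ ((j : ℕ) + 1) * P z j) ≤ 2 * M := by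
        have h6 : r ^ ((j : ℕ) + 1) * P z j ≤ 2 * M * q ^ 2 :=
          (mul_le_mul_of_nonneg_left (le_abs_self _) (by positivity)).trans h3
        calc _ ≤ q * (2 * M * q ^ 2) := mul_le_mul_of_nonneg_left h6 hq.le
          _ = 2 * M * q ^ 3 := by ring
          _ ≤ 2 * M * 1 := mul_le_mul_of_nonneg_left (pow_le_one₀ hq.le hq1.le) (by positivity)
          _ = _ := mul_one _
      rw [← Real.exp_add]
      exact (exp_bound_sigmoid _).trans (Real.exp_le_exp.2 (by linarith))
    · have := hw1 z
      have : 0 < Real.exp (2 * M) * Real.exp (-q⁻¹) := by positivity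
      linarith
  have hνB : ∀ m, 0 ≤ (ν m).real B := fun m => measureReal_nonneg
  have hX' : X = Real.exp (-q⁻¹) + ((ν j).real B + ∑ m ∈ N, (ν m).real B) := by
    rw [hX, ← Finset.Ioi_insert, Finset.sum_insert (by simp)]
  have hsum : ∑ m ∈ N, r ^ ((m : ℕ) - (j : ℕ)) *
      ∫ z, w z * (1 - bump (τ⁻¹ * Y z m)) ∂(ν m) ≤
      K1 * q * (∑ m ∈ N, r ^ ((m : ℕ) - (j : ℕ)) * ∫ z, w z ∂(ν m)) + ∑ m ∈ N, (ν m).real B := by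
    rw [Finset.mul_sum, ← Finset.sum_add_distrib]
    refine Finset.sum_le_sum fun m hm => ?_
    have h3 := mul_le_mul_of_nonneg_left (hEm m hm)
      (show 0 ≤ r ^ ((m : ℕ) - (j : ℕ)) by positivity)
    have h4 : r ^ ((m : ℕ) - (j : ℕ)) * (ν m).real B ≤ (ν m).real B :=
      mul_le_of_le_one_left (hνB m) (pow_le_one₀ hr0.le (pow_le_one₀ hq.le hq1.le))
    linarith
  have hwπ : 0 ≤ ∫ z, w z ∂π := integral_nonneg hw0
  have hwν : ∀ m : Fin d, 0 ≤ r ^ ((m : ℕ) - (j : ℕ)) * ∫ z, w z ∂(ν m) := fun m =>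
    mul_nonneg (by positivity) (integral_nonneg hw0)
  have hwνs : 0 ≤ ∑ m ∈ N, r ^ ((m : ℕ) - (j : ℕ)) * ∫ z, w z ∂(ν m) :=
    Finset.sum_nonneg fun m _ => hwν m
  have hA0 : 0 ≤ A := integral_nonneg hw0
  have hAX : A ≤ K2 * X := by
    have hνs : 0 ≤ ∑ m ∈ N, (ν m).real B := Finset.sum_nonneg fun m _ => hνB m
    have h3 : (∑ m ∈ N, r ^ ((m : ℕ) - (j : ℕ)) *
      ∫ z, w z * (1 - bump (τ⁻¹ * Y z m)) ∂(ν m)) + (q * ∫ z, w z ∂π + ∫ z, w z ∂(ν j)) ≤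
      (K1 + 1) * q * A + (Real.exp (2 * M) + 1) * X := by
      rw [hAeq, hX']
      have t1 : 0 ≤ K1 * q * ∫ z, w z ∂π := by positivity
      have t2 : 0 ≤ q * ∑ m ∈ N, r ^ ((m : ℕ) - (j : ℕ)) * ∫ z, w z ∂(ν m) := by positivity
      have t3 : 0 ≤ Real.exp (2 * M) * ((ν j).real B + ∑ m ∈ N, (ν m).real B) :=
        mul_nonneg (Real.exp_pos _).le (add_nonneg (hνB j) hνs)
      have t4 := Real.exp_pos (-q⁻¹)
      linarith
    have h4 := hA.trans (mul_le_mul_of_nonneg_left h3 hK)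
    have h5 : K * ((K1 + 1) * q * A) ≤ 1 / 2 * A := by
      have := mul_le_mul_of_nonneg_right hqK hA0
      linarith
    rw [hK2]
    linarith
  have hover : ∀ (μ : Measure (Fin d → ℝ)) [IsFiniteMeasure μ], (∀ᵐ z ∂μ, z ∈ posOrthant d) →
      μ.real (overSet q j) ≤ 2 * ∫ z, w z ∂μ + μ.real B := fun μ _ hμ => by
    rw [← integral_indicator_one (measurableSet_overSet q j), ← integral_const_mul]
    refine integral_le_add_measureReal
      ((integrable_const (1 : ℝ)).indicator (measurableSet_overSet q j))
      ((hwi _).const_mul _) hBm ?_ fun z => ?_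
    · filter_upwards [hμ] with z hz hzB
      by_cases h : z ∈ overSet q j
      · have h3 := hYsub z j hz hzB le_rfl
        have h4 : Y z j = q * (r ^ ((j : ℕ) + 1) * P z j) - q⁻¹ := by
          simp [hY, hb, mul_assoc, sub_eq_add_neg]
        have h5 : 2 < r ^ ((j : ℕ) + 1) * q ^ 2 * z j := h
        have h6 : -(2 * M * q ^ 2) ≤ r ^ ((j : ℕ) + 1) * (P z j - z j) := by
          have := mul_le_mul_of_nonneg_left (neg_abs_le (P z j - z j))
            (show 0 ≤ r ^ ((j : ℕ) + 1) by positivity)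
          linarith
        have h7 : 1 ≤ q ^ 2 * (r ^ ((j : ℕ) + 1) * P z j) := by
          have h8 := mul_le_mul_of_nonneg_left h6 (show 0 ≤ q ^ 2 by positivity)
          have h9 : q ^ 2 * (2 * M * q ^ 2) ≤ 1 := by
            calc _ = 2 * M * q ^ 4 := by ring
              _ ≤ 2 * M * q := mul_le_mul_of_nonneg_left (hqn 3) (by positivity)
              _ ≤ 1 := hqM
          linarith
        have h8 : 0 ≤ Y z j := by
          rw [h4, sub_nonneg, inv_le_iff_one_le_mul₀ hq]
          linarith
        have := half_le_sigmoid h8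
        simp only [Set.indicator_of_mem h, Pi.one_apply]
        linarith
      · have := hw0 z
        simp only [Set.indicator_of_notMem h]
        linarith
    · have h3 : (overSet q j).indicator (1 : (Fin d → ℝ) → ℝ) z ≤ 1 :=
        Set.indicator_le_self' (fun _ _ => zero_le_one) z
      have := hw0 z
      linarith
  constructor
  · have := hover π hπ
    linarith
  · intro m hm
    have h3 := mul_le_mul_of_nonneg_left (hover (ν m) ((hν m).mono fun z hz => hz.1))
      (show 0 ≤ r ^ ((m : ℕ) - (j : ℕ)) by positivity)
    have h4 : r ^ ((m : ℕ) - (j : ℕ)) * (ν m).real B ≤ (ν m).real B :=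
      mul_le_of_le_one_left (hνB m) (pow_le_one₀ hr0.le (pow_le_one₀ hq.le hq1.le))
    have h5 : r ^ ((m : ℕ) - (j : ℕ)) * ∫ z, w z ∂(ν m) ≤ A := by
      rw [hAeq]
      have := Finset.single_le_sum (f := fun m : Fin d => r ^ ((m : ℕ) - (j : ℕ)) *
        ∫ z, w z ∂(ν m)) (fun m _ => hwν m) (show m ∈ N by simpa [hN] using hm)
      linarith
    linarith

/-- `f q` decays faster than every power of `q` as `q → 0⁺`. -/
def RapidDecay (f : ℝ → ℝ) : Prop := ∀ n : ℕ, f =O[nhdsWithin 0 (Set.Ioi 0)] fun q => q ^ n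

theorem RapidDecay.add {f g : ℝ → ℝ} (hf : RapidDecay f) (hg : RapidDecay g) :
    RapidDecay fun q => f q + g q := fun n => (hf n).add (hg n)

theorem RapidDecay.const_mul {f : ℝ → ℝ} (hf : RapidDecay f) (c : ℝ) :
    RapidDecay fun q => c * f q := fun n => (hf n).const_mul_left c

theorem RapidDecay.sum {ι : Type*} {s : Finset ι} {f : ι → ℝ → ℝ}
    (hf : ∀ i ∈ s, RapidDecay (f i)) : RapidDecay fun q => ∑ i ∈ s, f i q := fun n =>
  Asymptotics.IsBigO.fun_sum fun i hi => hf i hi n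

theorem RapidDecay.of_pow_mul_le {f g : ℝ → ℝ} (hg : RapidDecay g) (k : ℕ)
    (h0 : ∀ᶠ q in nhdsWithin 0 (Set.Ioi 0), 0 ≤ f q)
    (h : ∀ᶠ q in nhdsWithin 0 (Set.Ioi 0), q ^ k * f q ≤ g q) : RapidDecay f := by
  intro n
  obtain ⟨C, hC⟩ := (hg (k + n)).bound
  refine Asymptotics.IsBigO.of_bound C ?_
  filter_upwards [h0, h, hC, self_mem_nhdsWithin] with q h0 h hC hq
  have hq : 0 < q := hq
  rw [Real.norm_eq_abs, abs_of_nonneg h0, Real.norm_eq_abs, abs_of_pos (by positivity)]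
  rw [Real.norm_eq_abs, Real.norm_eq_abs, abs_of_pos (by positivity : 0 < q ^ (k + n))] at hC
  refine le_of_mul_le_mul_left ?_ (pow_pos hq k)
  calc _ ≤ _ := h
    _ ≤ _ := le_abs_self _
    _ ≤ _ := hC
    _ = _ := by ring

theorem rapidDecay_exp_neg_inv : RapidDecay fun q => Real.exp (-q⁻¹) := by
  intro n
  have h := (Real.tendsto_pow_mul_exp_neg_atTop_nhds_zero n).comp tendsto_inv_nhdsGT_zero
  refine ((h.isBigO_one ℝ).mul (Asymptotics.isBigO_refl (fun q : ℝ => q ^ n) _)).congr' ?_ ?_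
  · filter_upwards [self_mem_nhdsWithin] with q hq
    have hq : 0 < q := hq
    simp only [Function.comp]
    rw [mul_right_comm, ← mul_pow, inv_mul_cancel₀ hq.ne', one_pow, one_mul]
  · filter_upwards with q
    simp

theorem RapidDecay.tendsto_pow_div {f : ℝ → ℝ} (hf : RapidDecay f) (k : ℕ) :
    Tendsto (fun q => f q / q ^ k) (nhdsWithin 0 (Set.Ioi 0)) (nhds 0) := by
  have h1 : (fun q => f q / q ^ k) =O[nhdsWithin 0 (Set.Ioi 0)] fun q => q := by
    refine ((hf (k + 1)).mul (Asymptotics.isBigO_refl (fun q : ℝ => (q ^ k)⁻¹) _)).congr' ?_ ?_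
    · exact Eventually.of_forall fun q => by simp [div_eq_mul_inv]
    · filter_upwards [self_mem_nhdsWithin] with q hq
      have hq : 0 < q := hq
      rw [pow_succ, mul_right_comm, mul_inv_cancel₀ (by positivity), one_mul]
  exact h1.trans_tendsto (tendsto_id.mono_left nhdsWithin_le_nhds)

theorem BARFamily.ae_mem {d : ℕ} {Γ R : Matrix (Fin d) (Fin d) ℝ}
    {π : ℝ → Measure (Fin d → ℝ)} {ν : Fin d → ℝ → Measure (Fin d → ℝ)}
    (h : BARFamily Γ R π ν) {r : ℝ} (hr : r ∈ Set.Ioo (0 : ℝ) 1) :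
    (∀ᵐ z ∂(π r), z ∈ posOrthant d) ∧ ∀ i, ∀ᵐ z ∂(ν i r), z ∈ posOrthant d ∧ z i = 0 := by
  obtain ⟨h1, h2, h3, -⟩ := h r hr
  have hm : MeasurableSet (posOrthant d) := by
    have : posOrthant d = ⋂ i, {z : Fin d → ℝ | 0 ≤ z i} := by
      ext z; simp [posOrthant]
    rw [this]
    exact MeasurableSet.iInter fun i => measurableSet_le measurable_const (measurable_pi_apply i)
  refine ⟨(mem_ae_iff_prob_eq_one hm).2 h2, fun i => ?_⟩
  obtain ⟨h4, h5⟩ := h3 i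
  exact (mem_ae_iff_prob_eq_one (hm.inter
    (measurableSet_eq_fun (measurable_pi_apply i) measurable_const))).2 h5

theorem pow_four_mem_Ioo {q : ℝ} (hq : 0 < q) (hq1 : q < 1) : q ^ 4 ∈ Set.Ioo (0 : ℝ) 1 :=
  ⟨by positivity, pow_lt_one₀ hq.le hq1 (by norm_num)⟩

theorem measureReal_overBelow_le {d : ℕ} (μ : Measure (Fin d → ℝ)) (q : ℝ) (j : Fin d) :
    μ.real (overBelow q j) ≤ ∑ l ∈ Finset.Iio j, μ.real (overSet q l) :=
  measureReal_biUnion_finset_le _ _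

/-- All tails at the thresholds decay rapidly. -/
theorem BARFamily.rapidDecay_overSet {d : ℕ} {Γ R : Matrix (Fin d) (Fin d) ℝ}
    {π : ℝ → Measure (Fin d → ℝ)} {ν : Fin d → ℝ → Measure (Fin d → ℝ)}
    (h : BARFamily Γ R π ν) (hR : IsPMatrix R) (j : Fin d) :
    RapidDecay (fun q => (π (q ^ 4)).real (overSet q j)) ∧
      ∀ m, j < m → RapidDecay (fun q => (ν m (q ^ 4)).real (overSet q j)) := by
  induction j using WellFoundedLT.induction with
  | ind j ih =>
  have hBof : ∀ μ : ℝ → Measure (Fin d → ℝ),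
      (∀ l, l < j → RapidDecay (fun q => (μ q).real (overSet q l))) →
      RapidDecay (fun q => (μ q).real (overBelow q j)) := fun μ hμ => by
    refine (RapidDecay.sum (s := Finset.Iio j) fun l hl => hμ l (by simpa using hl)).of_pow_mul_le 0
      (Eventually.of_forall fun q => measureReal_nonneg) (Eventually.of_forall fun q => ?_)
    rw [pow_zero, one_mul]
    exact measureReal_overBelow_le _ _ _
  have hBπ : RapidDecay (fun q => (π (q ^ 4)).real (overBelow q j)) :=
    hBof (fun q => π (q ^ 4)) fun l hl => (ih l hl).1
  have hBν : ∀ m, j ≤ m → RapidDecay (fun q => (ν m (q ^ 4)).real (overBelow q j)) :=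
    fun m hm => hBof (fun q => ν m (q ^ 4)) fun l hl => (ih l hl).2 m (hl.trans_le hm)
  obtain ⟨K, hK, q₀, hq₀, hb⟩ := exists_level_bound Γ hR j
  have hX : RapidDecay fun q => K * (Real.exp (-q⁻¹) +
      ∑ m ∈ Finset.Ici j, (ν m (q ^ 4)).real (overBelow q j)) :=
    (rapidDecay_exp_neg_inv.add (RapidDecay.sum fun m hm => hBν m (by simpa using hm))).const_mul K
  have hev : ∀ᶠ q : ℝ in nhdsWithin 0 (Set.Ioi 0),
      (π (q ^ 4)).real (overSet q j) ≤ K * (Real.exp (-q⁻¹) +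
          ∑ m ∈ Finset.Ici j, (ν m (q ^ 4)).real (overBelow q j)) +
            (π (q ^ 4)).real (overBelow q j) ∧
        ∀ m, j < m → (q ^ 4) ^ ((m : ℕ) - (j : ℕ)) * (ν m (q ^ 4)).real (overSet q j) ≤
          K * (Real.exp (-q⁻¹) + ∑ m ∈ Finset.Ici j, (ν m (q ^ 4)).real (overBelow q j)) +
            (ν m (q ^ 4)).real (overBelow q j) := by
    filter_upwards [Ioo_mem_nhdsGT (lt_min one_pos hq₀)] with q hq
    have hq1 : q < 1 := hq.2.trans_le (min_le_left _ _)
    have hr := pow_four_mem_Ioo hq.1 hq1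
    have hae := h.ae_mem hr
    obtain ⟨h1, -, h3, h4⟩ := h _ hr
    have := fun i => (h3 i).1
    exact hb q hq.1 (hq.2.trans_le (min_le_right _ _)) (π (q ^ 4)) (fun i => ν i (q ^ 4))
      hae.1 hae.2 h4
  refine ⟨(hX.add hBπ).of_pow_mul_le 0 (Eventually.of_forall fun q => measureReal_nonneg) ?_,
    fun m hm => (hX.add (hBν m hm.le)).of_pow_mul_le (4 * ((m : ℕ) - (j : ℕ)))
      (Eventually.of_forall fun q => measureReal_nonneg) ?_⟩
  · filter_upwards [hev] with q hq
    rw [pow_zero, one_mul]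
    exact hq.1
  · filter_upwards [hev] with q hq
    rw [pow_mul]
    exact hq.2 m hm

/-- The characteristic function of a measure on `ℝ^d`, in coordinates. -/
def coordCharFun {d : ℕ} (μ : Measure (Fin d → ℝ)) (θ : Fin d → ℝ) : ℂ :=
  ∫ z, Complex.exp (((∑ j, θ j * z j : ℝ) : ℂ) * Complex.I) ∂μ

theorem continuous_linForm {d : ℕ} (θ : Fin d → ℝ) :
    Continuous fun z : Fin d → ℝ => ∑ j, θ j * z j := by fun_prop

theorem integrable_cexp_linForm {d : ℕ} (μ : Measure (Fin d → ℝ)) [IsFiniteMeasure μ]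
    (θ : Fin d → ℝ) :
    Integrable (fun z => Complex.exp (((∑ j, θ j * z j : ℝ) : ℂ) * Complex.I)) μ := by
  refine Integrable.of_bound (Continuous.aestronglyMeasurable ?_) 1 (ae_of_all _ fun z => ?_)
  · have := continuous_linForm θ
    fun_prop
  · rw [Complex.norm_exp_ofReal_mul_I]

theorem norm_coordCharFun_le {d : ℕ} (μ : Measure (Fin d → ℝ)) [IsProbabilityMeasure μ]
    (θ : Fin d → ℝ) : ‖coordCharFun μ θ‖ ≤ 1 := by
  refine (norm_integral_le_of_norm_le_const (C := 1) (ae_of_all _ fun z => ?_)).trans_eq ?_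
  · rw [Complex.norm_exp_ofReal_mul_I]
  · simp

theorem coordCharFun_eq {d : ℕ} (μ : Measure (Fin d → ℝ)) [IsFiniteMeasure μ] (θ : Fin d → ℝ) :
    coordCharFun μ θ = ((∫ z, Real.cos (∑ j, θ j * z j) ∂μ : ℝ) : ℂ) +
      ((∫ z, Real.sin (∑ j, θ j * z j) ∂μ : ℝ) : ℂ) * Complex.I := by
  have hc := continuous_linForm θ
  have h1 : Integrable (fun z => Real.cos (∑ j, θ j * z j)) μ :=
    integrable_of_continuous_bounded (Real.continuous_cos.comp hc) μ 1
      fun z => Real.abs_cos_le_one _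
  have h2 : Integrable (fun z => Real.sin (∑ j, θ j * z j)) μ :=
    integrable_of_continuous_bounded (Real.continuous_sin.comp hc) μ 1
      fun z => Real.abs_sin_le_one _
  rw [coordCharFun, ← integral_complex_ofReal, ← integral_complex_ofReal, ← integral_mul_const,
    ← integral_add h1.ofReal (h2.ofReal.mul_const _)]
  congr 1
  ext z
  rw [Complex.exp_mul_I, Complex.ofReal_cos, Complex.ofReal_sin]

theorem hasFDerivAt_linForm {d : ℕ} (θ : Fin d → ℝ) (z : Fin d → ℝ) :
    HasFDerivAt (fun z : Fin d → ℝ => ∑ j, θ j * z j)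
      (∑ j, θ j • ContinuousLinearMap.proj (R := ℝ) (φ := fun _ : Fin d => ℝ) j) z :=
  HasFDerivAt.fun_sum fun j _ => (hasFDerivAt_apply j z).const_mul (θ j)

theorem pd1_comp_linForm {d : ℕ} (θ : Fin d → ℝ) {g g' : ℝ → ℝ} (hg : ∀ x, HasDerivAt g (g' x) x)
    (c : ℝ) (j : Fin d) (z : Fin d → ℝ) :
    pd1 (fun z => c * g (∑ j, θ j * z j)) j z = c * θ j * g' (∑ j, θ j * z j) := by
  have h := ((hg (∑ j, θ j * z j)).comp_hasFDerivAt z (hasFDerivAt_linForm θ z)).const_mul c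
  have h' : HasFDerivAt (fun z => c * g (∑ j, θ j * z j)) _ z := h
  rw [pd1, h'.fderiv]
  simp [Pi.single_apply]
  ring

theorem pd2_comp_linForm {d : ℕ} (θ : Fin d → ℝ) {g g' g'' : ℝ → ℝ}
    (hg : ∀ x, HasDerivAt g (g' x) x) (hg' : ∀ x, HasDerivAt g' (g'' x) x) (i j : Fin d)
    (z : Fin d → ℝ) :
    pd2 (fun z => 1 * g (∑ j, θ j * z j)) i j z = θ j * θ i * g'' (∑ j, θ j * z j) := by
  have h : (fun w => pd1 (fun z => 1 * g (∑ j, θ j * z j)) j w) =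
      fun w => θ j * g' (∑ j, θ j * w j) := by
    ext w; rw [pd1_comp_linForm θ hg]; ring
  rw [pd2, h]
  exact pd1_comp_linForm θ hg' (θ j) i z

theorem SatisfiesBAR.comp_linForm {d : ℕ} {Γ R : Matrix (Fin d) (Fin d) ℝ} {r : ℝ}
    {π : Measure (Fin d → ℝ)} {ν : Fin d → Measure (Fin d → ℝ)} (h : SatisfiesBAR Γ R r π ν)
    (θ : Fin d → ℝ) {g g' g'' : ℝ → ℝ}
    (hgc : ContDiff ℝ 2 g) (hg : ∀ x, HasDerivAt g (g' x) x) (hg' : ∀ x, HasDerivAt g' (g'' x) x)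
    (hb : ∀ x, |g x| ≤ 1) (hb' : ∀ x, |g' x| ≤ 1) (hb'' : ∀ x, |g'' x| ≤ 1) :
    1 / 2 * (quadForm Γ θ * ∫ z, g'' (∑ j, θ j * z j) ∂π) -
      ∑ i : Fin d, r ^ ((i : ℕ) + 1) * (uR R θ i * (∫ z, g' (∑ j, θ j * z j) ∂π -
        ∫ z, g' (∑ j, θ j * z j) ∂(ν i))) = 0 := by
  set D := ∑ j, |θ j| with hD
  have hDj : ∀ j, |θ j| ≤ D := fun j =>
    Finset.single_le_sum (f := fun j => |θ j|) (fun _ _ => abs_nonneg _) (Finset.mem_univ j)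
  have hD0 : 0 ≤ D := Finset.sum_nonneg fun _ _ => abs_nonneg _
  have hlin : ContDiff ℝ 2 fun z : Fin d → ℝ => ∑ j, θ j * z j := by fun_prop
  have hB := h (fun z => 1 * g (∑ j, θ j * z j)) ⟨contDiff_const.mul (hgc.comp hlin),
    1 + D + D * D, fun z _ => ⟨?_, fun j => ?_, fun i j => ?_⟩⟩
  · simp only [pd1_comp_linForm θ hg, pd2_comp_linForm θ hg hg'] at hB
    have e1 : ∀ z : Fin d → ℝ, ∑ i, ∑ j, Γ i j * (θ j * θ i * g'' (∑ j, θ j * z j)) =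
        quadForm Γ θ * g'' (∑ j, θ j * z j) := fun z => by
      simp only [quadForm, Finset.sum_mul]
      exact Finset.sum_congr rfl fun i _ => Finset.sum_congr rfl fun j _ => by ring
    have e2 : ∀ (i : Fin d) (z : Fin d → ℝ), ∑ j, R j i * (1 * θ j * g' (∑ j, θ j * z j)) =
        uR R θ i * g' (∑ j, θ j * z j) := fun i z => by
      simp only [uR, Finset.sum_mul]
      exact Finset.sum_congr rfl fun j _ => by ring
    simp only [e1, e2, integral_const_mul] at hB
    rw [sub_add, ← Finset.sum_sub_distrib] at hB
    rw [← hB]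
    congr 1
    exact Finset.sum_congr rfl fun i _ => by ring
  · simp only [one_mul]
    exact (hb _).trans (by nlinarith)
  · rw [pd1_comp_linForm θ hg, one_mul, abs_mul]
    have := mul_le_mul (hDj j) (hb' (∑ j, θ j * z j)) (abs_nonneg _) hD0
    nlinarith
  · rw [pd2_comp_linForm θ hg hg', abs_mul, abs_mul]
    have := mul_le_mul (mul_le_mul (hDj j) (hDj i) (abs_nonneg _) hD0)
      (hb'' (∑ j, θ j * z j)) (abs_nonneg _) (by positivity)
    nlinarith

/-- The basic adjoint relationship for complex exponentials. -/
theorem SatisfiesBAR.coordCharFun {d : ℕ} {Γ R : Matrix (Fin d) (Fin d) ℝ} {r : ℝ}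
    {π : Measure (Fin d → ℝ)} {ν : Fin d → Measure (Fin d → ℝ)} [IsFiniteMeasure π]
    [∀ i, IsFiniteMeasure (ν i)] (h : SatisfiesBAR Γ R r π ν) (θ : Fin d → ℝ) :
    1 / 2 * (quadForm Γ θ : ℂ) * coordCharFun π θ + Complex.I *
      ∑ i : Fin d, ((r ^ ((i : ℕ) + 1) * uR R θ i : ℝ) : ℂ) *
        (coordCharFun π θ - coordCharFun (ν i) θ) = 0 := by
  have hcos := h.comp_linForm θ (g := Real.cos) (g' := fun x => -Real.sin x)
    (g'' := fun x => -Real.cos x) Real.contDiff_cos Real.hasDerivAt_cos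
    (fun x => (Real.hasDerivAt_sin x).neg) Real.abs_cos_le_one
    (fun x => by rw [abs_neg]; exact Real.abs_sin_le_one x)
    (fun x => by rw [abs_neg]; exact Real.abs_cos_le_one x)
  have hsin := h.comp_linForm θ (g := Real.sin) (g' := Real.cos)
    (g'' := fun x => -Real.sin x) Real.contDiff_sin Real.hasDerivAt_sin
    Real.hasDerivAt_cos Real.abs_sin_le_one Real.abs_cos_le_one
    (fun x => by rw [abs_neg]; exact Real.abs_sin_le_one x)
  simp only [integral_neg] at hcos hsin
  simp only [coordCharFun_eq]
  generalize ∫ z, Real.cos (∑ j, θ j * z j) ∂π = a at *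
  generalize ∫ z, Real.sin (∑ j, θ j * z j) ∂π = b at *
  set SA : ℝ := ∑ i : Fin d, r ^ ((i : ℕ) + 1) * (uR R θ i *
    (a - ∫ z, Real.cos (∑ j, θ j * z j) ∂(ν i))) with hSA
  set SB : ℝ := ∑ i : Fin d, r ^ ((i : ℕ) + 1) * (uR R θ i *
    (-b - -∫ z, Real.sin (∑ j, θ j * z j) ∂(ν i))) with hSB
  have e : ∑ i : Fin d, ((r ^ ((i : ℕ) + 1) * uR R θ i : ℝ) : ℂ) *
      ((a : ℂ) + b * Complex.I - (((∫ z, Real.cos (∑ j, θ j * z j) ∂(ν i) : ℝ) : ℂ) +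
      ((∫ z, Real.sin (∑ j, θ j * z j) ∂(ν i) : ℝ) : ℂ) * Complex.I)) =
      (SA : ℂ) - SB * Complex.I := by
    rw [hSA, hSB]
    push_cast
    rw [Finset.sum_mul, ← Finset.sum_sub_distrib]
    exact Finset.sum_congr rfl fun i _ => by ring
  rw [e]
  clear_value SA SB
  have h1 := congrArg Complex.ofReal hcos
  have h2 := congrArg Complex.ofReal hsin
  push_cast at h1 h2
  linear_combination -h1 - Complex.I * h2 - SB * Complex.I_sq

theorem norm_cexp_sub_le (x y : ℝ) :
    ‖Complex.exp ((x : ℂ) * Complex.I) - Complex.exp ((y : ℂ) * Complex.I)‖ ≤ |x - y| := by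
  have e : Complex.exp ((x : ℂ) * Complex.I) - Complex.exp ((y : ℂ) * Complex.I) =
      Complex.exp ((y : ℂ) * Complex.I) *
        (Complex.exp (Complex.I * ((x - y : ℝ) : ℂ)) - 1) := by
    rw [mul_sub, ← Complex.exp_add, mul_one]
    congr 2
    push_cast
    ring
  rw [e, norm_mul, Complex.norm_exp_ofReal_mul_I, one_mul]
  exact Real.norm_exp_I_mul_ofReal_sub_one_le

theorem norm_coordCharFun_sub_le {d : ℕ} (μ : Measure (Fin d → ℝ)) [IsProbabilityMeasure μ]
    (a b : Fin d → ℝ) {B : Set (Fin d → ℝ)} (hB : MeasurableSet B) {ε : ℝ} (hε : 0 ≤ ε)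
    (h : ∀ᵐ z ∂μ, z ∉ B → |∑ j, (a j - b j) * z j| ≤ ε) :
    ‖coordCharFun μ a - coordCharFun μ b‖ ≤ ε + 2 * μ.real B := by
  have ha := integrable_cexp_linForm μ a
  have hb := integrable_cexp_linForm μ b
  rw [coordCharFun, coordCharFun, ← integral_sub ha hb]
  refine (norm_integral_le_integral_norm _).trans ?_
  have h1 := integral_le_add_measureReal (μ := μ) ((ha.sub hb).norm.const_mul (1 / 2))
    (integrable_const (ε / 2)) hB (B := B) ?_ fun z => ?_
  · rw [integral_const_mul, integral_const, smul_eq_mul, probReal_univ, one_mul] at h1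
    simp only [Pi.sub_apply] at h1
    linarith
  · filter_upwards [h] with z hz hzB
    have h2 := norm_cexp_sub_le (∑ j, a j * z j) (∑ j, b j * z j)
    rw [← Finset.sum_sub_distrib] at h2
    simp only [← sub_mul] at h2
    have := h2.trans (hz hzB)
    simp only [Pi.sub_apply]
    linarith
  · have h2 := norm_sub_le (Complex.exp (((∑ j, a j * z j : ℝ) : ℂ) * Complex.I))
      (Complex.exp (((∑ j, b j * z j : ℝ) : ℂ) * Complex.I))
    rw [Complex.norm_exp_ofReal_mul_I, Complex.norm_exp_ofReal_mul_I] at h2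
    simp only [Pi.sub_apply]
    linarith

theorem continuous_quadForm {d : ℕ} (Γ : Matrix (Fin d) (Fin d) ℝ) : Continuous (quadForm Γ) := by
  unfold quadForm
  fun_prop

theorem continuous_uR {d : ℕ} (R : Matrix (Fin d) (Fin d) ℝ) (i : Fin d) :
    Continuous fun v => uR R v i := by
  unfold uR
  fun_prop

theorem quadForm_smul {d : ℕ} (Γ : Matrix (Fin d) (Fin d) ℝ) (c : ℝ) (v : Fin d → ℝ) :
    quadForm Γ (c • v) = c ^ 2 * quadForm Γ v := by
  simp only [quadForm, Finset.mul_sum, Pi.smul_apply, smul_eq_mul]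
  exact Finset.sum_congr rfl fun i _ => Finset.sum_congr rfl fun j _ => by ring

theorem eventually_mem_Ioo_one : ∀ᶠ q : ℝ in nhdsWithin 0 (Set.Ioi 0), 0 < q ∧ q < 1 :=
  Ioo_mem_nhdsGT one_pos

/-- Asymptotic form of the basic adjoint relationship at frequencies of order `σ r^(k+1)`. -/
theorem BARFamily.tendsto_coordCharFun {d : ℕ} {Γ R : Matrix (Fin d) (Fin d) ℝ}
    {π : ℝ → Measure (Fin d → ℝ)} {ν : Fin d → ℝ → Measure (Fin d → ℝ)}
    (h : BARFamily Γ R π ν) (k : Fin d) {σ : ℝ → ℝ} {σ₀ : ℝ} {η : ℝ → Fin d → ℝ} {η₀ : Fin d → ℝ}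
    {κ : ℝ} (hσ : Tendsto σ (nhdsWithin 0 (Set.Ioi 0)) (nhds σ₀)) (hσ0 : ∀ q, 0 < q → 0 < σ q)
    (hη : Tendsto η (nhdsWithin 0 (Set.Ioi 0)) (nhds η₀)) (h0 : ∀ q, ∀ i < k, uR R (η q) i = 0)
    (hκ : ∀ q, uR R (η q) k = κ) :
    Tendsto (fun q => 1 / 2 * ((σ₀ * quadForm Γ η₀ : ℝ) : ℂ) *
        coordCharFun (π (q ^ 4)) ((σ q * (q ^ 4) ^ ((k : ℕ) + 1)) • η q) +
      Complex.I * κ * (coordCharFun (π (q ^ 4)) ((σ q * (q ^ 4) ^ ((k : ℕ) + 1)) • η q) -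
        coordCharFun (ν k (q ^ 4)) ((σ q * (q ^ 4) ^ ((k : ℕ) + 1)) • η q)))
      (nhdsWithin 0 (Set.Ioi 0)) (nhds 0) := by
  have hq0 : Tendsto (fun q : ℝ => q) (nhdsWithin 0 (Set.Ioi 0)) (nhds 0) :=
    tendsto_id.mono_left nhdsWithin_le_nhds
  have hbd : Tendsto (fun q => |σ₀ * quadForm Γ η₀ - σ q * quadForm Γ (η q)| +
      ∑ i ∈ Finset.Ioi k, (q ^ 4) ^ ((i : ℕ) - (k : ℕ)) * |uR R (η q) i| * 2)
      (nhdsWithin 0 (Set.Ioi 0)) (nhds 0) := by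
    have e : |σ₀ * quadForm Γ η₀ - σ₀ * quadForm Γ η₀| +
        ∑ i ∈ Finset.Ioi k, 0 * |uR R η₀ i| * 2 = 0 := by simp
    rw [← congrArg nhds e]
    refine (tendsto_const_nhds.sub (hσ.mul (((continuous_quadForm Γ).tendsto _).comp hη))).abs.add
      (tendsto_finsetSum _ fun i hi => ?_)
    refine Tendsto.mul_const _ (Tendsto.mul ?_ (((continuous_uR R i).tendsto _).comp hη).abs)
    have hki : (k : ℕ) < i := by simpa using hi
    have := (hq0.pow 4).pow ((i : ℕ) - (k : ℕ))
    rwa [zero_pow (by norm_num), zero_pow (by omega)] at this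
  refine squeeze_zero_norm' ?_ hbd
  filter_upwards [eventually_mem_Ioo_one] with q hq
  have hr := pow_four_mem_Ioo hq.1 hq.2
  obtain ⟨h1, -, h3, h4⟩ := h _ hr
  have hν := fun i => (h3 i).1
  set r := q ^ 4 with hrdef
  have hr0 : 0 < r := hr.1
  have hs := hσ0 q hq.1
  set c := σ q * r ^ ((k : ℕ) + 1) with hc
  set θ := c • η q with hθ
  have hbar := h4.coordCharFun θ
  set φ := SRBMPaper.coordCharFun (π r) θ with hφ
  have hφ1 : ‖φ‖ ≤ 1 := norm_coordCharFun_le _ _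
  have hφν : ∀ i, ‖φ - SRBMPaper.coordCharFun (ν i r) θ‖ ≤ 2 := fun i =>
    (norm_sub_le _ _).trans (by linarith [norm_coordCharFun_le (ν i r) θ])
  set ψ := fun i => φ - SRBMPaper.coordCharFun (ν i r) θ with hψ
  set S : ℂ := ∑ i ∈ Finset.Ioi k, ((r ^ ((i : ℕ) - (k : ℕ)) * uR R (η q) i : ℝ) : ℂ) * ψ i
    with hS
  have hsum : ∑ i : Fin d, ((r ^ ((i : ℕ) + 1) * uR R θ i : ℝ) : ℂ) * ψ i =
      ((c * r ^ ((k : ℕ) + 1) : ℝ) : ℂ) * (κ * ψ k + S) := by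
    have e1 : ∑ i : Fin d, ((r ^ ((i : ℕ) + 1) * uR R θ i : ℝ) : ℂ) * ψ i =
        ∑ i ∈ insert k (Finset.Ioi k), ((r ^ ((i : ℕ) + 1) * uR R θ i : ℝ) : ℂ) * ψ i := by
      symm
      refine Finset.sum_subset (Finset.subset_univ _) fun i _ hi => ?_
      have : i < k := by
        simp only [Finset.mem_insert, Finset.mem_Ioi, not_or, not_lt] at hi
        exact lt_of_le_of_ne hi.2 hi.1
      rw [hθ, uR_smul, h0 q i this]
      simp
    rw [e1, Finset.sum_insert (by simp), mul_add, hS, Finset.mul_sum]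
    congr 1
    · rw [hθ, uR_smul, hκ]
      push_cast
      ring
    · refine Finset.sum_congr rfl fun i hi => ?_
      have hki : (k : ℕ) < i := by simpa using hi
      have : (i : ℕ) + 1 = ((k : ℕ) + 1) + ((i : ℕ) - (k : ℕ)) := by omega
      rw [hθ, uR_smul, this, pow_add]
      push_cast
      ring
  rw [hsum, hθ, quadForm_smul] at hbar
  have hcr : ((c * r ^ ((k : ℕ) + 1) : ℝ) : ℂ) ≠ 0 := by
    have : c * r ^ ((k : ℕ) + 1) ≠ 0 := by positivity
    exact_mod_cast this
  have hkey : 1 / 2 * ((σ q * quadForm Γ (η q) : ℝ) : ℂ) * φ + Complex.I * (κ * ψ k + S) = 0 := by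
    refine mul_left_cancel₀ hcr ?_
    rw [mul_zero, ← hbar, hc]
    push_cast
    ring
  have hfin : 1 / 2 * ((σ₀ * quadForm Γ η₀ : ℝ) : ℂ) * φ + Complex.I * κ * ψ k =
      1 / 2 * ((σ₀ * quadForm Γ η₀ - σ q * quadForm Γ (η q) : ℝ) : ℂ) * φ - Complex.I * S := by
    rw [Complex.ofReal_sub]
    linear_combination hkey
  change ‖1 / 2 * ((σ₀ * quadForm Γ η₀ : ℝ) : ℂ) * φ + Complex.I * κ * ψ k‖ ≤ _
  rw [hfin]
  refine (norm_sub_le _ _).trans (add_le_add ?_ ?_)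
  · rw [norm_mul, norm_mul, Complex.norm_real, Real.norm_eq_abs]
    have : ‖(1 / 2 : ℂ)‖ ≤ 1 := by norm_num
    calc _ ≤ 1 * |σ₀ * quadForm Γ η₀ - σ q * quadForm Γ (η q)| * 1 := by gcongr
      _ = _ := by ring
  · rw [norm_mul, Complex.norm_I, one_mul]
    refine (norm_sum_le _ _).trans (Finset.sum_le_sum fun i _ => ?_)
    rw [norm_mul, Complex.norm_real, Real.norm_eq_abs, abs_mul, abs_of_pos (pow_pos hr0 _)]
    exact mul_le_mul_of_nonneg_left (hφν i) (by positivity)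

/-- Characteristic functions at nearby frequencies agree asymptotically when the levels escape the
over-sets only with rapidly decaying probability. -/
theorem tendsto_coordCharFun_sub {d : ℕ} {μ : ℝ → Measure (Fin d → ℝ)} {a b : ℝ → Fin d → ℝ}
    (S : Finset (Fin d)) {C : ℝ} (hC : 0 ≤ C)
    (hμ : ∀ q, 0 < q → q < 1 → IsProbabilityMeasure (μ q) ∧ ∀ᵐ z ∂μ q, z ∈ posOrthant d)
    (hS : ∀ j ∈ S, RapidDecay fun q => (μ q).real (overSet q j))
    (hab : ∀ q, 0 < q → q < 1 → ∀ j ∈ S, |a q j - b q j| ≤ C * q ^ 3 * (q ^ 4) ^ ((j : ℕ) + 1))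
    (h0 : ∀ q, 0 < q → q < 1 → ∀ j ∉ S, ∀ᵐ z ∂μ q, (a q j - b q j) * z j = 0) :
    Tendsto (fun q => coordCharFun (μ q) (a q) - coordCharFun (μ q) (b q))
      (nhdsWithin 0 (Set.Ioi 0)) (nhds 0) := by
  have hq0 : Tendsto (fun q : ℝ => q) (nhdsWithin 0 (Set.Ioi 0)) (nhds 0) :=
    tendsto_id.mono_left nhdsWithin_le_nhds
  have hlim : Tendsto (fun q => S.card * (2 * C * q) +
      2 * ∑ j ∈ S, (μ q).real (overSet q j)) (nhdsWithin 0 (Set.Ioi 0)) (nhds 0) := by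
    have h1 : Tendsto (fun q : ℝ => (S.card : ℝ) * (2 * C * q)) (nhdsWithin 0 (Set.Ioi 0))
        (nhds 0) := by
      simpa using (hq0.const_mul (2 * C)).const_mul (S.card : ℝ)
    have h2 : Tendsto (fun q => ∑ j ∈ S, (μ q).real (overSet q j)) (nhdsWithin 0 (Set.Ioi 0))
        (nhds 0) := by
      simpa using (RapidDecay.sum hS).tendsto_pow_div 0
    simpa using h1.add (h2.const_mul 2)
  refine squeeze_zero_norm' ?_ hlim
  filter_upwards [eventually_mem_Ioo_one] with q ⟨hq, hq1⟩
  obtain ⟨hp, hpos⟩ := hμ q hq hq1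
  have hB : MeasurableSet (⋃ j ∈ S, overSet q j) :=
    S.measurableSet_biUnion fun j _ => measurableSet_overSet q j
  have h0' : ∀ᵐ z ∂μ q, ∀ j ∉ S, (a q j - b q j) * z j = 0 := by
    rw [ae_all_iff]
    intro j
    by_cases hj : j ∈ S
    · simp [hj]
    · filter_upwards [h0 q hq hq1 j hj] with z hz _ using hz
  refine (norm_coordCharFun_sub_le (μ q) (a q) (b q) hB (ε := S.card * (2 * C * q))
    (by positivity) ?_).trans ?_
  · filter_upwards [hpos, h0'] with z hz hz0 hzB
    rw [← Finset.sum_subset S.subset_univ fun j _ hj => hz0 j hj]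
    refine (Finset.abs_sum_le_sum_abs _ _).trans ?_
    rw [← nsmul_eq_mul]
    refine Finset.sum_le_card_nsmul _ _ _ fun j hj => ?_
    have hzj : (q ^ 4) ^ ((j : ℕ) + 1) * q ^ 2 * z j ≤ 2 := by
      simp only [Set.mem_iUnion, not_exists] at hzB
      simpa [overSet] using hzB j hj
    rw [abs_mul, abs_of_nonneg (hz j)]
    calc |a q j - b q j| * z j ≤ C * q ^ 3 * (q ^ 4) ^ ((j : ℕ) + 1) * z j :=
          mul_le_mul_of_nonneg_right (hab q hq hq1 j hj) (hz j)
      _ = C * q * ((q ^ 4) ^ ((j : ℕ) + 1) * q ^ 2 * z j) := by ring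
      _ ≤ C * q * 2 := by gcongr
      _ = 2 * C * q := by ring
  · gcongr
    exact measureReal_biUnion_finset_le _ _

/-- The frequency `∑_{ℓ ≥ n} r^(ℓ+1) s_ℓ u_ℓ`. -/
def ladderFreq {d : ℕ} (u : Fin d → Fin d → ℝ) (s : Fin d → ℝ) (n : ℕ) (r : ℝ) : Fin d → ℝ :=
  ∑ l ∈ Finset.univ.filter (fun l : Fin d => n ≤ (l : ℕ)), (r ^ ((l : ℕ) + 1) * s l) • u l

/-- The renormalised frequency `∑_{ℓ ≥ n} r^(ℓ-n) s_ℓ u_ℓ`. -/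
def ladderTail {d : ℕ} (u : Fin d → Fin d → ℝ) (s : Fin d → ℝ) (n : ℕ) (r : ℝ) : Fin d → ℝ :=
  ∑ l ∈ Finset.univ.filter (fun l : Fin d => n ≤ (l : ℕ)), (r ^ ((l : ℕ) - n) * s l) • u l

theorem ladderFreq_eq_smul {d : ℕ} (u : Fin d → Fin d → ℝ) (s : Fin d → ℝ) (n : ℕ) (r : ℝ) :
    ladderFreq u s n r = r ^ (n + 1) • ladderTail u s n r := by
  rw [ladderFreq, ladderTail, Finset.smul_sum]
  refine Finset.sum_congr rfl fun l hl => ?_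
  have hl : n ≤ (l : ℕ) := by simpa using hl
  rw [smul_smul, ← mul_assoc, ← pow_add]
  congr 3
  omega

theorem ladderFreq_succ {d : ℕ} (u : Fin d → Fin d → ℝ) (s : Fin d → ℝ) (k : Fin d) (r : ℝ) :
    ladderFreq u s k r =
      (r ^ ((k : ℕ) + 1) * s k) • u k + ladderFreq u s ((k : ℕ) + 1) r := by
  have : Finset.univ.filter (fun l : Fin d => (k : ℕ) ≤ (l : ℕ)) =
      insert k (Finset.univ.filter fun l : Fin d => (k : ℕ) + 1 ≤ (l : ℕ)) := by
    ext l
    simp only [Finset.mem_filter, Finset.mem_univ, true_and, Finset.mem_insert, Fin.ext_iff]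
    omega
  rw [ladderFreq, this, Finset.sum_insert (by simp), ladderFreq]

theorem ladderFreq_of_le {d : ℕ} (u : Fin d → Fin d → ℝ) (s : Fin d → ℝ) {n : ℕ} (hn : d ≤ n)
    (r : ℝ) : ladderFreq u s n r = 0 := by
  rw [ladderFreq, Finset.sum_eq_zero]
  intro l hl
  have hl : n ≤ (l : ℕ) := by simpa using hl
  omega

theorem uR_ladderTail {d : ℕ} {R : Matrix (Fin d) (Fin d) ℝ} {u : Fin d → Fin d → ℝ}
    (hu : ∀ k, IsUk R k (u k)) (s : Fin d → ℝ) {n : ℕ} (r : ℝ) {i : Fin d} (hi : (i : ℕ) < n) :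
    uR R (ladderTail u s n r) i = 0 := by
  rw [ladderTail, uR_sum, Finset.sum_eq_zero]
  intro l hl
  have hl : n ≤ (l : ℕ) := by simpa using hl
  rw [uR_smul, (hu l).uR_eq_zero (by rw [Fin.lt_def]; omega), mul_zero]

theorem continuous_ladderTail {d : ℕ} (u : Fin d → Fin d → ℝ) (s : Fin d → ℝ) (n : ℕ) :
    Continuous (ladderTail u s n) := by
  unfold ladderTail
  fun_prop

/-- Asymptotic form of the basic adjoint relationship along the ladder frequencies, at the scale
`σ r^(k+1)`. -/
theorem BARFamily.tendsto_ladder {d : ℕ} {Γ R : Matrix (Fin d) (Fin d) ℝ}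
    {π : ℝ → Measure (Fin d → ℝ)} {ν : Fin d → ℝ → Measure (Fin d → ℝ)}
    (h : BARFamily Γ R π ν) {u : Fin d → Fin d → ℝ} (hu : ∀ k, IsUk R k (u k))
    (s : Fin d → ℝ) (k : Fin d) {σ τ : ℝ → ℝ} {σ₀ : ℝ}
    (hσ : Tendsto σ (nhdsWithin 0 (Set.Ioi 0)) (nhds σ₀)) (hσ0 : ∀ q, 0 < q → 0 < σ q)
    (hτ : Tendsto τ (nhdsWithin 0 (Set.Ioi 0)) (nhds 0)) (hστ : ∀ q, σ q * τ q = q ^ 4)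
    {θ : ℝ → Fin d → ℝ}
    (hθ : ∀ q, θ q = (σ q * (q ^ 4) ^ ((k : ℕ) + 1) * s k) • u k +
      ladderFreq u s ((k : ℕ) + 1) (q ^ 4)) :
    Tendsto (fun q => 1 / 2 * ((σ₀ * quadForm Γ (s k • u k) : ℝ) : ℂ) *
        coordCharFun (π (q ^ 4)) (θ q) +
      Complex.I * ((s k * uR R (u k) k : ℝ) : ℂ) *
        (coordCharFun (π (q ^ 4)) (θ q) - coordCharFun (ν k (q ^ 4)) (θ q)))
      (nhdsWithin 0 (Set.Ioi 0)) (nhds 0) := by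
  have hq0 : Tendsto (fun q : ℝ => q) (nhdsWithin 0 (Set.Ioi 0)) (nhds 0) :=
    tendsto_id.mono_left nhdsWithin_le_nhds
  have hη : Tendsto (fun q => s k • u k + τ q • ladderTail u s ((k : ℕ) + 1) (q ^ 4))
      (nhdsWithin 0 (Set.Ioi 0)) (nhds (s k • u k)) := by
    have h1 := ((continuous_ladderTail u s ((k : ℕ) + 1)).tendsto _).comp (hq0.pow 4)
    simpa using tendsto_const_nhds.add (hτ.smul h1)
  have e : ∀ q, θ q = (σ q * (q ^ 4) ^ ((k : ℕ) + 1)) •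
      (s k • u k + τ q • ladderTail u s ((k : ℕ) + 1) (q ^ 4)) := fun q => by
    rw [hθ, ladderFreq_eq_smul, smul_add, smul_smul, smul_smul]
    congr 2
    rw [mul_right_comm, hστ, pow_succ' _ ((k : ℕ) + 1)]
  simp only [e]
  refine h.tendsto_coordCharFun k hσ hσ0 hη (fun q i hi => ?_) fun q => ?_
  · rw [uR_add, uR_smul, uR_smul, (hu k).uR_eq_zero hi, uR_ladderTail hu s _ (by
      rw [Fin.lt_def] at hi; omega)]
    simp
  · rw [uR_add, uR_smul, uR_smul, uR_ladderTail hu s _ (by omega)]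
    simp

theorem BARFamily.tendsto_ladder_step {d : ℕ} {Γ R : Matrix (Fin d) (Fin d) ℝ} (hR : IsPMatrix R)
    {π : ℝ → Measure (Fin d → ℝ)} {ν : Fin d → ℝ → Measure (Fin d → ℝ)}
    (h : BARFamily Γ R π ν) {u : Fin d → Fin d → ℝ} (hu : ∀ k, IsUk R k (u k))
    (s : Fin d → ℝ) (k : Fin d) :
    Tendsto (fun q => (1 - Complex.I * ((meanOf Γ R (u k) k * s k : ℝ) : ℂ)) *
        coordCharFun (π (q ^ 4)) (ladderFreq u s k (q ^ 4)) -
      coordCharFun (π (q ^ 4)) (ladderFreq u s ((k : ℕ) + 1) (q ^ 4)))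
      (nhdsWithin 0 (Set.Ioi 0)) (nhds 0) := by
  by_cases hs : s k = 0
  · simp [ladderFreq_succ, hs]
  have hq0 : Tendsto (fun q : ℝ => q) (nhdsWithin 0 (Set.Ioi 0)) (nhds 0) :=
    tendsto_id.mono_left nhdsWithin_le_nhds
  set C : ℝ := ∑ j, |s k * u k j| with hC
  have hC0 : 0 ≤ C := Finset.sum_nonneg fun _ _ => abs_nonneg _
  have hCj : ∀ j, |s k * u k j| ≤ C := fun j =>
    Finset.single_le_sum (f := fun j => |s k * u k j|) (fun _ _ => abs_nonneg _)
      (Finset.mem_univ j)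
  set θ : ℝ → Fin d → ℝ := fun q => (q ^ 3 * (q ^ 4) ^ ((k : ℕ) + 1) * s k) • u k +
    ladderFreq u s ((k : ℕ) + 1) (q ^ 4) with hθ
  have hA := h.tendsto_ladder hu s k (σ := fun _ => 1) (τ := fun q => q ^ 4)
    tendsto_const_nhds (fun _ _ => one_pos) (by simpa using hq0.pow 4) (fun q => one_mul _)
    (θ := fun q => ladderFreq u s k (q ^ 4)) (fun q => by rw [ladderFreq_succ, one_mul])
  have hB := h.tendsto_ladder hu s k (σ := fun q => q ^ 3) (σ₀ := 0) (τ := fun q => q)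
    (by simpa using hq0.pow 3) (fun _ hq => pow_pos hq 3) hq0 (fun q => (pow_succ q 3).symm)
    (θ := θ) (fun q => rfl)
  have hν : Tendsto (fun q => coordCharFun (ν k (q ^ 4)) (ladderFreq u s k (q ^ 4)) -
      coordCharFun (ν k (q ^ 4)) (θ q)) (nhdsWithin 0 (Set.Ioi 0)) (nhds 0) := by
    have e : ∀ q j, ladderFreq u s k (q ^ 4) j - θ q j =
        (1 - q ^ 3) * (q ^ 4) ^ ((k : ℕ) + 1) * (s k * u k j) := fun q j => by
      simp only [hθ, ladderFreq_succ, Pi.add_apply, Pi.smul_apply, smul_eq_mul]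
      ring
    refine tendsto_coordCharFun_sub (Finset.Iio k) hC0 (fun q hq hq1 => ?_)
      (fun j hj => (h.rapidDecay_overSet hR j).2 k (Finset.mem_Iio.1 hj))
      (fun q hq hq1 j hj => ?_) fun q hq hq1 j hj => ?_
    · have hr := pow_four_mem_Ioo hq hq1
      exact ⟨((h _ hr).2.2.1 k).1, ((h.ae_mem hr).2 k).mono fun z hz => hz.1⟩
    · have hjk : (j : ℕ) < k := by simpa using hj
      have h3 : q ^ 3 ≤ 1 := pow_le_one₀ hq.le hq1.le
      have hp : 0 < q ^ 3 := pow_pos hq 3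
      rw [e, abs_mul, abs_of_nonneg (mul_nonneg (by linarith) (by positivity))]
      have h4 : (q ^ 4) ^ ((k : ℕ) + 1) ≤ (q ^ 4) ^ ((j : ℕ) + 1 + 1) :=
        pow_le_pow_of_le_one (by positivity) (pow_four_mem_Ioo hq hq1).2.le (by omega)
      have h5 : q ^ 4 ≤ q ^ 3 := pow_le_pow_of_le_one hq.le hq1.le (by norm_num)
      calc (1 - q ^ 3) * (q ^ 4) ^ ((k : ℕ) + 1) * |s k * u k j|
          ≤ 1 * (q ^ 4) ^ ((j : ℕ) + 1 + 1) * C := by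
            gcongr
            · linarith
            · exact hCj j
        _ = C * q ^ 4 * (q ^ 4) ^ ((j : ℕ) + 1) := by ring
        _ ≤ C * q ^ 3 * (q ^ 4) ^ ((j : ℕ) + 1) := by gcongr
    · filter_upwards [(h.ae_mem (pow_four_mem_Ioo hq hq1)).2 k] with z hz
      rcases eq_or_ne j k with rfl | hjk
      · rw [hz.2, mul_zero]
      · have : k < j := lt_of_le_of_ne (by simpa using hj) hjk.symm
        rw [e, (hu k).2.1 j this]
        simp
  have hπ : Tendsto (fun q => coordCharFun (π (q ^ 4)) (θ q) -
      coordCharFun (π (q ^ 4)) (ladderFreq u s ((k : ℕ) + 1) (q ^ 4)))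
      (nhdsWithin 0 (Set.Ioi 0)) (nhds 0) := by
    have e : ∀ q j, θ q j - ladderFreq u s ((k : ℕ) + 1) (q ^ 4) j =
        q ^ 3 * (q ^ 4) ^ ((k : ℕ) + 1) * (s k * u k j) := fun q j => by
      simp only [hθ, Pi.add_apply, Pi.smul_apply, smul_eq_mul]
      ring
    refine tendsto_coordCharFun_sub (Finset.Iic k) hC0 (fun q hq hq1 => ?_)
      (fun j hj => (h.rapidDecay_overSet hR j).1)
      (fun q hq hq1 j hj => ?_) fun q hq hq1 j hj => ?_
    · have hr := pow_four_mem_Ioo hq hq1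
      exact ⟨(h _ hr).1, (h.ae_mem hr).1⟩
    · have hjk : (j : ℕ) ≤ k := by simpa using hj
      rw [e, abs_mul, abs_of_nonneg (by positivity)]
      have h4 : (q ^ 4) ^ ((k : ℕ) + 1) ≤ (q ^ 4) ^ ((j : ℕ) + 1) :=
        pow_le_pow_of_le_one (by positivity) (pow_four_mem_Ioo hq hq1).2.le (by omega)
      calc q ^ 3 * (q ^ 4) ^ ((k : ℕ) + 1) * |s k * u k j|
          ≤ q ^ 3 * (q ^ 4) ^ ((j : ℕ) + 1) * C := by
            gcongr
            exact hCj j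
        _ = C * q ^ 3 * (q ^ 4) ^ ((j : ℕ) + 1) := by ring
    · refine ae_of_all _ fun z => ?_
      rw [e, (hu k).2.1 j (by simpa using hj)]
      simp
  have hρ : (uR R (u k) k : ℂ) ≠ 0 := by exact_mod_cast ((hu k).uR_pos hR).ne'
  have hsc : (s k : ℂ) ≠ 0 := by exact_mod_cast hs
  set c : ℂ := Complex.I * ((s k * uR R (u k) k : ℝ) : ℂ) with hc
  have hc0 : c ≠ 0 := by
    rw [hc]
    push_cast
    exact mul_ne_zero Complex.I_ne_zero (mul_ne_zero hsc hρ)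
  have hall := (((hA.add (hν.const_mul c)).sub hB).add (hπ.const_mul c)).const_mul c⁻¹
  rw [show c⁻¹ * (0 + c * 0 - 0 + c * 0) = 0 by simp] at hall
  refine hall.congr fun q => ?_
  refine mul_left_cancel₀ hc0 ?_
  rw [mul_inv_cancel_left₀ hc0, quadForm_smul]
  have hm : c * (Complex.I * ((meanOf Γ R (u k) k * s k : ℝ) : ℂ)) =
      -(1 / 2 * ((s k ^ 2 * quadForm Γ (u k) : ℝ) : ℂ)) := by
    rw [hc, meanOf]
    push_cast
    field_simp
    rw [Complex.I_sq]
    ring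
  rw [zero_mul, Complex.ofReal_zero, one_mul]
  linear_combination coordCharFun (π (q ^ 4)) (ladderFreq u s k (q ^ 4)) * hm

theorem one_sub_I_mul_ne_zero (x : ℝ) : 1 - Complex.I * (x : ℂ) ≠ 0 := fun h => by
  simpa using congrArg Complex.re h

theorem BARFamily.tendsto_ladderFreq {d : ℕ} {Γ R : Matrix (Fin d) (Fin d) ℝ} (hR : IsPMatrix R)
    {π : ℝ → Measure (Fin d → ℝ)} {ν : Fin d → ℝ → Measure (Fin d → ℝ)}
    (h : BARFamily Γ R π ν) {u : Fin d → Fin d → ℝ} (hu : ∀ k, IsUk R k (u k))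
    (s : Fin d → ℝ) {n : ℕ} (hn : n ≤ d) :
    Tendsto (fun q => coordCharFun (π (q ^ 4)) (ladderFreq u s n (q ^ 4)))
      (nhdsWithin 0 (Set.Ioi 0))
      (nhds (∏ l ∈ Finset.univ.filter (fun l : Fin d => n ≤ (l : ℕ)),
        (1 - Complex.I * ((meanOf Γ R (u l) l * s l : ℝ) : ℂ))⁻¹)) := by
  induction hn using Nat.decreasingInduction with
  | self =>
    have e : Finset.univ.filter (fun l : Fin d => d ≤ (l : ℕ)) = ∅ := by
      ext l
      simp
    rw [e, Finset.prod_empty]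
    refine tendsto_const_nhds.congr' ?_
    filter_upwards [eventually_mem_Ioo_one] with q hq
    have := (h _ (pow_four_mem_Ioo hq.1 hq.2)).1
    rw [ladderFreq_of_le u s le_rfl]
    simp [coordCharFun]
  | of_succ n hn ih =>
    set k : Fin d := ⟨n, hn⟩ with hk
    have e : Finset.univ.filter (fun l : Fin d => n ≤ (l : ℕ)) =
        insert k (Finset.univ.filter fun l : Fin d => n + 1 ≤ (l : ℕ)) := by
      ext l
      simp only [Finset.mem_filter, Finset.mem_univ, true_and, Finset.mem_insert, Fin.ext_iff, hk]
      omega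
    rw [e, Finset.prod_insert (by simp [hk])]
    have h1 := ((h.tendsto_ladder_step hR hu s k).add ih).const_mul
      (1 - Complex.I * ((meanOf Γ R (u k) k * s k : ℝ) : ℂ))⁻¹
    rw [zero_add] at h1
    refine h1.congr fun q => ?_
    rw [hk, sub_add_cancel, inv_mul_cancel_left₀ (one_sub_I_mul_ne_zero _)]

theorem BARFamily.tendsto_coordCharFun_scaled {d : ℕ} {Γ R : Matrix (Fin d) (Fin d) ℝ}
    (hR : IsPMatrix R) {π : ℝ → Measure (Fin d → ℝ)} {ν : Fin d → ℝ → Measure (Fin d → ℝ)}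
    (h : BARFamily Γ R π ν) {u : Fin d → Fin d → ℝ} (hu : ∀ k, IsUk R k (u k)) (s : Fin d → ℝ) :
    Tendsto (fun q => coordCharFun (π (q ^ 4)) fun l => (q ^ 4) ^ ((l : ℕ) + 1) * s l)
      (nhdsWithin 0 (Set.Ioi 0))
      (nhds (∏ l, (1 - Complex.I * ((meanOf Γ R (u l) l * s l : ℝ) : ℂ))⁻¹)) := by
  have h1 := h.tendsto_ladderFreq hR hu s (Nat.zero_le d)
  have e0 : Finset.univ.filter (fun l : Fin d => 0 ≤ (l : ℕ)) = Finset.univ := by simp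
  rw [e0] at h1
  set C : ℝ := ∑ l, ∑ j, |s l * u l j| with hC
  have hC0 : 0 ≤ C := Finset.sum_nonneg fun _ _ => Finset.sum_nonneg fun _ _ => abs_nonneg _
  have h2 : Tendsto (fun q => coordCharFun (π (q ^ 4)) (fun l => (q ^ 4) ^ ((l : ℕ) + 1) * s l) -
      coordCharFun (π (q ^ 4)) (ladderFreq u s 0 (q ^ 4))) (nhdsWithin 0 (Set.Ioi 0))
      (nhds 0) := by
    refine tendsto_coordCharFun_sub Finset.univ hC0 (fun q hq hq1 => ?_)
      (fun j _ => (h.rapidDecay_overSet hR j).1) (fun q hq hq1 j _ => ?_)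
      fun q hq hq1 j hj => absurd (Finset.mem_univ j) hj
    · have hr := pow_four_mem_Ioo hq hq1
      exact ⟨(h _ hr).1, (h.ae_mem hr).1⟩
    · have hr := pow_four_mem_Ioo hq hq1
      have h5 : q ^ 4 ≤ q ^ 3 := pow_le_pow_of_le_one hq.le hq1.le (by norm_num)
      rw [ladderFreq, e0, Finset.sum_apply, abs_sub_comm,
        ← Finset.add_sum_erase _ _ (Finset.mem_univ j)]
      rw [Pi.smul_apply, (hu j).1, smul_eq_mul, mul_one, add_sub_cancel_left]
      refine (Finset.abs_sum_le_sum_abs _ _).trans ?_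
      calc _ ≤ ∑ l ∈ Finset.univ.erase j,
            (∑ j, |s l * u l j|) * q ^ 3 * (q ^ 4) ^ ((j : ℕ) + 1) := by
            refine Finset.sum_le_sum fun l hl => ?_
            have hlj : l ≠ j := Finset.ne_of_mem_erase hl
            rcases lt_or_gt_of_ne hlj with hlt | hgt
            · rw [Pi.smul_apply, (hu l).2.1 j hlt, smul_zero, abs_zero]
              have : 0 ≤ ∑ j, |s l * u l j| := Finset.sum_nonneg fun _ _ => abs_nonneg _
              positivity
            · have hjl : (j : ℕ) < l := hgt
              have h4 : (q ^ 4) ^ ((l : ℕ) + 1) ≤ (q ^ 4) ^ ((j : ℕ) + 1 + 1) :=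
                pow_le_pow_of_le_one (by positivity) hr.2.le (by omega)
              have h6 : |s l * u l j| ≤ ∑ j, |s l * u l j| :=
                Finset.single_le_sum (f := fun j => |s l * u l j|) (fun _ _ => abs_nonneg _)
                  (Finset.mem_univ j)
              rw [Pi.smul_apply, smul_eq_mul, mul_assoc, abs_mul, abs_of_pos (pow_pos hr.1 _)]
              calc (q ^ 4) ^ ((l : ℕ) + 1) * |s l * u l j|
                  ≤ (q ^ 4) ^ ((j : ℕ) + 1 + 1) * ∑ j, |s l * u l j| := by gcongr
                _ = (∑ j, |s l * u l j|) * q ^ 4 * (q ^ 4) ^ ((j : ℕ) + 1) := by ring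
                _ ≤ _ := by gcongr
        _ ≤ ∑ l, (∑ j, |s l * u l j|) * q ^ 3 * (q ^ 4) ^ ((j : ℕ) + 1) :=
            Finset.sum_le_sum_of_subset_of_nonneg (Finset.subset_univ _) fun l _ _ => by positivity
        _ = _ := by rw [hC, Finset.sum_mul, Finset.sum_mul]
  simpa using h2.add h1

theorem expMean_eq_expMeasure (m : ℝ) : expMean m = ProbabilityTheory.expMeasure m⁻¹ := by
  change expMean m = volume.withDensity (ProbabilityTheory.exponentialPDF m⁻¹)
  rw [expMean]
  congr 1
  ext x
  rw [ProbabilityTheory.exponentialPDF_eq]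
  congr 4
  rw [neg_div, div_eq_inv_mul]

theorem isProbabilityMeasure_expMean {m : ℝ} (hm : 0 < m) : IsProbabilityMeasure (expMean m) := by
  rw [expMean_eq_expMeasure]
  exact ProbabilityTheory.isProbabilityMeasure_expMeasure (inv_pos.2 hm)

theorem charFun_expMean {m : ℝ} (hm : 0 < m) (t : ℝ) :
    charFun (expMean m) t = (1 - Complex.I * ((m * t : ℝ) : ℂ))⁻¹ := by
  have hmeas : Measurable fun x : ℝ => if 0 ≤ x then m⁻¹ * Real.exp (-x / m) else 0 :=
    Measurable.ite measurableSet_Ici (by fun_prop) measurable_const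
  have hmc : (m : ℂ) ≠ 0 := by exact_mod_cast hm.ne'
  have hre : (-(m : ℂ)⁻¹ + t * Complex.I).re < 0 := by simp [hm]
  rw [charFun_apply_real, expMean, integral_withDensity_eq_integral_toReal_smul hmeas.ennreal_ofReal
    (ae_of_all _ fun _ => ENNReal.ofReal_lt_top)]
  have e : (fun x : ℝ => (ENNReal.ofReal (if 0 ≤ x then m⁻¹ * Real.exp (-x / m) else 0)).toReal •
      Complex.exp (t * x * Complex.I)) = (Set.Ici 0).indicator fun x : ℝ =>
        (m : ℂ)⁻¹ * Complex.exp ((-(m : ℂ)⁻¹ + t * Complex.I) * x) := by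
    ext x
    by_cases hx : 0 ≤ x
    · rw [if_pos hx, ENNReal.toReal_ofReal (by positivity), Set.indicator_of_mem (Set.mem_Ici.2 hx),
        Complex.real_smul]
      push_cast
      rw [mul_assoc, ← Complex.exp_add]
      congr 2
      ring
    · rw [if_neg hx, Set.indicator_of_notMem (by simpa using hx)]
      simp
  rw [e, integral_indicator measurableSet_Ici, integral_Ici_eq_integral_Ioi, integral_const_mul,
    integral_exp_mul_complex_Ioi hre]
  have h0 : -(m : ℂ)⁻¹ + t * Complex.I ≠ 0 := fun h => by rw [h] at hre; simp at hre
  have h1 := one_sub_I_mul_ne_zero (m * t)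
  simp only [Complex.ofReal_zero, mul_zero, Complex.exp_zero]
  rw [mul_div_assoc', div_eq_iff h0, eq_comm, inv_mul_eq_iff_eq_mul₀ h1]
  push_cast
  field_simp
  ring

theorem measurable_toLp_scaled {d : ℕ} (c : Fin d → ℝ) :
    Measurable fun z : Fin d → ℝ => WithLp.toLp 2 fun i => c i * z i :=
  (WithLp.measurable_toLp 2 _).comp
    (measurable_pi_lambda _ fun i => measurable_const.mul (measurable_pi_apply i))

theorem charFun_map_scaled {d : ℕ} (μ : Measure (Fin d → ℝ)) (c : Fin d → ℝ)
    (t : EuclideanSpace ℝ (Fin d)) :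
    charFun (μ.map fun z => WithLp.toLp 2 fun i => c i * z i) t =
      coordCharFun μ fun l => c l * t l := by
  rw [charFun_apply, integral_map (measurable_toLp_scaled c).aemeasurable (by fun_prop), coordCharFun]
  congr 1
  ext z
  congr 3
  simp only [PiLp.inner_apply, RCLike.inner_apply, conj_trivial]
  exact Finset.sum_congr rfl fun i _ => by ring

/-- Lévy's continuity theorem in coordinates, for scaled laws. -/
theorem scaledWeakLimit_prodExp {d : ℕ} {π : ℝ → Measure (Fin d → ℝ)} {m : Fin d → ℝ}
    (hm : ∀ k, 0 < m k) (hπ : ∀ r ∈ Set.Ioo (0 : ℝ) 1, IsProbabilityMeasure (π r))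
    (h : ∀ t : Fin d → ℝ, Tendsto (fun r => coordCharFun (π r) fun l => r ^ ((l : ℕ) + 1) * t l)
      (nhdsWithin 0 (Set.Ioo 0 1)) (nhds (∏ l, (1 - Complex.I * ((m l * t l : ℝ) : ℂ))⁻¹))) :
    ScaledWeakLimit π (prodExp m) := by
  intro g
  have hexp : ∀ k, IsProbabilityMeasure (expMean (m k)) := fun k =>
    isProbabilityMeasure_expMean (hm k)
  have hF : nhdsWithin (0 : ℝ) (Set.Ioo 0 1) =
      map ((↑) : Set.Ioo (0 : ℝ) 1 → ℝ) (comap ((↑) : Set.Ioo (0 : ℝ) 1 → ℝ) (nhds 0)) :=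
    (subtype_coe_map_comap _ _).symm
  rw [hF, tendsto_map'_iff]
  refine tendsto_of_seq_tendsto fun x hx => ?_
  have hx' : Tendsto (fun n : ℕ => (x n : ℝ)) atTop (nhdsWithin 0 (Set.Ioo 0 1)) := by
    rw [hF]
    exact tendsto_map.comp hx
  have hp : ∀ n, IsProbabilityMeasure (π (x n)) := fun n => hπ _ (x n).2
  set P : ℕ → ProbabilityMeasure (EuclideanSpace ℝ (Fin d)) := fun n =>
    ⟨(π (x n)).map fun z => WithLp.toLp 2 fun i => (x n : ℝ) ^ ((i : ℕ) + 1) * z i,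
      Measure.isProbabilityMeasure_map (measurable_toLp_scaled _).aemeasurable⟩ with hP
  set P₀ : ProbabilityMeasure (EuclideanSpace ℝ (Fin d)) :=
    ⟨(Measure.pi fun k => expMean (m k)).map (WithLp.toLp 2),
      Measure.isProbabilityMeasure_map (WithLp.measurable_toLp 2 _).aemeasurable⟩ with hP₀
  have hlim : Tendsto P atTop (nhds P₀) := by
    refine ProbabilityMeasure.tendsto_of_tendsto_charFun fun t => ?_
    have e : charFun (P₀ : Measure (EuclideanSpace ℝ (Fin d))) t =
        ∏ l, (1 - Complex.I * ((m l * t l : ℝ) : ℂ))⁻¹ := by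
      rw [hP₀, ProbabilityMeasure.coe_mk, charFun_pi]
      exact Finset.prod_congr rfl fun k _ => charFun_expMean (hm k) _
    rw [e]
    refine ((h fun i => t i).comp hx').congr fun n => ?_
    rw [hP, ProbabilityMeasure.coe_mk, charFun_map_scaled]
    rfl
  have hg := (ProbabilityMeasure.tendsto_iff_forall_integral_tendsto.1 hlim)
    (g.compContinuous ⟨WithLp.ofLp, PiLp.continuous_ofLp 2 _⟩)
  have hgc : Continuous fun z : EuclideanSpace ℝ (Fin d) => g (WithLp.ofLp z) :=
    g.continuous.comp (PiLp.continuous_ofLp 2 _)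
  have e₀ : ∫ z, g (WithLp.ofLp z) ∂(P₀ : Measure (EuclideanSpace ℝ (Fin d))) =
      ∫ z, g z ∂(prodExp m) := by
    rw [hP₀, ProbabilityMeasure.coe_mk,
      integral_map (WithLp.measurable_toLp 2 _).aemeasurable
        hgc.measurable.aestronglyMeasurable, prodExp]
  have en : ∀ n, ∫ z, g (WithLp.ofLp z) ∂(P n : Measure (EuclideanSpace ℝ (Fin d))) =
      ∫ z, g (fun i => (x n : ℝ) ^ ((i : ℕ) + 1) * z i) ∂(π (x n)) := fun n => by
    rw [hP, ProbabilityMeasure.coe_mk,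
      integral_map (measurable_toLp_scaled _).aemeasurable hgc.measurable.aestronglyMeasurable]
  simp only [BoundedContinuousFunction.compContinuous_apply, ContinuousMap.coe_mk] at hg
  rw [← e₀]
  exact hg.congr en

theorem tendsto_nhdsWithin_Ioo_of_pow_four {E : Type*} [TopologicalSpace E] {f : ℝ → E} {a : E}
    (h : Tendsto (fun q => f (q ^ 4)) (nhdsWithin 0 (Set.Ioi 0)) (nhds a)) :
    Tendsto f (nhdsWithin 0 (Set.Ioo 0 1)) (nhds a) := by
  have h1 : Tendsto (fun r : ℝ => √√r) (nhdsWithin 0 (Set.Ioo 0 1))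
      (nhdsWithin 0 (Set.Ioi 0)) := by
    refine tendsto_nhdsWithin_iff.2 ⟨?_, ?_⟩
    · have : Tendsto (fun r : ℝ => √√r) (nhds 0) (nhds (√√0)) :=
        (Real.continuous_sqrt.comp Real.continuous_sqrt).tendsto 0
      simp only [Real.sqrt_zero] at this
      exact this.mono_left nhdsWithin_le_nhds
    · filter_upwards [self_mem_nhdsWithin] with r hr
      exact Real.sqrt_pos.2 (Real.sqrt_pos.2 hr.1)
  refine (h.comp h1).congr' ?_
  filter_upwards [self_mem_nhdsWithin] with r hr
  have : √√r ^ 4 = r := by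
    rw [show 4 = 2 * 2 from rfl, pow_mul, Real.sq_sqrt (Real.sqrt_nonneg _), Real.sq_sqrt hr.1.le]
  simp only [Function.comp, this]

/-- Steady-state convergence of SRBM in the multi-scaling regime for a
P-reflection matrix, assuming the uniform moment bound condition: the scaled stationary
distributions converge weakly to a product of independent exponentials with means
`m_k = (u_kᵀ Γ u_k)/(2 u_kᵀ R_{:,k}) > 0`. -/
theorem srbm_steady_state_convergence_P
    {d : ℕ} (hd : 1 ≤ d)
    (Γ R : Matrix (Fin d) (Fin d) ℝ)
    (hΓsymm : Γ.IsSymm) (hΓpd : Γ.PosDef)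
    (hR : IsPMatrix R)
    (π : ℝ → Measure (Fin d → ℝ)) (ν : Fin d → ℝ → Measure (Fin d → ℝ))
    (hBAR : BARFamily Γ R π ν)
    (hMom : UniformMomentBound π ν)
    (u : Fin d → Fin d → ℝ) (hu : ∀ k, IsUk R k (u k)) :
    (∀ k, 0 < meanOf Γ R (u k) k) ∧
    ScaledWeakLimit π (prodExp fun k => meanOf Γ R (u k) k) := by
  have hm : ∀ k, 0 < meanOf Γ R (u k) k := fun k => meanOf_pos hΓpd hR (hu k)
  exact ⟨hm, scaledWeakLimit_prodExp hm (fun r hr => (hBAR r hr).1) fun t =>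
    tendsto_nhdsWithin_Ioo_of_pow_four (hBAR.tendsto_coordCharFun_scaled hR hu t)⟩

end SRBMPaper
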